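/- The expected volume of the tetrahedron spanned by four i.i.d. uniform random points in a tetrahedron of volume 1 equals 13/720 − π²/15015. -/

import Mathlib

open MeasureTheory

theorem lintegral_Ioi_comp_add_right (f : ℝ → ENNReal) (a : ℝ) :
    ∫⁻ x in Set.Ioi a, f x = ∫⁻ x in Set.Ioi 0, f (a + x) := by
  have h := lintegral_image_eq_lintegral_abs_deriv_mul (f := fun x : ℝ => a + x)
    (f' := fun _ => 1) (s := Set.Ioi 0) measurableSet_Ioi
    (fun x _ => ((hasDerivAt_id x).const_add a).hasDerivWithinAt)
    (fun x _ y _ h => by simpa using h) f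
  simpa using h

theorem lintegral_Ioi_zero_comp_mul_left (f : ℝ → ENNReal) {c : ℝ} (hc : 0 < c) :
    ∫⁻ x in Set.Ioi 0, f x = ENNReal.ofReal c * ∫⁻ x in Set.Ioi 0, f (c * x) := by
  have h := lintegral_image_eq_lintegral_abs_deriv_mul (f := fun x : ℝ => c * x)
    (f' := fun _ => c) (s := Set.Ioi 0) measurableSet_Ioi
    (fun x _ => by simpa using ((hasDerivAt_id x).const_mul c).hasDerivWithinAt)
    (fun x _ y _ h => by simpa [hc.ne'] using h) f
  rw [Set.image_mul_left_Ioi hc, mul_zero] at h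
  rw [h, abs_of_pos hc, lintegral_const_mul' _ _ ENNReal.ofReal_ne_top]

theorem lintegral_Ioi_zero_comp_inv (f : ℝ → ENNReal) :
    ∫⁻ x in Set.Ioi 0, f x = ∫⁻ x in Set.Ioi 0, ENNReal.ofReal ((x ^ 2)⁻¹) * f x⁻¹ := by
  have h := lintegral_image_eq_lintegral_abs_deriv_mul (f := fun x : ℝ => x⁻¹)
    (f' := fun x => -(x ^ 2)⁻¹) (s := Set.Ioi 0) measurableSet_Ioi
    (fun x hx => (hasDerivAt_inv (ne_of_gt hx)).hasDerivWithinAt)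
    (fun x _ y _ h => by simpa using h) f
  have hi : (fun x : ℝ => x⁻¹) '' Set.Ioi 0 = Set.Ioi 0 := by
    ext y
    exact ⟨fun ⟨x, hx, e⟩ => e ▸ inv_pos.2 (Set.mem_Ioi.1 hx),
      fun hy => ⟨y⁻¹, inv_pos.2 (Set.mem_Ioi.1 hy), inv_inv y⟩⟩
  rw [hi] at h
  rw [h]
  refine lintegral_congr fun x => ?_
  rw [abs_neg, abs_of_nonneg (by positivity)]

theorem lintegral_Ioi_zero_comp_inv_sub_one (f : ℝ → ENNReal) :
    ∫⁻ x in Set.Ioi 0, f x =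
      ∫⁻ x in Set.Ioo 0 1, ENNReal.ofReal ((x ^ 2)⁻¹) * f (x⁻¹ - 1) := by
  have h := lintegral_image_eq_lintegral_abs_deriv_mul (f := fun x : ℝ => x⁻¹ - 1)
    (f' := fun x => -(x ^ 2)⁻¹) (s := Set.Ioo 0 1) measurableSet_Ioo
    (fun x hx => ((hasDerivAt_inv (ne_of_gt hx.1)).sub_const 1).hasDerivWithinAt)
    (fun x _ y _ h => by simpa using h) f
  have hi : (fun x : ℝ => x⁻¹ - 1) '' Set.Ioo 0 1 = Set.Ioi 0 := by
    ext y
    refine ⟨fun ⟨x, hx, e⟩ => e ▸ ?_, fun hy => ⟨(y + 1)⁻¹, ?_, by simp⟩⟩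
    · simpa using (one_lt_inv₀ hx.1).2 hx.2
    · have : (0 : ℝ) < y := hy
      exact ⟨by positivity, inv_lt_one_of_one_lt₀ (by linarith)⟩
  rw [hi] at h
  rw [h]
  refine lintegral_congr fun x => ?_
  rw [abs_neg, abs_of_nonneg (by positivity)]

theorem lintegral_eq_Ioi_add_Ioi_neg (f : ℝ → ENNReal) :
    ∫⁻ x, f x = (∫⁻ x in Set.Ioi 0, f x) + ∫⁻ x in Set.Ioi 0, f (-x) := by
  have h := lintegral_image_eq_lintegral_abs_deriv_mul (f := fun x : ℝ => -x)
    (f' := fun _ => -1) (s := Set.Ioi 0) measurableSet_Ioi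
    (fun x _ => ((hasDerivAt_id x).neg).hasDerivWithinAt)
    (fun x _ y _ h => by simpa using h) f
  rw [Set.image_neg_eq_neg, Set.neg_Ioi, neg_zero] at h
  simp only [abs_neg, abs_one, ENNReal.ofReal_one, one_mul] at h
  rw [← h, ← lintegral_add_compl f (measurableSet_Ioi (a := (0 : ℝ))), Set.compl_Ioi,
    setLIntegral_congr Iio_ae_eq_Iic]

theorem lintegral_quadrant_split {f : ℝ → ℝ → ENNReal} (hf : Measurable (Function.uncurry f)) :
    ∫⁻ x in Set.Ioi 0, ∫⁻ y in Set.Ioi 0, f x y =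
      (∫⁻ y in Set.Ioi 0, ∫⁻ m in Set.Ioi 0, f (y + m) y) +
        ∫⁻ x in Set.Ioi 0, ∫⁻ m in Set.Ioi 0, f x (x + m) := by
  have h1 : ∀ x ∈ Set.Ioi (0 : ℝ), ∫⁻ y in Set.Ioi 0, f x y =
      (∫⁻ y in Set.Ioi 0, (Set.Ioi y).indicator (fun x => f x y) x) +
        ∫⁻ m in Set.Ioi 0, f x (x + m) := by
    intro x hx
    rw [← lintegral_Ioi_comp_add_right (f x) x,
      ← lintegral_inter_add_sdiff (f x) (Set.Ioi 0) (measurableSet_Ioi (a := x)), add_comm]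
    congr 1
    · have : Set.Ioi (0 : ℝ) \ Set.Ioi x = Set.Ioc 0 x := by ext; simp
      rw [this, ← setLIntegral_congr Ioo_ae_eq_Ioc,
        ← lintegral_indicator measurableSet_Ioo, ← lintegral_indicator measurableSet_Ioi]
      refine lintegral_congr fun y => ?_
      by_cases h0 : 0 < y <;> by_cases h1 : y < x <;> simp [Set.indicator, h0, h1]
    · congr 2
      exact Set.inter_eq_right.2 (Set.Ioi_subset_Ioi (le_of_lt hx))
  have hm : Measurable (fun z : ℝ × ℝ => (Set.Ioi z.2).indicator (fun x => f x z.2) z.1) := by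
    have : (fun z : ℝ × ℝ => (Set.Ioi z.2).indicator (fun x => f x z.2) z.1) =
        {z : ℝ × ℝ | z.2 < z.1}.indicator (Function.uncurry f) := by
      ext z; simp [Set.indicator, Function.uncurry]
    rw [this]
    exact hf.indicator (measurableSet_lt measurable_snd measurable_fst)
  rw [setLIntegral_congr_fun measurableSet_Ioi h1, lintegral_add_left]
  · congr 1
    rw [lintegral_lintegral_swap hm.aemeasurable]
    refine setLIntegral_congr_fun measurableSet_Ioi fun y hy => ?_
    rw [← lintegral_Ioi_comp_add_right (fun x => f x y) y, lintegral_indicator measurableSet_Ioi,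
      Measure.restrict_restrict measurableSet_Ioi]
    congr 2
    exact Set.inter_eq_left.2 (Set.Ioi_subset_Ioi (le_of_lt hy))
  · exact hm.lintegral_prod_right'

theorem lintegral_quadratic_mul_exp {L : ℝ} (hL : 0 < L) {a b c : ℝ} (ha : 0 ≤ a) (hb : 0 ≤ b)
    (hc : 0 ≤ c) :
    ∫⁻ x in Set.Ioi 0, ENNReal.ofReal ((a + b * x + c * x ^ 2) * Real.exp (-(L * x))) =
      ENNReal.ofReal (a / L + b / L ^ 2 + 2 * c / L ^ 3) := by
  have key : ∀ k : ℕ, IntegrableOn (fun x : ℝ => x ^ k * Real.exp (-(L * x))) (Set.Ioi 0) ∧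
      ∫ x in Set.Ioi 0, x ^ k * Real.exp (-(L * x)) = k.factorial / L ^ (k + 1) := by
    intro k
    have h := Real.integral_rpow_mul_exp_neg_mul_Ioi (a := (k : ℝ) + 1) (by positivity) hL
    have e : (fun x : ℝ => x ^ ((k : ℝ) + 1 - 1) * Real.exp (-(L * x))) =
        fun x => x ^ k * Real.exp (-(L * x)) := by
      ext x; simp
    rw [e] at h
    have h2 : ∫ x in Set.Ioi 0, x ^ k * Real.exp (-(L * x)) = k.factorial / L ^ (k + 1) := by
      rw [h, Real.Gamma_nat_eq_factorial]
      have : ((k : ℝ) + 1) = ((k + 1 : ℕ) : ℝ) := by push_cast; ring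
      rw [this, Real.rpow_natCast, one_div, inv_pow]; field_simp
    refine ⟨?_, h2⟩
    by_contra hn
    rw [IntegrableOn] at hn
    rw [integral_undef hn] at h2
    have : (0 : ℝ) < k.factorial / L ^ (k + 1) := by positivity
    linarith
  have h0 := key 0
  have h1 := key 1
  have h2 := key 2
  rw [← ofReal_integral_eq_lintegral_ofReal]
  · congr 1
    have : ∀ x : ℝ, (a + b * x + c * x ^ 2) * Real.exp (-(L * x)) =
        a * (x ^ 0 * Real.exp (-(L * x))) + b * (x ^ 1 * Real.exp (-(L * x))) +
          c * (x ^ 2 * Real.exp (-(L * x))) := fun x => by ring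
    simp_rw [this]
    rw [integral_add, integral_add, integral_const_mul, integral_const_mul, integral_const_mul,
      h0.2, h1.2, h2.2]
    · simp [Nat.factorial]; ring
    · exact h0.1.const_mul a
    · exact h1.1.const_mul b
    · exact (h0.1.const_mul a).add (h1.1.const_mul b)
    · exact h2.1.const_mul c
  · have : (fun x : ℝ => (a + b * x + c * x ^ 2) * Real.exp (-(L * x))) = fun x =>
        a * (x ^ 0 * Real.exp (-(L * x))) + b * (x ^ 1 * Real.exp (-(L * x))) +
          c * (x ^ 2 * Real.exp (-(L * x))) := by ext x; ring
    rw [this]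
    exact ((h0.1.const_mul a).add (h1.1.const_mul b)).add (h2.1.const_mul c)
  · filter_upwards [ae_restrict_mem measurableSet_Ioi] with x hx
    have : (0 : ℝ) < x := hx
    positivity

theorem lintegral_quadratic_mul_exp_add {L : ℝ} (hL : 0 < L) {a b c : ℝ} (d : ℝ) (ha : 0 ≤ a)
    (hb : 0 ≤ b) (hc : 0 ≤ c) :
    ∫⁻ x in Set.Ioi 0, ENNReal.ofReal ((a + b * x + c * x ^ 2) * Real.exp (-(d + L * x))) =
      ENNReal.ofReal ((a / L + b / L ^ 2 + 2 * c / L ^ 3) * Real.exp (-d)) := by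
  have h : ∀ x : ℝ, ENNReal.ofReal ((a + b * x + c * x ^ 2) * Real.exp (-(d + L * x))) =
      ENNReal.ofReal ((a + b * x + c * x ^ 2) * Real.exp (-(L * x))) *
        ENNReal.ofReal (Real.exp (-d)) := fun x => by
    rw [← ENNReal.ofReal_mul' (Real.exp_nonneg _), mul_assoc, ← Real.exp_add]
    congr 3; ring
  simp_rw [h]
  rw [lintegral_mul_const' _ _ ENNReal.ofReal_ne_top, lintegral_quadratic_mul_exp hL ha hb hc,
    ENNReal.ofReal_mul' (Real.exp_nonneg _)]

theorem lintegral_bilinear_mul_exp {L₁ L₂ L₃ : ℝ} (h₁ : 0 < L₁) (h₂ : 0 < L₂) (h₃ : 0 < L₃)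
    {a₁ a₂ a₃ b₁ b₂ b₃ : ℝ} (ha₁ : 0 ≤ a₁) (ha₂ : 0 ≤ a₂) (ha₃ : 0 ≤ a₃) (hb₁ : 0 ≤ b₁)
    (hb₂ : 0 ≤ b₂) (hb₃ : 0 ≤ b₃) :
    ∫⁻ x in Set.Ioi 0, ∫⁻ y in Set.Ioi 0, ∫⁻ z in Set.Ioi 0,
      ENNReal.ofReal ((a₁ * x + a₂ * y + a₃ * z) * (b₁ * x + b₂ * y + b₃ * z) *
        Real.exp (-(L₁ * x + L₂ * y + L₃ * z))) =
      ENNReal.ofReal ((a₁ * b₁ / L₁ ^ 2 + a₂ * b₂ / L₂ ^ 2 + a₃ * b₃ / L₃ ^ 2 +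
        (a₁ / L₁ + a₂ / L₂ + a₃ / L₃) * (b₁ / L₁ + b₂ / L₂ + b₃ / L₃)) / (L₁ * L₂ * L₃)) := by
  have hz : ∀ x ∈ Set.Ioi (0 : ℝ), ∀ y ∈ Set.Ioi (0 : ℝ), ∫⁻ z in Set.Ioi 0,
      ENNReal.ofReal ((a₁ * x + a₂ * y + a₃ * z) * (b₁ * x + b₂ * y + b₃ * z) *
        Real.exp (-(L₁ * x + L₂ * y + L₃ * z))) =
      ENNReal.ofReal (((a₁ * b₁ / L₃ * x ^ 2 + (a₁ * b₃ + a₃ * b₁) / L₃ ^ 2 * x +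
          2 * (a₃ * b₃) / L₃ ^ 3) +
        ((a₁ * b₂ + a₂ * b₁) / L₃ * x + (a₂ * b₃ + a₃ * b₂) / L₃ ^ 2) * y +
        a₂ * b₂ / L₃ * y ^ 2) * Real.exp (-(L₁ * x + L₂ * y))) := by
    intro x hx y hy
    have hx : (0 : ℝ) < x := hx
    have hy : (0 : ℝ) < y := hy
    have := lintegral_quadratic_mul_exp_add h₃ (a := (a₁ * x + a₂ * y) * (b₁ * x + b₂ * y))
      (b := (a₁ * x + a₂ * y) * b₃ + a₃ * (b₁ * x + b₂ * y)) (c := a₃ * b₃) (L₁ * x + L₂ * y)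
      (by positivity) (by positivity) (by positivity)
    refine (lintegral_congr fun z => ?_).trans (this.trans ?_)
    · congr 2; ring
    · congr 2; ring
  have hy : ∀ x ∈ Set.Ioi (0 : ℝ), ∫⁻ y in Set.Ioi 0, ENNReal.ofReal (((a₁ * b₁ / L₃ * x ^ 2 +
        (a₁ * b₃ + a₃ * b₁) / L₃ ^ 2 * x + 2 * (a₃ * b₃) / L₃ ^ 3) +
        ((a₁ * b₂ + a₂ * b₁) / L₃ * x + (a₂ * b₃ + a₃ * b₂) / L₃ ^ 2) * y +
        a₂ * b₂ / L₃ * y ^ 2) * Real.exp (-(L₁ * x + L₂ * y))) =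
      ENNReal.ofReal (((2 * (a₃ * b₃) / L₃ ^ 3 / L₂ + (a₂ * b₃ + a₃ * b₂) / L₃ ^ 2 / L₂ ^ 2 +
          2 * (a₂ * b₂ / L₃) / L₂ ^ 3) +
        ((a₁ * b₃ + a₃ * b₁) / L₃ ^ 2 / L₂ + (a₁ * b₂ + a₂ * b₁) / L₃ / L₂ ^ 2) * x +
        a₁ * b₁ / L₃ / L₂ * x ^ 2) * Real.exp (-(0 + L₁ * x))) := by
    intro x hx
    have hx : (0 : ℝ) < x := hx
    rw [lintegral_quadratic_mul_exp_add h₂ (L₁ * x) (by positivity) (by positivity)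
      (by positivity)]
    congr 2
    · ring
    · ring_nf
  rw [setLIntegral_congr_fun measurableSet_Ioi fun x hx =>
    (setLIntegral_congr_fun measurableSet_Ioi (hz x hx)).trans (hy x hx),
    lintegral_quadratic_mul_exp_add h₁ 0 (by positivity) (by positivity) (by positivity)]
  congr 1
  rw [neg_zero, Real.exp_zero, mul_one]
  field_simp
  ring

section
variable {ι : Type*} [Fintype ι] [DecidableEq ι]

theorem det_sq_mul_prod_eq (w : (ι → ℝ) → ℝ) (N : ι → ι → ℝ) :
    (Matrix.of N).det ^ 2 * ∏ i, w (N i) =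
      ∑ σ : Equiv.Perm ι, ∑ τ : Equiv.Perm ι, ((Equiv.Perm.sign σ : ℤ) : ℝ) *
        (((Equiv.Perm.sign τ : ℤ) : ℝ) * ∏ i, N i (σ i) * N i (τ i) * w (N i)) := by
  rw [sq, ← Matrix.det_transpose, Matrix.det_apply', Finset.sum_mul_sum, Finset.sum_mul]
  refine Finset.sum_congr rfl fun σ _ => ?_
  rw [Finset.sum_mul]
  refine Finset.sum_congr rfl fun τ _ => ?_
  simp only [Matrix.transpose_apply, Matrix.of_apply, Finset.prod_mul_distrib]
  ring

theorem integrable_det_sq_mul_prod {w : (ι → ℝ) → ℝ}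
    (hw : ∀ i j, Integrable fun n : ι → ℝ => n i * n j * w n) :
    Integrable fun N : ι → ι → ℝ => (Matrix.of N).det ^ 2 * ∏ i, w (N i) := by
  simp_rw [det_sq_mul_prod_eq]
  refine integrable_finsetSum _ fun σ _ => integrable_finsetSum _ fun τ _ => ?_
  exact ((Integrable.fintype_prod (f := fun i (n : ι → ℝ) => n (σ i) * n (τ i) * w n)
    fun i => hw _ _).const_mul _).const_mul _

theorem integral_det_sq_mul_prod {w : (ι → ℝ) → ℝ}
    (hw : ∀ i j, Integrable fun n : ι → ℝ => n i * n j * w n) :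
    ∫ N : ι → ι → ℝ, (Matrix.of N).det ^ 2 * ∏ i, w (N i) =
      (Fintype.card ι).factorial *
        (Matrix.of fun i j => ∫ n : ι → ℝ, n i * n j * w n).det := by
  simp_rw [det_sq_mul_prod_eq]
  have hi : ∀ σ τ : Equiv.Perm ι, Integrable fun N : ι → ι → ℝ =>
      ∏ i, N i (σ i) * N i (τ i) * w (N i) := fun σ τ =>
    Integrable.fintype_prod (f := fun i (n : ι → ℝ) => n (σ i) * n (τ i) * w n) fun i => hw _ _
  rw [integral_finsetSum _ fun σ _ => integrable_finsetSum _ fun τ _ =>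
    ((hi σ τ).const_mul _).const_mul _]
  have key : ∀ σ : Equiv.Perm ι, ∫ N : ι → ι → ℝ, ∑ τ : Equiv.Perm ι,
      ((Equiv.Perm.sign σ : ℤ) : ℝ) * (((Equiv.Perm.sign τ : ℤ) : ℝ) *
        ∏ i, N i (σ i) * N i (τ i) * w (N i)) =
      (Matrix.of fun i j => ∫ n : ι → ℝ, n i * n j * w n).det := by
    intro σ
    rw [integral_finsetSum _ fun τ _ => ((hi σ τ).const_mul _).const_mul _]
    have hp : ∀ τ : Equiv.Perm ι, ∫ N : ι → ι → ℝ, ∏ i, N i (σ i) * N i (τ i) * w (N i) =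
        ∏ i, ∫ n : ι → ℝ, n (σ i) * n (τ i) * w n := fun τ =>
      integral_fintype_prod_eq_prod (fun i (n : ι → ℝ) => n (σ i) * n (τ i) * w n)
    simp_rw [integral_const_mul, hp, ← Finset.mul_sum]
    have hd := Matrix.det_permute σ (Matrix.of fun i j => ∫ n : ι → ℝ, n i * n j * w n)
    rw [← Matrix.det_transpose, Matrix.det_apply'] at hd
    simp only [Matrix.transpose_apply, Matrix.submatrix_apply, Matrix.of_apply, id] at hd
    rw [hd, ← mul_assoc]
    have : ((Equiv.Perm.sign σ : ℤ) : ℝ) * ((Equiv.Perm.sign σ : ℤ) : ℝ) = 1 := by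
      rw [← Int.cast_mul, ← Units.val_mul, Int.units_mul_self]; simp
    rw [this, one_mul]
  simp_rw [key]
  rw [Finset.sum_const, Finset.card_univ, Fintype.card_perm, nsmul_eq_mul]

end

theorem ae_det_ne_zero {ι : Type*} [Fintype ι] [DecidableEq ι] :
    ∀ᵐ N : ι → ι → ℝ, (Matrix.of N).det ≠ 0 := by
  have hc : Continuous fun N : ι → ι → ℝ => (Matrix.of N).det :=
    Continuous.matrix_det (by fun_prop)
  refine ae_mem_of_ae_add_linearMap_mem
    (LinearMap.toSpanSingleton ℝ (ι → ι → ℝ) (Matrix.of.symm (1 : Matrix ι ι ℝ))) volume volume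
    (s := {N | (Matrix.of N).det ≠ 0}) (isOpen_ne_fun hc continuous_const).measurableSet ?_
  intro N
  have hfin : {t : ℝ | (Matrix.charpoly (-(Matrix.of N))).IsRoot t}.Finite :=
    Polynomial.finite_setOfPred_isRoot (Matrix.charpoly_monic _).ne_zero
  refine (hfin.countable.ae_notMem volume).mono fun t ht => ?_
  simp only [Set.mem_ofPred_eq, Polynomial.IsRoot, Matrix.eval_charpoly] at ht ⊢
  convert ht using 2
  ext i j
  simp [Matrix.scalar_apply, Matrix.one_apply, Matrix.diagonal_apply, add_comm]

noncomputable def expWeight (x : ℝ) : ℝ := if 0 < x then Real.exp (-x) else 0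

theorem expWeight_nonneg (x : ℝ) : 0 ≤ expWeight x := by
  unfold expWeight; split_ifs <;> positivity

theorem expWeight_le_one (x : ℝ) : expWeight x ≤ 1 := by
  unfold expWeight; split_ifs with h
  · simpa using h.le
  · simp

@[fun_prop]
theorem measurable_expWeight : Measurable expWeight :=
  Measurable.ite measurableSet_Ioi (by fun_prop) measurable_const

theorem lintegral_expWeight_mul (f : ℝ → ENNReal) :
    ∫⁻ x, ENNReal.ofReal (expWeight x) * f x =
      ∫⁻ x in Set.Ioi 0, ENNReal.ofReal (Real.exp (-x)) * f x := by
  rw [← lintegral_indicator measurableSet_Ioi]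
  refine lintegral_congr fun x => ?_
  by_cases h : 0 < x <;> simp [expWeight, h]

/-- The weight of a row of the first three columns, the last column being their combination
with coefficients `p`. -/
noncomputable def rowWeight (p n : Fin 3 → ℝ) : ℝ :=
  (∏ j, expWeight (n j)) * expWeight (n ⬝ᵥ p)

theorem rowWeight_nonneg (p n : Fin 3 → ℝ) : 0 ≤ rowWeight p n :=
  mul_nonneg (Finset.prod_nonneg fun _ _ => expWeight_nonneg _) (expWeight_nonneg _)

theorem measurable_dotProduct_pair :
    Measurable fun q : (Fin 3 → ℝ) × (Fin 3 → ℝ) => q.2 ⬝ᵥ q.1 := by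
  simp only [dotProduct]; fun_prop

theorem measurable_uncurry_rowWeight : Measurable (Function.uncurry rowWeight) := by
  unfold rowWeight Function.uncurry
  refine Measurable.mul (by fun_prop) (measurable_expWeight.comp measurable_dotProduct_pair)

noncomputable def momentMatrix (p : Fin 3 → ℝ) : Matrix (Fin 3) (Fin 3) ℝ :=
  Matrix.of fun i j => ∫ n, n i * n j * rowWeight p n

noncomputable def gapMean (p : Fin 3 → ℝ) : ENNReal :=
  ∫⁻ m : Fin 3 → ℝ, ∫⁻ t, ENNReal.ofReal (|t - m ⬝ᵥ p| * ((∏ j, expWeight (m j)) * expWeight t))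

theorem integrable_sq_mul_expWeight (k : ℕ) : Integrable fun x : ℝ => x ^ k * expWeight x := by
  have h := Real.GammaIntegral_convergent (s := (k : ℝ) + 1) (by positivity)
  have : (fun x : ℝ => x ^ k * expWeight x) =
      (Set.Ioi 0).indicator fun x => Real.exp (-x) * x ^ ((k : ℝ) + 1 - 1) := by
    ext x
    by_cases hx : 0 < x <;> simp [expWeight, hx, mul_comm]
  rw [this]
  exact h.integrable_indicator measurableSet_Ioi

theorem integrable_mul_mul_rowWeight (p : Fin 3 → ℝ) (i j : Fin 3) :
    Integrable fun n => n i * n j * rowWeight p n := by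
  have h : Integrable fun n : Fin 3 → ℝ => ∏ l,
      (n l ^ ((if l = i then 1 else 0) + (if l = j then 1 else 0)) * expWeight (n l)) :=
    Integrable.fintype_prod fun l => integrable_sq_mul_expWeight _
  have e : (fun n : Fin 3 → ℝ => ∏ l,
      (n l ^ ((if l = i then 1 else 0) + (if l = j then 1 else 0)) * expWeight (n l))) =
      fun n => n i * n j * ∏ l, expWeight (n l) := by
    ext n
    simp only [Finset.prod_mul_distrib, pow_add]
    simp
  rw [e] at h
  have := h.mul_bdd (c := 1) (g := fun n => expWeight (n ⬝ᵥ p))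
    (Measurable.aestronglyMeasurable (measurable_expWeight.comp
      (measurable_dotProduct_pair.comp (measurable_const.prodMk measurable_id)))) ?_
  · refine this.congr (ae_of_all _ fun n => ?_)
    simp only [rowWeight]; ring
  · refine ae_of_all _ fun n => ?_
    rw [Real.norm_eq_abs, abs_of_nonneg (expWeight_nonneg _)]
    exact expWeight_le_one _

theorem lintegral_det_sq_mul_prod_rowWeight (p : Fin 3 → ℝ) :
    ∫⁻ N : Fin 3 → Fin 3 → ℝ,
      ENNReal.ofReal ((Matrix.of N).det ^ 2 * ∏ i, rowWeight p (N i)) =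
      ENNReal.ofReal (6 * (momentMatrix p).det) := by
  rw [← ofReal_integral_eq_lintegral_ofReal
    (integrable_det_sq_mul_prod (integrable_mul_mul_rowWeight p)),
    integral_det_sq_mul_prod (integrable_mul_mul_rowWeight p)]
  · rfl
  · exact ae_of_all _ fun N => mul_nonneg (sq_nonneg _)
      (Finset.prod_nonneg fun _ _ => rowWeight_nonneg _ _)

theorem measurable_gapMean : Measurable gapMean := by
  have h : Measurable fun q : ((Fin 3 → ℝ) × (Fin 3 → ℝ)) × ℝ =>
      ENNReal.ofReal (|q.2 - q.1.2 ⬝ᵥ q.1.1| *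
        ((∏ j, expWeight (q.1.2 j)) * expWeight q.2)) := by
    have h2 : Measurable fun q : ((Fin 3 → ℝ) × (Fin 3 → ℝ)) × ℝ => q.1.2 ⬝ᵥ q.1.1 := by
      simp only [dotProduct]; fun_prop
    fun_prop
  exact (h.lintegral_prod_right').lintegral_prod_right'

theorem lintegral_comp_mulVec {ι : Type*} [Fintype ι] [DecidableEq ι] {N : Matrix ι ι ℝ}
    (hN : N.det ≠ 0) {f : (ι → ℝ) → ENNReal} (hf : Measurable f) :
    ∫⁻ z, f z = ENNReal.ofReal |N.det| * ∫⁻ p, f (N.mulVec p) := by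
  have h := Real.map_matrix_volume_pi_eq_smul_volume_pi hN
  have h1 : ∫⁻ p, f (N.mulVec p) = ∫⁻ z, f z ∂(Measure.map (Matrix.toLin' N) volume) := by
    rw [lintegral_map hf (by
      exact (LinearMap.continuous_of_finiteDimensional _).measurable)]
    rfl
  rw [h1, h, lintegral_smul_measure, smul_eq_mul, ← mul_assoc, ← ENNReal.ofReal_mul (abs_nonneg _),
    ← abs_mul, mul_inv_cancel₀ hN]
  simp

theorem det_fin_four_mulVec (N : Fin 3 → Fin 3 → ℝ) (p m : Fin 3 → ℝ) (t : ℝ) :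
    (!![N 0 0, N 0 1, N 0 2, ((Matrix.of N).mulVec p) 0;
        N 1 0, N 1 1, N 1 2, ((Matrix.of N).mulVec p) 1;
        N 2 0, N 2 1, N 2 2, ((Matrix.of N).mulVec p) 2;
        m 0, m 1, m 2, t] : Matrix (Fin 4) (Fin 4) ℝ).det =
      (Matrix.of N).det * (t - m ⬝ᵥ p) := by
  simp [Matrix.det_succ_row_zero, Fin.sum_univ_succ, Matrix.mulVec, dotProduct, Fin.succAbove]
  ring

theorem measurable_det_fin_four :
    Measurable fun q : (((Fin 3 → Fin 3 → ℝ) × (Fin 3 → ℝ)) × (Fin 3 → ℝ)) × ℝ =>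
      (!![q.1.1.1 0 0, q.1.1.1 0 1, q.1.1.1 0 2, q.1.1.2 0;
          q.1.1.1 1 0, q.1.1.1 1 1, q.1.1.1 1 2, q.1.1.2 1;
          q.1.1.1 2 0, q.1.1.1 2 1, q.1.1.1 2 2, q.1.1.2 2;
          q.1.2 0, q.1.2 1, q.1.2 2, q.2] : Matrix (Fin 4) (Fin 4) ℝ).det := by
  refine Continuous.measurable (Continuous.matrix_det (continuous_matrix fun i j => ?_))
  fin_cases i <;> fin_cases j <;> simp <;> fun_prop

theorem lintegral_abs_det_mul_expWeight :
    ∫⁻ N : Fin 3 → Fin 3 → ℝ, ∫⁻ z : Fin 3 → ℝ, ∫⁻ m : Fin 3 → ℝ, ∫⁻ t : ℝ,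
      ENNReal.ofReal (|(!![N 0 0, N 0 1, N 0 2, z 0; N 1 0, N 1 1, N 1 2, z 1;
        N 2 0, N 2 1, N 2 2, z 2; m 0, m 1, m 2, t] : Matrix (Fin 4) (Fin 4) ℝ).det| *
        ((∏ i, (∏ j, expWeight (N i j)) * expWeight (z i)) *
          ((∏ j, expWeight (m j)) * expWeight t))) =
      ∫⁻ p : Fin 3 → ℝ, gapMean p * ENNReal.ofReal (6 * (momentMatrix p).det) := by
  have hN : ∀ N : Fin 3 → Fin 3 → ℝ, (Matrix.of N).det ≠ 0 →
      ∫⁻ z : Fin 3 → ℝ, ∫⁻ m : Fin 3 → ℝ, ∫⁻ t : ℝ,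
        ENNReal.ofReal (|(!![N 0 0, N 0 1, N 0 2, z 0; N 1 0, N 1 1, N 1 2, z 1;
          N 2 0, N 2 1, N 2 2, z 2; m 0, m 1, m 2, t] : Matrix (Fin 4) (Fin 4) ℝ).det| *
          ((∏ i, (∏ j, expWeight (N i j)) * expWeight (z i)) *
            ((∏ j, expWeight (m j)) * expWeight t))) =
      ∫⁻ p : Fin 3 → ℝ,
        ENNReal.ofReal ((Matrix.of N).det ^ 2 * ∏ i, rowWeight p (N i)) * gapMean p := by
    intro N hN
    have hm : Measurable fun z : Fin 3 → ℝ => ∫⁻ m : Fin 3 → ℝ, ∫⁻ t : ℝ,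
        ENNReal.ofReal (|(!![N 0 0, N 0 1, N 0 2, z 0; N 1 0, N 1 1, N 1 2, z 1;
          N 2 0, N 2 1, N 2 2, z 2; m 0, m 1, m 2, t] : Matrix (Fin 4) (Fin 4) ℝ).det| *
          ((∏ i, (∏ j, expWeight (N i j)) * expWeight (z i)) *
            ((∏ j, expWeight (m j)) * expWeight t))) := by
      have h : Measurable fun q : ((Fin 3 → ℝ) × (Fin 3 → ℝ)) × ℝ =>
          ENNReal.ofReal (|(!![N 0 0, N 0 1, N 0 2, q.1.1 0; N 1 0, N 1 1, N 1 2, q.1.1 1;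
            N 2 0, N 2 1, N 2 2, q.1.1 2;
            q.1.2 0, q.1.2 1, q.1.2 2, q.2] : Matrix (Fin 4) (Fin 4) ℝ).det| *
            ((∏ i, (∏ j, expWeight (N i j)) * expWeight (q.1.1 i)) *
              ((∏ j, expWeight (q.1.2 j)) * expWeight q.2))) := by
        have hd := measurable_det_fin_four.comp (f := fun q : ((Fin 3 → ℝ) × (Fin 3 → ℝ)) × ℝ =>
          (((N, q.1.1), q.1.2), q.2)) (by fun_prop)
        exact ENNReal.measurable_ofReal.comp ((measurable_abs.comp hd).mul (by fun_prop))
      exact (h.lintegral_prod_right').lintegral_prod_right'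
    rw [lintegral_comp_mulVec hN hm, ← lintegral_const_mul' _ _ ENNReal.ofReal_ne_top]
    refine lintegral_congr fun p => ?_
    rw [gapMean, ← lintegral_const_mul' _ _ ENNReal.ofReal_ne_top,
      ← lintegral_const_mul' _ _ ENNReal.ofReal_ne_top]
    refine lintegral_congr fun m => ?_
    rw [← lintegral_const_mul' _ _ ENNReal.ofReal_ne_top,
      ← lintegral_const_mul' _ _ ENNReal.ofReal_ne_top]
    refine lintegral_congr fun t => ?_
    rw [← ENNReal.ofReal_mul (abs_nonneg _), ← ENNReal.ofReal_mul (mul_nonneg (sq_nonneg _)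
      (Finset.prod_nonneg fun _ _ => rowWeight_nonneg _ _)), det_fin_four_mulVec, abs_mul,
      ← sq_abs (Matrix.of N).det]
    congr 1
    simp only [rowWeight, Matrix.mulVec, Matrix.of_apply]
    ring
  rw [lintegral_congr_ae (ae_det_ne_zero.mono hN), lintegral_lintegral_swap]
  · refine lintegral_congr fun p => ?_
    rw [lintegral_mul_const'', lintegral_det_sq_mul_prod_rowWeight, mul_comm]
    exact (integrable_det_sq_mul_prod
      (integrable_mul_mul_rowWeight p)).aestronglyMeasurable.aemeasurable.ennreal_ofReal
  · have hw : ∀ i, Measurable fun q : (Fin 3 → Fin 3 → ℝ) × (Fin 3 → ℝ) =>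
        rowWeight q.2 (q.1 i) := fun i =>
      measurable_uncurry_rowWeight.comp (measurable_snd.prodMk (by fun_prop))
    have hd : Measurable fun q : (Fin 3 → Fin 3 → ℝ) × (Fin 3 → ℝ) => (Matrix.of q.1).det :=
      Continuous.measurable (Continuous.matrix_det (continuous_matrix fun i j => by
        simp only [Matrix.of_apply]; fun_prop))
    refine Measurable.aemeasurable (Measurable.mul (ENNReal.measurable_ofReal.comp
      ((hd.pow_const 2).mul (Finset.measurable_prod _ fun i _ => hw i)))
      (measurable_gapMean.comp measurable_snd))

/-- The Laplace transform of `f` at `a`. -/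
noncomputable def laplace (a : ℝ) (f : ℝ → ENNReal) : ENNReal :=
  ∫⁻ x in Set.Ioi 0, ENNReal.ofReal (Real.exp (-(a * x))) * f x

theorem laplace_congr {a : ℝ} {f g : ℝ → ENNReal} (h : ∀ x, 0 < x → f x = g x) :
    laplace a f = laplace a g :=
  setLIntegral_congr_fun measurableSet_Ioi fun x hx => by simp only [h x hx]

theorem laplace_const_mul (a : ℝ) {c : ENNReal} (hc : c ≠ ⊤) (f : ℝ → ENNReal) :
    laplace a (fun x => c * f x) = c * laplace a f := by
  rw [laplace, laplace, ← lintegral_const_mul' _ _ hc]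
  exact lintegral_congr fun x => mul_left_comm _ _ _

theorem laplace_ofReal_mul (a c : ℝ) (f : ℝ → ENNReal) :
    laplace a (fun x => ENNReal.ofReal c * f x) = ENNReal.ofReal c * laplace a f :=
  laplace_const_mul a ENNReal.ofReal_ne_top f

theorem laplace_zero (a : ℝ) : laplace a (fun _ => 0) = 0 := by simp [laplace]

theorem Measurable.laplace {α : Type*} [MeasurableSpace α] {a : ℝ} {f : α → ℝ → ENNReal}
    (hf : Measurable (Function.uncurry f)) : Measurable fun x => laplace a (f x) := by
  unfold _root_.laplace
  exact Measurable.lintegral_prod_right' (ν := volume.restrict (Set.Ioi 0))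
    (f := fun z : α × ℝ => ENNReal.ofReal (Real.exp (-(a * z.2))) * f z.1 z.2)
    (Measurable.mul (by fun_prop) hf)

theorem laplace_comm (a b : ℝ) {f : ℝ → ℝ → ENNReal} (hf : Measurable (Function.uncurry f)) :
    laplace a (fun x => laplace b (f x)) = laplace b fun y => laplace a fun x => f x y := by
  simp only [laplace, ← lintegral_const_mul' _ _ ENNReal.ofReal_ne_top]
  rw [lintegral_lintegral_swap]
  · simp only [mul_left_comm]
  · exact Measurable.aemeasurable (Measurable.mul (f := fun z : ℝ × ℝ =>
      ENNReal.ofReal (Real.exp (-(a * z.1)))) (by fun_prop) (Measurable.mul (f := fun z : ℝ × ℝ =>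
      ENNReal.ofReal (Real.exp (-(b * z.2)))) (by fun_prop) hf))

theorem laplace_laplace_split (a b : ℝ) {f : ℝ → ℝ → ENNReal}
    (hf : Measurable (Function.uncurry f)) :
    laplace a (fun x => laplace b (f x)) =
      laplace (a + b) (fun y => laplace a fun m => f (y + m) y) +
        laplace (a + b) (fun x => laplace b fun m => f x (x + m)) := by
  simp only [laplace, ← lintegral_const_mul' _ _ ENNReal.ofReal_ne_top]
  rw [lintegral_quadrant_split]
  · congr 1 <;> refine lintegral_congr fun x => lintegral_congr fun y => ?_
    · rw [← mul_assoc, ← mul_assoc, ← ENNReal.ofReal_mul (Real.exp_nonneg _),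
        ← ENNReal.ofReal_mul (Real.exp_nonneg _), ← Real.exp_add, ← Real.exp_add]
      ring_nf
    · rw [← mul_assoc, ← mul_assoc, ← ENNReal.ofReal_mul (Real.exp_nonneg _),
        ← ENNReal.ofReal_mul (Real.exp_nonneg _), ← Real.exp_add, ← Real.exp_add]
      ring_nf
  · exact Measurable.mul (f := fun z : ℝ × ℝ =>
      ENNReal.ofReal (Real.exp (-(a * z.1)))) (by fun_prop) (Measurable.mul (f := fun z : ℝ × ℝ =>
      ENNReal.ofReal (Real.exp (-(b * z.2)))) (by fun_prop) hf)

theorem laplace_quadratic {L : ℝ} (hL : 0 < L) {a b c : ℝ} (ha : 0 ≤ a) (hb : 0 ≤ b)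
    (hc : 0 ≤ c) :
    laplace L (fun x => ENNReal.ofReal (a + b * x + c * x ^ 2)) =
      ENNReal.ofReal (a / L + b / L ^ 2 + 2 * c / L ^ 3) := by
  rw [← lintegral_quadratic_mul_exp hL ha hb hc]
  refine lintegral_congr fun x => ?_
  rw [mul_comm, ENNReal.ofReal_mul' (Real.exp_nonneg _)]

theorem laplace_const {L c : ℝ} (hL : 0 < L) (hc : 0 ≤ c) :
    laplace L (fun _ => ENNReal.ofReal c) = ENNReal.ofReal (L⁻¹ * c) := by
  simpa [div_eq_inv_mul] using laplace_quadratic hL hc (le_refl 0) (le_refl 0)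

theorem laplace_const' {L : ℝ} (hL : 0 < L) (c : ENNReal) :
    laplace L (fun _ => c) = ENNReal.ofReal L⁻¹ * c := by
  have h : laplace L (fun _ => 1) = ENNReal.ofReal L⁻¹ := by
    simpa using laplace_const hL zero_le_one
  rw [← h, laplace, laplace, ← lintegral_mul_const _ (by fun_prop)]
  simp

theorem laplace_bilinear {L₁ L₂ L₃ : ℝ} (h₁ : 0 < L₁) (h₂ : 0 < L₂) (h₃ : 0 < L₃)
    {a₁ a₂ a₃ b₁ b₂ b₃ : ℝ} (ha₁ : 0 ≤ a₁) (ha₂ : 0 ≤ a₂) (ha₃ : 0 ≤ a₃) (hb₁ : 0 ≤ b₁)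
    (hb₂ : 0 ≤ b₂) (hb₃ : 0 ≤ b₃) :
    laplace L₁ (fun x => laplace L₂ fun y => laplace L₃ fun z =>
      ENNReal.ofReal ((a₁ * x + a₂ * y + a₃ * z) * (b₁ * x + b₂ * y + b₃ * z))) =
      ENNReal.ofReal ((a₁ * b₁ / L₁ ^ 2 + a₂ * b₂ / L₂ ^ 2 + a₃ * b₃ / L₃ ^ 2 +
        (a₁ / L₁ + a₂ / L₂ + a₃ / L₃) * (b₁ / L₁ + b₂ / L₂ + b₃ / L₃)) / (L₁ * L₂ * L₃)) := by
  rw [← lintegral_bilinear_mul_exp h₁ h₂ h₃ ha₁ ha₂ ha₃ hb₁ hb₂ hb₃]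
  simp only [laplace, ← lintegral_const_mul' _ _ ENNReal.ofReal_ne_top]
  refine lintegral_congr fun x => lintegral_congr fun y => lintegral_congr fun z => ?_
  rw [← ENNReal.ofReal_mul (Real.exp_nonneg _), ← ENNReal.ofReal_mul (Real.exp_nonneg _),
    ← ENNReal.ofReal_mul (Real.exp_nonneg _)]
  congr 1
  rw [neg_add, neg_add, Real.exp_add, Real.exp_add]
  ring

theorem laplace_expWeight_mul (a : ℝ) (f : ℝ → ENNReal) :
    laplace a (fun x => ENNReal.ofReal (expWeight x) * f x) = laplace (a + 1) f := by
  refine setLIntegral_congr_fun measurableSet_Ioi fun x hx => ?_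
  simp only [expWeight, if_pos (Set.mem_Ioi.1 hx)]
  rw [← mul_assoc, ← ENNReal.ofReal_mul (Real.exp_nonneg _), ← Real.exp_add]
  ring_nf

theorem laplace_laplace_sub {a b : ℝ} (ha : 0 < a) (hb : 0 < b) {h : ℝ → ENNReal}
    (hh : Measurable h) :
    laplace a (fun x => laplace b fun y => h (x - y)) =
      ENNReal.ofReal (a + b)⁻¹ * (laplace a h + laplace b fun m => h (-m)) := by
  rw [laplace_laplace_split a b (f := fun x y => h (x - y))
    (hh.comp (measurable_fst.sub measurable_snd)), mul_add,
    ← laplace_const' (by positivity), ← laplace_const' (by positivity)]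
  simp

theorem laplace_abs_sub {a b : ℝ} (ha : 0 < a) (hb : 0 < b) :
    laplace a (fun x => laplace b fun y => ENNReal.ofReal |x - y|) =
      ENNReal.ofReal ((a + b)⁻¹ * ((a ^ 2)⁻¹ + (b ^ 2)⁻¹)) := by
  have h1 : ∀ {c : ℝ}, 0 < c → laplace c (fun m => ENNReal.ofReal |m|) =
      ENNReal.ofReal (c ^ 2)⁻¹ := by
    intro c hc
    rw [laplace_congr (g := fun m => ENNReal.ofReal (0 + 1 * m + 0 * m ^ 2)) fun x hx => by
      simp [abs_of_pos hx], laplace_quadratic hc le_rfl zero_le_one le_rfl]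
    congr 1; ring
  rw [laplace_laplace_sub ha hb (h := fun s => ENNReal.ofReal |s|) (by fun_prop)]
  simp only [abs_neg]
  rw [h1 ha, h1 hb, ← ENNReal.ofReal_add (by positivity) (by positivity),
    ← ENNReal.ofReal_mul (by positivity)]

theorem laplace_add_add {a b : ℝ} (ha : 0 < a) (hb : 0 < b) :
    laplace a (fun x => laplace b fun y => ENNReal.ofReal |x + y|) =
      ENNReal.ofReal ((a * b)⁻¹ * (a⁻¹ + b⁻¹)) := by
  rw [laplace_congr (g := fun x => ENNReal.ofReal ((b ^ 2)⁻¹ + b⁻¹ * x + 0 * x ^ 2)),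
    laplace_quadratic ha (by positivity) (by positivity) le_rfl]
  · congr 1; field_simp; ring
  · intro x hx
    rw [laplace_congr (g := fun y => ENNReal.ofReal (x + 1 * y + 0 * y ^ 2)) fun y hy => by
      rw [abs_of_pos (by positivity)]; ring_nf,
      laplace_quadratic hb hx.le zero_le_one le_rfl]
    congr 1; field_simp; ring

theorem laplace_abs_add_sub {a b d : ℝ} (ha : 0 < a) (hb : 0 < b) (hd : 0 < d) :
    laplace a (fun x => laplace d fun t => laplace b fun y => ENNReal.ofReal |x - t + y|) =
      ENNReal.ofReal ((a + d)⁻¹ * ((a * b)⁻¹ * (a⁻¹ + b⁻¹) +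
        (b + d)⁻¹ * ((b ^ 2)⁻¹ + (d ^ 2)⁻¹))) := by
  have hm : Measurable fun s : ℝ => laplace b fun y => ENNReal.ofReal |s + y| :=
    Measurable.laplace (f := fun s y => ENNReal.ofReal |s + y|)
      (by unfold Function.uncurry; fun_prop)
  rw [laplace_laplace_sub ha hd (h := fun s => laplace b fun y => ENNReal.ofReal |s + y|) hm,
    laplace_add_add ha hb]
  have : laplace d (fun m => laplace b fun y => ENNReal.ofReal |-m + y|) =
      ENNReal.ofReal ((b + d)⁻¹ * ((b ^ 2)⁻¹ + (d ^ 2)⁻¹)) := by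
    rw [add_comm b, add_comm (b ^ 2)⁻¹, ← laplace_abs_sub hd hb]
    refine laplace_congr fun x _ => laplace_congr fun y _ => ?_
    rw [← abs_neg]; congr 2; ring
  rw [this, ← ENNReal.ofReal_add (by positivity) (by positivity),
    ← ENNReal.ofReal_mul (by positivity)]

theorem laplace_abs_two_two {a b c d : ℝ} (ha : 0 < a) (hb : 0 < b) (hc : 0 < c) (hd : 0 < d) :
    laplace a (fun x => laplace b fun y => laplace c fun z => laplace d fun t =>
      ENNReal.ofReal |x + y - z - t|) =
      ENNReal.ofReal ((a + c)⁻¹ * ((a + d)⁻¹ * ((a * b)⁻¹ * (a⁻¹ + b⁻¹) +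
        (b + d)⁻¹ * ((b ^ 2)⁻¹ + (d ^ 2)⁻¹)) + (c + b)⁻¹ * ((c * d)⁻¹ * (c⁻¹ + d⁻¹) +
        (d + b)⁻¹ * ((d ^ 2)⁻¹ + (b ^ 2)⁻¹)))) := by
  have hm : Measurable fun s : ℝ => laplace b fun y => laplace d fun t =>
      ENNReal.ofReal |s + y - t| :=
    Measurable.laplace (f := fun s y => laplace d fun t => ENNReal.ofReal |s + y - t|)
      (Measurable.laplace (f := fun (q : ℝ × ℝ) t => ENNReal.ofReal |q.1 + q.2 - t|)
        (by unfold Function.uncurry; fun_prop))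
  have h1 : ∀ x, laplace b (fun y => laplace c fun z => laplace d fun t =>
      ENNReal.ofReal |x + y - z - t|) = laplace c fun z => laplace b fun y => laplace d fun t =>
      ENNReal.ofReal |x - z + y - t| := by
    intro x
    rw [laplace_comm]
    · refine laplace_congr fun z _ => laplace_congr fun y _ => laplace_congr fun t _ => ?_
      congr 2; ring
    · exact Measurable.laplace (f := fun (q : ℝ × ℝ) t => ENNReal.ofReal |x + q.1 - q.2 - t|)
        (by unfold Function.uncurry; fun_prop)
  rw [laplace_congr fun x _ => h1 x, laplace_laplace_sub ha hc (h := fun s =>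
    laplace b fun y => laplace d fun t => ENNReal.ofReal |s + y - t|) hm]
  have h2 : laplace a (fun m => laplace b fun y => laplace d fun t =>
      ENNReal.ofReal |m + y - t|) = ENNReal.ofReal ((a + d)⁻¹ * ((a * b)⁻¹ * (a⁻¹ + b⁻¹) +
        (b + d)⁻¹ * ((b ^ 2)⁻¹ + (d ^ 2)⁻¹))) := by
    rw [← laplace_abs_add_sub ha hb hd]
    refine laplace_congr fun x _ => ?_
    rw [laplace_comm _ _ (by unfold Function.uncurry; fun_prop)]
    refine laplace_congr fun y _ => laplace_congr fun t _ => ?_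
    congr 2; ring
  have h3 : laplace c (fun m => laplace b fun y => laplace d fun t =>
      ENNReal.ofReal |-m + y - t|) = ENNReal.ofReal ((c + b)⁻¹ * ((c * d)⁻¹ * (c⁻¹ + d⁻¹) +
        (d + b)⁻¹ * ((d ^ 2)⁻¹ + (b ^ 2)⁻¹))) := by
    rw [← laplace_abs_add_sub hc hd hb]
    refine laplace_congr fun x _ => laplace_congr fun y _ => laplace_congr fun t _ => ?_
    rw [← abs_neg]; congr 2; ring
  rw [h2, h3, ← ENNReal.ofReal_add (by positivity) (by positivity),
    ← ENNReal.ofReal_mul (by positivity)]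

theorem laplace_abs_one_three {e a b c : ℝ} (he : 0 < e) (ha : 0 < a) (hb : 0 < b) (hc : 0 < c) :
    laplace e (fun s => laplace a fun x => laplace b fun y => laplace c fun z =>
      ENNReal.ofReal |s - x - y - z|) =
      ENNReal.ofReal ((e + a)⁻¹ * ((b + e)⁻¹ * ((b * c)⁻¹ * (b⁻¹ + c⁻¹) +
        (c + e)⁻¹ * ((c ^ 2)⁻¹ + (e ^ 2)⁻¹)) + (a * b * c)⁻¹ * (a⁻¹ + b⁻¹ + c⁻¹))) := by
  have hm : Measurable fun s : ℝ => laplace b fun y => laplace c fun z =>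
      ENNReal.ofReal |s - y - z| :=
    Measurable.laplace (f := fun s y => laplace c fun z => ENNReal.ofReal |s - y - z|)
      (Measurable.laplace (f := fun (q : ℝ × ℝ) z => ENNReal.ofReal |q.1 - q.2 - z|)
        (by unfold Function.uncurry; fun_prop))
  rw [laplace_laplace_sub he ha (h := fun s =>
    laplace b fun y => laplace c fun z => ENNReal.ofReal |s - y - z|) hm]
  have h2 : laplace e (fun m => laplace b fun y => laplace c fun z =>
      ENNReal.ofReal |m - y - z|) = ENNReal.ofReal ((b + e)⁻¹ * ((b * c)⁻¹ * (b⁻¹ + c⁻¹) +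
        (c + e)⁻¹ * ((c ^ 2)⁻¹ + (e ^ 2)⁻¹))) := by
    rw [← laplace_abs_add_sub hb hc he, laplace_comm]
    · refine laplace_congr fun x _ => laplace_congr fun y _ => laplace_congr fun t _ => ?_
      rw [← abs_neg]; congr 2; ring
    · exact Measurable.laplace (f := fun (q : ℝ × ℝ) z => ENNReal.ofReal |q.1 - q.2 - z|)
        (by unfold Function.uncurry; fun_prop)
  have h3 : laplace a (fun m => laplace b fun y => laplace c fun z =>
      ENNReal.ofReal |-m - y - z|) =
        ENNReal.ofReal ((a * b * c)⁻¹ * (a⁻¹ + b⁻¹ + c⁻¹)) := by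
    rw [laplace_congr (g := fun x => ENNReal.ofReal ((b * c)⁻¹ * (b⁻¹ + c⁻¹) + (b * c)⁻¹ * x +
      0 * x ^ 2)), laplace_quadratic ha (by positivity) (by positivity) le_rfl]
    · congr 1; field_simp; ring
    intro x hx
    rw [laplace_congr (g := fun y => ENNReal.ofReal ((c⁻¹ * c⁻¹ + c⁻¹ * x) + c⁻¹ * y +
      0 * y ^ 2)), laplace_quadratic hb (by positivity) (by positivity) le_rfl]
    · congr 1; field_simp; ring
    intro y hy
    rw [laplace_congr (g := fun z => ENNReal.ofReal ((x + y) + 1 * z + 0 * z ^ 2)),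
      laplace_quadratic hc (by positivity) (by positivity) le_rfl]
    · congr 1; field_simp; ring
    intro z hz
    rw [← abs_neg, abs_of_nonneg (by linarith)]
    congr 1; ring
  rw [h2, h3, ← ENNReal.ofReal_add (by positivity) (by positivity),
    ← ENNReal.ofReal_mul (by positivity)]

theorem expWeight_of_nonpos {x : ℝ} (hx : x ≤ 0) : expWeight x = 0 := if_neg hx.not_gt

theorem expWeight_add {x y : ℝ} (hx : 0 < x) (hy : 0 < y) :
    expWeight (x + y) = expWeight x * expWeight y := by
  simp only [expWeight, if_pos hx, if_pos hy, if_pos (add_pos hx hy), ← Real.exp_add]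
  ring_nf

theorem laplace_expWeight_add_mul (a b : ℝ) (g : ℝ → ℝ → ENNReal) :
    laplace a (fun x => laplace b fun y => ENNReal.ofReal (expWeight (x + y)) * g x y) =
      laplace (a + 1) fun x => laplace (b + 1) fun y => g x y := by
  simp only [← laplace_expWeight_mul a, ← laplace_expWeight_mul b]
  refine laplace_congr fun x hx => ?_
  rw [← laplace_ofReal_mul]
  refine laplace_congr fun y hy => ?_
  rw [expWeight_add hx hy, ENNReal.ofReal_mul (expWeight_nonneg _), mul_assoc]

theorem laplace_expWeight_sub_mul (a b : ℝ) {g : ℝ → ℝ → ENNReal}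
    (hg : Measurable (Function.uncurry g)) :
    laplace a (fun x => laplace b fun y => ENNReal.ofReal (expWeight (x - y)) * g x y) =
      laplace (a + b) fun y => laplace (a + 1) fun k => g (y + k) y := by
  rw [laplace_laplace_split a b (f := fun x y => ENNReal.ofReal (expWeight (x - y)) * g x y)
    (Measurable.mul (by fun_prop) hg)]
  have h : laplace (a + b) (fun x => laplace b fun m =>
      ENNReal.ofReal (expWeight (x - (x + m))) * g x (x + m)) = 0 := by
    rw [← laplace_zero (a + b)]
    refine laplace_congr fun x _ => ?_
    rw [← laplace_zero b]
    refine laplace_congr fun m hm => ?_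
    rw [expWeight_of_nonpos (by linarith)]
    simp
  rw [h, add_zero]
  refine laplace_congr fun y _ => ?_
  rw [← laplace_expWeight_mul a]
  simp

theorem laplace_expWeight_add_add_mul (a b c : ℝ) (g : ℝ → ℝ → ℝ → ENNReal) :
    laplace a (fun x => laplace b fun y => laplace c fun z =>
      ENNReal.ofReal (expWeight (x + y + z)) * g x y z) =
      laplace (a + 1) fun x => laplace (b + 1) fun y => laplace (c + 1) fun z => g x y z := by
  rw [← laplace_expWeight_mul a]
  refine laplace_congr fun x hx => ?_
  rw [← laplace_expWeight_add_mul b c, ← laplace_ofReal_mul]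
  refine laplace_congr fun y hy => ?_
  rw [← laplace_ofReal_mul]
  refine laplace_congr fun z hz => ?_
  rw [add_assoc, expWeight_add hx (add_pos hy hz), ENNReal.ofReal_mul (expWeight_nonneg _),
    mul_assoc]

theorem laplace_expWeight_sub_sub_mul (a b c : ℝ) {g : ℝ × ℝ × ℝ → ENNReal} (hg : Measurable g) :
    laplace a (fun x => laplace b fun y => laplace c fun z =>
      ENNReal.ofReal (expWeight (x - y - z)) * g (x, y, z)) =
      laplace (a + b) fun y => laplace (a + c) fun z => laplace (a + 1) fun k =>
        g (y + z + k, y, z) := by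
  rw [laplace_laplace_split a b (f := fun x y => laplace c fun z =>
      ENNReal.ofReal (expWeight (x - y - z)) * g (x, y, z))]
  · have h : laplace (a + b) (fun x => laplace b fun m => laplace c fun z =>
        ENNReal.ofReal (expWeight (x - (x + m) - z)) * g (x, x + m, z)) = 0 := by
      rw [← laplace_zero (a + b)]
      refine laplace_congr fun x _ => ?_
      rw [← laplace_zero b]
      refine laplace_congr fun m hm => ?_
      rw [← laplace_zero c]
      refine laplace_congr fun z hz => ?_
      rw [expWeight_of_nonpos (by linarith)]
      simp
    rw [h, add_zero]
    refine laplace_congr fun y _ => ?_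
    have := laplace_expWeight_sub_mul a c (g := fun m z => g (y + m, y, z))
      (hg.comp (by fun_prop))
    simp only [← add_assoc] at this
    rw [← this]
    simp
  · exact Measurable.laplace (f := fun (q : ℝ × ℝ) z =>
      ENNReal.ofReal (expWeight (q.1 - q.2 - z)) * g (q.1, q.2, z))
      (Measurable.mul (by fun_prop) (hg.comp (by fun_prop)))

theorem laplace_expWeight_add_sub_mul (a b c : ℝ) {g : ℝ × ℝ × ℝ → ENNReal} (hg : Measurable g) :
    laplace a (fun x => laplace b fun y => laplace c fun z =>
      ENNReal.ofReal (expWeight (x + y - z)) * g (x, y, z)) =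
      (laplace (a + c) fun z => laplace (a + 1) fun m => laplace (b + 1) fun y =>
        g (z + m, y, z)) +
      laplace (a + c) fun x => laplace (b + c) fun m => laplace (b + 1) fun k =>
        g (x, m + k, x + m) := by
  have h1 : ∀ x, laplace b (fun y => laplace c fun z =>
      ENNReal.ofReal (expWeight (x + y - z)) * g (x, y, z)) =
      laplace c fun z => laplace b fun y =>
      ENNReal.ofReal (expWeight (x + y - z)) * g (x, y, z) := fun x =>
    laplace_comm _ _ (f := fun y z => ENNReal.ofReal (expWeight (x + y - z)) * g (x, y, z))
      (Measurable.mul (by fun_prop) (hg.comp (by fun_prop)))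
  rw [laplace_congr fun x _ => h1 x, laplace_laplace_split a c (f := fun x z => laplace b fun y =>
      ENNReal.ofReal (expWeight (x + y - z)) * g (x, y, z))]
  · congr 1
    · refine laplace_congr fun z _ => ?_
      rw [← laplace_expWeight_add_mul]
      refine laplace_congr fun m _ => laplace_congr fun y _ => ?_
      congr 3; ring
    · refine laplace_congr fun x _ => ?_
      rw [← laplace_expWeight_sub_mul b c (g := fun y m => g (x, y, x + m))
        (hg.comp (by fun_prop)), laplace_comm]
      · refine laplace_congr fun y _ => laplace_congr fun m _ => ?_
        congr 3; ring
      · exact Measurable.mul (by fun_prop) (hg.comp (by fun_prop))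
  · exact Measurable.laplace (f := fun (q : ℝ × ℝ) y =>
      ENNReal.ofReal (expWeight (q.1 + y - q.2)) * g (q.1, y, q.2))
      (Measurable.mul (by fun_prop) (hg.comp (by fun_prop)))

theorem lintegral_fin_three {α : Type*} [MeasureSpace α] [SigmaFinite (volume : Measure α)]
    {f : (Fin 3 → α) → ENNReal} (hf : Measurable f) :
    ∫⁻ n, f n = ∫⁻ x, ∫⁻ y, ∫⁻ z, f ![x, y, z] := by
  rw [← (volume_preserving_piFinSuccAbove (fun _ : Fin 3 => α) 0).symm.lintegral_comp hf,
    Measure.volume_eq_prod, lintegral_prod _ (by fun_prop)]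
  refine lintegral_congr fun x => ?_
  rw [← (volume_preserving_piFinSuccAbove (fun _ : Fin 2 => α) 0).symm.lintegral_comp
    (by fun_prop), Measure.volume_eq_prod, lintegral_prod _ (by fun_prop)]
  refine lintegral_congr fun y => ?_
  refine ((volume_preserving_funUnique (Fin 1) α).symm.lintegral_comp (by fun_prop)).symm.trans ?_
  refine lintegral_congr fun z => ?_
  congr 1
  ext i
  fin_cases i <;> rfl

theorem laplace_one_eq_mul {a : ℝ} (ha : 0 < a) (f : ℝ → ENNReal) :
    laplace 1 f = ENNReal.ofReal a * laplace a fun x => f (a * x) := by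
  rw [laplace, lintegral_Ioi_zero_comp_mul_left _ ha]
  simp only [one_mul, laplace]

theorem lintegral_expWeight_mul_eq_laplace (f : ℝ → ENNReal) :
    ∫⁻ x, ENNReal.ofReal (expWeight x) * f x = laplace 1 f := by
  rw [lintegral_expWeight_mul, laplace]
  simp only [one_mul]

theorem lintegral_prod_expWeight_mul {a b c : ℝ} (ha : 0 < a) (hb : 0 < b) (hc : 0 < c)
    {g : (Fin 3 → ℝ) → ENNReal} (hg : Measurable g) :
    ∫⁻ n : Fin 3 → ℝ, ENNReal.ofReal (∏ j, expWeight (n j)) * g n =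
      ENNReal.ofReal (a * b * c) * laplace a fun x => laplace b fun y => laplace c fun z =>
        g ![a * x, b * y, c * z] := by
  rw [lintegral_fin_three (f := fun n => ENNReal.ofReal (∏ j, expWeight (n j)) * g n)
    (Measurable.mul (by fun_prop) hg), ENNReal.ofReal_mul (by positivity),
    ENNReal.ofReal_mul ha.le]
  have h : ∀ x y z : ℝ, ENNReal.ofReal (∏ j, expWeight (![x, y, z] j)) * g ![x, y, z] =
      ENNReal.ofReal (expWeight x) * (ENNReal.ofReal (expWeight y) *
        (ENNReal.ofReal (expWeight z) * g ![x, y, z])) := by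
    intro x y z
    rw [Fin.prod_univ_three, ENNReal.ofReal_mul (mul_nonneg (expWeight_nonneg _)
      (expWeight_nonneg _)), ENNReal.ofReal_mul (expWeight_nonneg _)]
    simp only [Matrix.cons_val, mul_assoc]
  simp only [h, lintegral_const_mul' _ _ ENNReal.ofReal_ne_top, lintegral_expWeight_mul_eq_laplace]
  have h2 : ∀ x, laplace 1 (fun y => laplace 1 fun z => g ![x, y, z]) = ENNReal.ofReal b *
      (ENNReal.ofReal c * laplace b fun y => laplace c fun z => g ![x, b * y, c * z]) := by
    intro x
    rw [laplace_one_eq_mul hb]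
    simp only [laplace_one_eq_mul hc, laplace_ofReal_mul]
  rw [laplace_congr fun x _ => h2 x, laplace_one_eq_mul ha]
  simp only [laplace_ofReal_mul]
  ring

theorem gapMean_eq {a b c : ℝ} (ha : 0 < a) (hb : 0 < b) (hc : 0 < c) (p : Fin 3 → ℝ) :
    gapMean p = ENNReal.ofReal (a * b * c) * laplace a fun x => laplace b fun y =>
      laplace c fun z => laplace 1 fun t =>
        ENNReal.ofReal |t - (a * x * p 0 + b * y * p 1 + c * z * p 2)| := by
  have hm : Measurable fun m : Fin 3 → ℝ => laplace 1 fun t => ENNReal.ofReal |t - m ⬝ᵥ p| :=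
    Measurable.laplace (f := fun (m : Fin 3 → ℝ) t => ENNReal.ofReal |t - m ⬝ᵥ p|)
      (by unfold Function.uncurry; simp only [dotProduct]; fun_prop)
  have h := lintegral_prod_expWeight_mul ha hb hc hm
  simp only [dotProduct, Fin.sum_univ_three, Matrix.cons_val] at h
  rw [← h, gapMean]
  refine lintegral_congr fun m => ?_
  rw [← lintegral_expWeight_mul_eq_laplace, ← lintegral_const_mul' _ _ ENNReal.ofReal_ne_top]
  refine lintegral_congr fun t => ?_
  rw [mul_comm, ENNReal.ofReal_mul' (abs_nonneg _),
    ENNReal.ofReal_mul' (expWeight_nonneg _), mul_assoc]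
  simp only [dotProduct, Fin.sum_univ_three]

theorem momentMatrix_eq {a b c : ℝ} (ha : 0 < a) (hb : 0 < b) (hc : 0 < c) (p : Fin 3 → ℝ)
    (i j : Fin 3) :
    momentMatrix p i j = (ENNReal.ofReal (a * b * c) * laplace a fun x => laplace b fun y =>
      laplace c fun z => ENNReal.ofReal (expWeight (a * x * p 0 + b * y * p 1 + c * z * p 2)) *
        ENNReal.ofReal (![a * x, b * y, c * z] i * ![a * x, b * y, c * z] j)).toReal := by
  have hm : Measurable fun n : Fin 3 → ℝ => ENNReal.ofReal (expWeight (n ⬝ᵥ p)) *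
      ENNReal.ofReal (n i * n j) := by
    simp only [dotProduct]; fun_prop
  have h := lintegral_prod_expWeight_mul ha hb hc hm
  simp only [dotProduct, Fin.sum_univ_three] at h
  change _ = (ENNReal.ofReal (a * b * c) * laplace a fun x => laplace b fun y =>
      laplace c fun z => ENNReal.ofReal (expWeight (![a * x, b * y, c * z] 0 * p 0 +
        ![a * x, b * y, c * z] 1 * p 1 + ![a * x, b * y, c * z] 2 * p 2)) * _).toReal
  rw [← h, momentMatrix, Matrix.of_apply, integral_eq_lintegral_of_nonneg_ae]
  · congr 1
    refine lintegral_congr fun n => ?_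
    rw [ENNReal.ofReal_mul' (rowWeight_nonneg _ _), rowWeight,
      ENNReal.ofReal_mul' (expWeight_nonneg _), mul_comm, mul_assoc]
    simp only [dotProduct, Fin.sum_univ_three]
  · refine ae_of_all _ fun n => ?_
    by_cases hn : ∀ j, 0 < n j
    · exact mul_nonneg (mul_nonneg (hn i).le (hn j).le) (rowWeight_nonneg _ _)
    · push Not at hn
      obtain ⟨l, hl⟩ := hn
      have : rowWeight p n = 0 := by
        rw [rowWeight, Finset.prod_eq_zero (Finset.mem_univ l) (expWeight_of_nonpos hl), zero_mul]
      simp [this]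
  · exact (integrable_mul_mul_rowWeight p i j).aestronglyMeasurable

/-- The second moments of the random vector `x • α + y • β + z • γ`, the coordinates `x`, `y`, `z`
having exponential weights of rates `L₁`, `L₂`, `L₃`. -/
noncomputable def biMoment (L₁ L₂ L₃ : ℝ) (α β γ : Fin 3 → ℝ) (i j : Fin 3) : ℝ :=
  (α i * α j / L₁ ^ 2 + β i * β j / L₂ ^ 2 + γ i * γ j / L₃ ^ 2 +
    (α i / L₁ + β i / L₂ + γ i / L₃) * (α j / L₁ + β j / L₂ + γ j / L₃)) / (L₁ * L₂ * L₃)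

theorem laplace_biMoment {L₁ L₂ L₃ : ℝ} (h₁ : 0 < L₁) (h₂ : 0 < L₂) (h₃ : 0 < L₃)
    {α β γ d : Fin 3 → ℝ} (hα : 0 ≤ α) (hβ : 0 ≤ β) (hγ : 0 ≤ γ) (hd : 0 ≤ d)
    {u : ℝ → ℝ → ℝ → Fin 3 → ℝ} (hu : ∀ x y z i, u x y z i = d i * (α i * x + β i * y + γ i * z))
    (i j : Fin 3) :
    laplace L₁ (fun x => laplace L₂ fun y => laplace L₃ fun z =>
      ENNReal.ofReal (u x y z i * u x y z j)) =
      ENNReal.ofReal (d i * d j * biMoment L₁ L₂ L₃ α β γ i j) := by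
  rw [ENNReal.ofReal_mul (mul_nonneg (hd i) (hd j)), biMoment,
    ← laplace_bilinear h₁ h₂ h₃ (hα i) (hβ i) (hγ i) (hα j) (hβ j) (hγ j)]
  simp only [← laplace_ofReal_mul]
  refine laplace_congr fun x _ => laplace_congr fun y _ => laplace_congr fun z _ => ?_
  rw [← ENNReal.ofReal_mul (mul_nonneg (hd i) (hd j)), hu, hu]
  congr 1; ring

theorem biMoment_nonneg {L₁ L₂ L₃ : ℝ} (h₁ : 0 < L₁) (h₂ : 0 < L₂) (h₃ : 0 < L₃)
    {α β γ : Fin 3 → ℝ} (hα : 0 ≤ α) (hβ : 0 ≤ β) (hγ : 0 ≤ γ) (i j : Fin 3) :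
    0 ≤ biMoment L₁ L₂ L₃ α β γ i j := by
  have := hα i; have := hα j; have := hβ i; have := hβ j; have := hγ i; have := hγ j
  simp only [Pi.zero_apply] at *
  unfold biMoment
  positivity

noncomputable def absOneThree (e a b c : ℝ) : ℝ :=
  (e + a)⁻¹ * ((b + e)⁻¹ * ((b * c)⁻¹ * (b⁻¹ + c⁻¹) +
    (c + e)⁻¹ * ((c ^ 2)⁻¹ + (e ^ 2)⁻¹)) + (a * b * c)⁻¹ * (a⁻¹ + b⁻¹ + c⁻¹))

noncomputable def absTwoTwo (a b c d : ℝ) : ℝ :=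
  (a + c)⁻¹ * ((a + d)⁻¹ * ((a * b)⁻¹ * (a⁻¹ + b⁻¹) +
    (b + d)⁻¹ * ((b ^ 2)⁻¹ + (d ^ 2)⁻¹)) + (c + b)⁻¹ * ((c * d)⁻¹ * (c⁻¹ + d⁻¹) +
      (d + b)⁻¹ * ((d ^ 2)⁻¹ + (b ^ 2)⁻¹)))

theorem laplace_abs_three_one {e a b c : ℝ} (he : 0 < e) (ha : 0 < a) (hb : 0 < b) (hc : 0 < c) :
    laplace a (fun x => laplace b fun y => laplace c fun z => laplace e fun s =>
      ENNReal.ofReal |s - x - y - z|) = ENNReal.ofReal (absOneThree e a b c) := by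
  rw [absOneThree, ← laplace_abs_one_three he ha hb hc]
  have h3 : ∀ x y, laplace c (fun z => laplace e fun s => ENNReal.ofReal |s - x - y - z|) =
      laplace e fun s => laplace c fun z => ENNReal.ofReal |s - x - y - z| := fun x y =>
    laplace_comm c e (f := fun z s => ENNReal.ofReal |s - x - y - z|)
      (by unfold Function.uncurry; fun_prop)
  have h2 : ∀ x, laplace b (fun y => laplace e fun s => laplace c fun z =>
      ENNReal.ofReal |s - x - y - z|) = laplace e fun s => laplace b fun y => laplace c fun z =>
      ENNReal.ofReal |s - x - y - z| := fun x => laplace_comm b e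
      (f := fun y s => laplace c fun z => ENNReal.ofReal |s - x - y - z|)
      (Measurable.laplace (f := fun (q : ℝ × ℝ) z => ENNReal.ofReal |q.2 - x - q.1 - z|)
        (by unfold Function.uncurry; fun_prop))
  simp only [h3, h2]
  exact laplace_comm a e (f := fun x s => laplace b fun y => laplace c fun z =>
    ENNReal.ofReal |s - x - y - z|) (Measurable.laplace (f := fun (q : ℝ × ℝ) y =>
      laplace c fun z => ENNReal.ofReal |q.2 - q.1 - y - z|)
      (Measurable.laplace (f := fun (q : (ℝ × ℝ) × ℝ) z =>
        ENNReal.ofReal |q.1.2 - q.1.1 - q.2 - z|) (by unfold Function.uncurry; fun_prop)))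

theorem gapMean_pos_pos_pos {a b c : ℝ} (ha : 0 < a) (hb : 0 < b) (hc : 0 < c) :
    gapMean ![a⁻¹, b⁻¹, c⁻¹] = ENNReal.ofReal (a * b * c * absOneThree 1 a b c) := by
  rw [gapMean_eq ha hb hc, ENNReal.ofReal_mul (p := a * b * c) (by positivity),
    ← laplace_abs_three_one one_pos ha hb hc]
  congr 1
  refine laplace_congr fun x _ => laplace_congr fun y _ => laplace_congr fun z _ =>
    laplace_congr fun t _ => ?_
  congr 2; simp; field_simp; ring

theorem gapMean_pos_neg_neg {a b c : ℝ} (ha : 0 < a) (hb : 0 < b) (hc : 0 < c) :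
    gapMean ![a⁻¹, -b⁻¹, -c⁻¹] = ENNReal.ofReal (a * b * c * absOneThree a b c 1) := by
  rw [gapMean_eq ha hb hc, ENNReal.ofReal_mul (p := a * b * c) (by positivity), absOneThree,
    ← laplace_abs_one_three ha hb hc one_pos]
  congr 1
  refine laplace_congr fun x _ => laplace_congr fun y _ => laplace_congr fun z _ =>
    laplace_congr fun t _ => ?_
  rw [← abs_neg]
  congr 2; simp; field_simp; ring

theorem gapMean_pos_pos_neg {a b c : ℝ} (ha : 0 < a) (hb : 0 < b) (hc : 0 < c) :
    gapMean ![a⁻¹, b⁻¹, -c⁻¹] = ENNReal.ofReal (a * b * c * absTwoTwo a b c 1) := by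
  rw [gapMean_eq ha hb hc, ENNReal.ofReal_mul (p := a * b * c) (by positivity), absTwoTwo,
    ← laplace_abs_two_two ha hb hc one_pos]
  congr 1
  refine laplace_congr fun x _ => laplace_congr fun y _ => laplace_congr fun z _ =>
    laplace_congr fun t _ => ?_
  rw [← abs_neg]
  congr 2; simp; field_simp; ring

theorem det_of_mul_mul_mul (d : Fin 3 → ℝ) (k : ℝ) (X : Fin 3 → Fin 3 → ℝ) :
    (Matrix.of fun i j => k * (d i * d j * X i j)).det =
      k ^ 3 * (d 0 * d 1 * d 2) ^ 2 * (Matrix.of X).det := by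
  simp only [Matrix.det_fin_three, Matrix.of_apply]
  ring

theorem det_momentMatrix_of_laplace {a b c : ℝ} (ha : 0 < a) (hb : 0 < b) (hc : 0 < c)
    {p : Fin 3 → ℝ} {X : Fin 3 → Fin 3 → ℝ}
    (hX : ∀ i j, 0 ≤ X i j)
    (h : ∀ i j, (laplace a fun x => laplace b fun y => laplace c fun z =>
      ENNReal.ofReal (expWeight (a * x * p 0 + b * y * p 1 + c * z * p 2)) *
        ENNReal.ofReal (![a * x, b * y, c * z] i * ![a * x, b * y, c * z] j)) =
      ENNReal.ofReal (![a, b, c] i * ![a, b, c] j * X i j)) :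
    (momentMatrix p).det = (a * b * c) ^ 5 * (Matrix.of X).det := by
  have hd : ∀ i, 0 ≤ ![a, b, c] i := by
    intro i; fin_cases i <;> simp [ha.le, hb.le, hc.le]
  have : momentMatrix p = Matrix.of fun i j => a * b * c * (![a, b, c] i * ![a, b, c] j * X i j) := by
    ext i j
    rw [momentMatrix_eq ha hb hc, h, ← ENNReal.ofReal_mul (by positivity), ENNReal.toReal_ofReal]
    · rfl
    · have := hd i; have := hd j; have := hX i j
      positivity
  rw [this, det_of_mul_mul_mul]
  simp only [Matrix.cons_val]
  ring

theorem det_momentMatrix_pos_pos_pos {a b c : ℝ} (ha : 0 < a) (hb : 0 < b) (hc : 0 < c) :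
    (momentMatrix ![a⁻¹, b⁻¹, c⁻¹]).det =
      (a * b * c) ^ 5 * (4 / ((a + 1) * (b + 1) * (c + 1)) ^ 5) := by
  have hα : (0 : Fin 3 → ℝ) ≤ ![1, 0, 0] := by intro i; fin_cases i <;> simp
  have hβ : (0 : Fin 3 → ℝ) ≤ ![0, 1, 0] := by intro i; fin_cases i <;> simp
  have hγ : (0 : Fin 3 → ℝ) ≤ ![0, 0, 1] := by intro i; fin_cases i <;> simp
  have hd : (0 : Fin 3 → ℝ) ≤ ![a, b, c] := by
    intro i; fin_cases i <;> simp [ha.le, hb.le, hc.le]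
  have h1 : 0 < a + 1 := by positivity
  have h2 : 0 < b + 1 := by positivity
  have h3 : 0 < c + 1 := by positivity
  rw [det_momentMatrix_of_laplace ha hb hc (biMoment_nonneg h1 h2 h3 hα hβ hγ)]
  · congr 1
    simp [Matrix.det_fin_three, biMoment]
    field_simp
    ring
  · intro i j
    rw [← laplace_biMoment h1 h2 h3 hα hβ hγ hd (u := fun x y z => ![a * x, b * y, c * z])
      (fun x y z i => by fin_cases i <;> simp), ← laplace_expWeight_add_add_mul]
    refine laplace_congr fun x _ => laplace_congr fun y _ => laplace_congr fun z _ => ?_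
    congr 3; simp; field_simp

theorem det_momentMatrix_pos_neg_neg {a b c : ℝ} (ha : 0 < a) (hb : 0 < b) (hc : 0 < c) :
    (momentMatrix ![a⁻¹, -b⁻¹, -c⁻¹]).det =
      (a * b * c) ^ 5 * (4 / ((a + b) * (a + c) * (a + 1)) ^ 5) := by
  have hα : (0 : Fin 3 → ℝ) ≤ ![1, 1, 0] := by intro i; fin_cases i <;> simp
  have hβ : (0 : Fin 3 → ℝ) ≤ ![1, 0, 1] := by intro i; fin_cases i <;> simp
  have hγ : (0 : Fin 3 → ℝ) ≤ ![1, 0, 0] := by intro i; fin_cases i <;> simp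
  have hd : (0 : Fin 3 → ℝ) ≤ ![a, b, c] := by
    intro i; fin_cases i <;> simp [ha.le, hb.le, hc.le]
  have h1 : 0 < a + b := by positivity
  have h2 : 0 < a + c := by positivity
  have h3 : 0 < a + 1 := by positivity
  rw [det_momentMatrix_of_laplace ha hb hc (biMoment_nonneg h1 h2 h3 hα hβ hγ)]
  · congr 1
    simp [Matrix.det_fin_three, biMoment]
    field_simp
    ring
  · intro i j
    have hm : Measurable fun q : ℝ × ℝ × ℝ => ENNReal.ofReal
        (![a * q.1, b * q.2.1, c * q.2.2] i * ![a * q.1, b * q.2.1, c * q.2.2] j) := by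
      fin_cases i <;> fin_cases j <;> simp <;> fun_prop
    rw [← laplace_biMoment h1 h2 h3 hα hβ hγ hd (u := fun x y z =>
      ![a * (x + y + z), b * x, c * y]) (fun x y z i => by fin_cases i <;> simp),
      ← laplace_expWeight_sub_sub_mul a b c hm]
    refine laplace_congr fun x _ => laplace_congr fun y _ => laplace_congr fun z _ => ?_
    congr 3; simp; field_simp; ring

theorem det_momentMatrix_pos_pos_neg {a b c : ℝ} (ha : 0 < a) (hb : 0 < b) (hc : 0 < c) :
    (momentMatrix ![a⁻¹, b⁻¹, -c⁻¹]).det = (a * b * c) ^ 5 *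
      (4 * (a + b + c + 1) * ((a + b + c + 1) ^ 4 - 4 * ((a + c) * (a + 1) * (b + c) * (b + 1))) /
        ((a + c) * (a + 1) * (b + c) * (b + 1)) ^ 5) := by
  have hα : (0 : Fin 3 → ℝ) ≤ ![1, 0, 1] := by intro i; fin_cases i <;> simp
  have hβ : (0 : Fin 3 → ℝ) ≤ ![1, 0, 0] := by intro i; fin_cases i <;> simp
  have hγ : (0 : Fin 3 → ℝ) ≤ ![0, 1, 0] := by intro i; fin_cases i <;> simp
  have hβ' : (0 : Fin 3 → ℝ) ≤ ![0, 1, 1] := by intro i; fin_cases i <;> simp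
  have hd : (0 : Fin 3 → ℝ) ≤ ![a, b, c] := by
    intro i; fin_cases i <;> simp [ha.le, hb.le, hc.le]
  have h1 : 0 < a + c := by positivity
  have h2 : 0 < a + 1 := by positivity
  have h3 : 0 < b + 1 := by positivity
  have h4 : 0 < b + c := by positivity
  rw [det_momentMatrix_of_laplace ha hb hc (X := fun i j =>
    biMoment (a + c) (a + 1) (b + 1) ![1, 0, 1] ![1, 0, 0] ![0, 1, 0] i j +
      biMoment (a + c) (b + c) (b + 1) ![1, 0, 1] ![0, 1, 1] ![0, 1, 0] i j)]
  · congr 1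
    simp [Matrix.det_fin_three, biMoment]
    field_simp
    ring
  · exact fun i j => add_nonneg (biMoment_nonneg h1 h2 h3 hα hβ hγ i j)
      (biMoment_nonneg h1 h4 h3 hα hβ' hγ i j)
  · intro i j
    have hm : Measurable fun q : ℝ × ℝ × ℝ => ENNReal.ofReal
        (![a * q.1, b * q.2.1, c * q.2.2] i * ![a * q.1, b * q.2.1, c * q.2.2] j) := by
      fin_cases i <;> fin_cases j <;> simp <;> fun_prop
    rw [mul_add, ENNReal.ofReal_add (mul_nonneg (mul_nonneg (hd i) (hd j))
        (biMoment_nonneg h1 h2 h3 hα hβ hγ i j)) (mul_nonneg (mul_nonneg (hd i) (hd j))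
        (biMoment_nonneg h1 h4 h3 hα hβ' hγ i j)),
      ← laplace_biMoment h1 h2 h3 hα hβ hγ hd (u := fun z m y =>
      ![a * (z + m), b * y, c * z]) (fun x y z i => by fin_cases i <;> simp),
      ← laplace_biMoment h1 h4 h3 hα hβ' hγ hd (u := fun x m k =>
      ![a * x, b * (m + k), c * (x + m)]) (fun x y z i => by fin_cases i <;> simp),
      ← laplace_expWeight_add_sub_mul a b c hm]
    refine laplace_congr fun x _ => laplace_congr fun y _ => laplace_congr fun z _ => ?_
    congr 3; simp; field_simp; ring

noncomputable def cramerDensity (p : Fin 3 → ℝ) : ENNReal :=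
  gapMean p * ENNReal.ofReal (6 * (momentMatrix p).det)

theorem measurable_momentMatrix (i j : Fin 3) : Measurable fun p => momentMatrix p i j := by
  simp only [momentMatrix, Matrix.of_apply]
  refine (StronglyMeasurable.integral_prod_right' (f := fun q : (Fin 3 → ℝ) × (Fin 3 → ℝ) =>
    q.2 i * q.2 j * rowWeight q.1 q.2) (Measurable.stronglyMeasurable ?_)).measurable
  exact Measurable.mul (by fun_prop) measurable_uncurry_rowWeight

theorem measurable_cramerDensity : Measurable cramerDensity := by
  have h := measurable_momentMatrix
  have : Measurable fun p => (momentMatrix p).det := by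
    simp only [Matrix.det_fin_three]
    fun_prop
  exact measurable_gapMean.mul (by fun_prop)

theorem cramerDensity_comp_perm (p : Fin 3 → ℝ) (σ : Equiv.Perm (Fin 3)) :
    cramerDensity (p ∘ σ) = cramerDensity p := by
  set e := MeasurableEquiv.piCongrLeft (fun _ : Fin 3 => ℝ) σ with he
  have hmp : MeasurePreserving e := volume_measurePreserving_piCongrLeft (fun _ : Fin 3 => ℝ) σ
  have hev : ∀ (m : Fin 3 → ℝ) i, e m (σ i) = m i := fun m i => by
    rw [he, MeasurableEquiv.coe_piCongrLeft]
    exact Equiv.piCongrLeft_apply_apply (fun _ : Fin 3 => ℝ) σ m i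
  have hdot : ∀ m : Fin 3 → ℝ, e m ⬝ᵥ p = m ⬝ᵥ (p ∘ σ) := fun m => by
    simp only [dotProduct]
    rw [← Equiv.sum_comp σ]
    simp [hev]
  have hprod : ∀ m : Fin 3 → ℝ, ∏ j, expWeight (e m j) = ∏ j, expWeight (m j) := fun m => by
    rw [← Equiv.prod_comp σ]
    simp [hev]
  have hg : gapMean (p ∘ σ) = gapMean p := by
    rw [gapMean, gapMean]
    conv_rhs => rw [← hmp.lintegral_comp_emb e.measurableEmbedding]
    simp only [hdot, hprod]
  have hS : momentMatrix (p ∘ σ) = (momentMatrix p).submatrix σ σ := by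
    ext i j
    rw [Matrix.submatrix_apply, momentMatrix, momentMatrix, Matrix.of_apply, Matrix.of_apply]
    conv_rhs => rw [← hmp.integral_comp e.measurableEmbedding]
    simp only [rowWeight, hdot, hprod, hev]
  rw [cramerDensity, cramerDensity, hg, hS, Matrix.det_submatrix_equiv_self]

theorem cramerDensity_swap_left (x y z : ℝ) :
    cramerDensity ![x, y, z] = cramerDensity ![y, x, z] := by
  rw [← cramerDensity_comp_perm _ (Equiv.swap 0 1)]
  congr 1; ext i; fin_cases i <;> rfl

theorem cramerDensity_swap_right (x y z : ℝ) :
    cramerDensity ![x, y, z] = cramerDensity ![x, z, y] := by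
  rw [← cramerDensity_comp_perm _ (Equiv.swap 1 2)]
  congr 1; ext i; fin_cases i <;> rfl

theorem cramerDensity_of_nonpos {p : Fin 3 → ℝ} (hp : ∀ i, p i ≤ 0) : cramerDensity p = 0 := by
  have h : ∀ n, rowWeight p n = 0 := by
    intro n
    by_cases hn : ∀ j, 0 < n j
    · rw [rowWeight, expWeight_of_nonpos (x := n ⬝ᵥ p), mul_zero]
      exact Finset.sum_nonpos fun i _ => mul_nonpos_of_nonneg_of_nonpos (hn i).le (hp i)
    · push Not at hn
      obtain ⟨l, hl⟩ := hn
      rw [rowWeight, Finset.prod_eq_zero (Finset.mem_univ l) (expWeight_of_nonpos hl), zero_mul]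
  have hS : momentMatrix p = 0 := by
    ext i j
    simp [momentMatrix, h]
  simp [cramerDensity, hS]

/-- The integral over the positive octant. -/
noncomputable def octantLIntegral (f : ℝ → ℝ → ℝ → ENNReal) : ENNReal :=
  ∫⁻ x in Set.Ioi 0, ∫⁻ y in Set.Ioi 0, ∫⁻ z in Set.Ioi 0, f x y z

theorem octantLIntegral_congr {f g : ℝ → ℝ → ℝ → ENNReal}
    (h : ∀ x y z, 0 < x → 0 < y → 0 < z → f x y z = g x y z) :
    octantLIntegral f = octantLIntegral g :=
  setLIntegral_congr_fun measurableSet_Ioi fun x hx =>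
    setLIntegral_congr_fun measurableSet_Ioi fun y hy =>
      setLIntegral_congr_fun measurableSet_Ioi fun z hz => h x y z hx hy hz

theorem octantLIntegral_swap_right {f : ℝ × ℝ × ℝ → ENNReal} (hf : Measurable f) :
    octantLIntegral (fun x y z => f (x, z, y)) = octantLIntegral fun x y z => f (x, y, z) := by
  refine lintegral_congr fun x => ?_
  exact lintegral_lintegral_swap (f := fun y z => f (x, z, y))
    (hf.comp (by fun_prop : Measurable fun q : ℝ × ℝ => (x, q.2, q.1))).aemeasurable

theorem octantLIntegral_swap_left {f : ℝ × ℝ × ℝ → ENNReal} (hf : Measurable f) :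
    octantLIntegral (fun x y z => f (y, x, z)) = octantLIntegral fun x y z => f (x, y, z) := by
  rw [octantLIntegral, octantLIntegral, lintegral_lintegral_swap]
  exact (Measurable.lintegral_prod_right' (f := fun q : (ℝ × ℝ) × ℝ => f (q.1.2, q.1.1, q.2))
    (hf.comp (by fun_prop))).aemeasurable

theorem octantLIntegral_const_mul {c : ENNReal} (hc : c ≠ ⊤) (f : ℝ → ℝ → ℝ → ENNReal) :
    octantLIntegral (fun x y z => c * f x y z) = c * octantLIntegral f := by
  simp only [octantLIntegral, lintegral_const_mul' _ _ hc]

theorem octantLIntegral_inv (f : ℝ → ℝ → ℝ → ENNReal) :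
    octantLIntegral f = octantLIntegral fun x y z =>
      ENNReal.ofReal (((x * y * z) ^ 2)⁻¹) * f x⁻¹ y⁻¹ z⁻¹ := by
  rw [octantLIntegral, lintegral_Ioi_zero_comp_inv]
  refine lintegral_congr fun x => ?_
  rw [lintegral_Ioi_zero_comp_inv, ← lintegral_const_mul' _ _ ENNReal.ofReal_ne_top]
  refine lintegral_congr fun y => ?_
  rw [lintegral_Ioi_zero_comp_inv, ← lintegral_const_mul' _ _ ENNReal.ofReal_ne_top,
    ← lintegral_const_mul' _ _ ENNReal.ofReal_ne_top]
  refine lintegral_congr fun z => ?_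
  beta_reduce
  rw [mul_pow, mul_pow, mul_inv, mul_inv, ENNReal.ofReal_mul (by positivity),
    ENNReal.ofReal_mul (by positivity), mul_assoc, mul_assoc]

theorem lintegral_eq_octantLIntegral {f : ℝ × ℝ × ℝ → ENNReal} (hf : Measurable f) :
    ∫⁻ x, ∫⁻ y, ∫⁻ z, f (x, y, z) =
      (((octantLIntegral fun x y z => f (x, y, z)) + octantLIntegral fun x y z => f (x, y, -z)) +
      ((octantLIntegral fun x y z => f (x, -y, z)) + octantLIntegral fun x y z => f (x, -y, -z))) +
      (((octantLIntegral fun x y z => f (-x, y, z)) + octantLIntegral fun x y z => f (-x, y, -z)) +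
      ((octantLIntegral fun x y z => f (-x, -y, z)) +
        octantLIntegral fun x y z => f (-x, -y, -z))) := by
  have h2 : ∀ {g : ℝ × ℝ → ENNReal}, Measurable g → ∀ (μ : Measure ℝ) [SFinite μ],
      ∫⁻ x, ∫⁻ y, g (x, y) ∂volume ∂μ = (∫⁻ x, ∫⁻ y in Set.Ioi 0, g (x, y) ∂volume ∂μ) +
        ∫⁻ x, ∫⁻ y in Set.Ioi 0, g (x, -y) ∂volume ∂μ := by
    intro g hg μ _
    rw [← lintegral_add_left]
    · exact lintegral_congr fun x => lintegral_eq_Ioi_add_Ioi_neg _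
    · exact Measurable.lintegral_prod_right' hg
  have h3 : ∀ {g : ℝ × ℝ × ℝ → ENNReal}, Measurable g →
      ∫⁻ x in Set.Ioi 0, ∫⁻ y in Set.Ioi 0, ∫⁻ z, g (x, y, z) =
      (octantLIntegral fun x y z => g (x, y, z)) + octantLIntegral fun x y z => g (x, y, -z) := by
    intro g hg
    rw [octantLIntegral, octantLIntegral, ← lintegral_add_left]
    · exact lintegral_congr fun x => h2 (hg.comp (by fun_prop : Measurable fun q : ℝ × ℝ =>
        (x, q.1, q.2))) _
    · exact Measurable.lintegral_prod_right' (f := fun q : ℝ × ℝ => ∫⁻ z in Set.Ioi 0,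
        g (q.1, q.2, z)) (Measurable.lintegral_prod_right' (f := fun q : (ℝ × ℝ) × ℝ =>
          g (q.1.1, q.1.2, q.2)) (hg.comp (by fun_prop)))
  have hz : Measurable fun q : ℝ × ℝ => ∫⁻ z, f (q.1, q.2, z) :=
    Measurable.lintegral_prod_right' (f := fun q : (ℝ × ℝ) × ℝ => f (q.1.1, q.1.2, q.2))
      (hf.comp (by fun_prop))
  rw [lintegral_eq_Ioi_add_Ioi_neg, h2 (g := fun q => ∫⁻ z, f (q.1, q.2, z)) hz,
    h2 (g := fun q => ∫⁻ z, f (-q.1, q.2, z)) (hz.comp (by fun_prop : Measurable fun q : ℝ × ℝ =>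
      (-q.1, q.2))), h3 hf,
    h3 (g := fun q => f (q.1, -q.2.1, q.2.2)) (hf.comp (by fun_prop)),
    h3 (g := fun q => f (-q.1, q.2.1, q.2.2)) (hf.comp (by fun_prop)),
    h3 (g := fun q => f (-q.1, -q.2.1, q.2.2)) (hf.comp (by fun_prop))]

theorem lintegral_cramerDensity_eq_octant :
    ∫⁻ p, cramerDensity p = (octantLIntegral fun x y z => cramerDensity ![x, y, z]) +
      3 * (octantLIntegral fun x y z => cramerDensity ![x, -y, -z]) +
      3 * octantLIntegral fun x y z => cramerDensity ![x, y, -z] := by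
  have hm : ∀ s t u : ℝ, Measurable fun q : ℝ × ℝ × ℝ =>
      cramerDensity ![s * q.1, t * q.2.1, u * q.2.2] := fun s t u =>
    measurable_cramerDensity.comp (measurable_pi_iff.2 fun i => by
      fin_cases i <;> simp <;> fun_prop)
  have hs : ∀ s t u : ℝ, (octantLIntegral fun x y z => cramerDensity ![s * x, t * y, u * z]) =
      octantLIntegral fun x y z => cramerDensity ![s * x, u * y, t * z] := fun s t u => by
    rw [← octantLIntegral_swap_right (hm s t u)]
    simp only [fun x y z => cramerDensity_swap_right (s * x) (t * z) (u * y)]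
  have hs' : ∀ s t u : ℝ, (octantLIntegral fun x y z => cramerDensity ![s * x, t * y, u * z]) =
      octantLIntegral fun x y z => cramerDensity ![t * x, s * y, u * z] := fun s t u => by
    rw [← octantLIntegral_swap_left (hm s t u)]
    simp only [fun x y z => cramerDensity_swap_left (s * y) (t * x) (u * z)]
  have h0 : (octantLIntegral fun x y z => cramerDensity ![-x, -y, -z]) = 0 := by
    rw [octantLIntegral_congr (g := fun _ _ _ => 0)]
    · simp [octantLIntegral]
    · intro x y z hx hy hz
      refine cramerDensity_of_nonpos fun i => ?_
      fin_cases i <;> simp <;> linarith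
  have e1 := hs 1 (-1) 1
  have e2 := (hs' (-1) 1 1).trans e1
  have e3 := hs' (-1) 1 (-1)
  have e4 := (hs (-1) (-1) 1).trans e3
  simp only [one_mul, neg_one_mul] at e1 e2 e3 e4
  rw [lintegral_fin_three measurable_cramerDensity]
  have := lintegral_eq_octantLIntegral (hm 1 1 1)
  simp only [one_mul] at this
  rw [this, h0, e1, e2, e3, e4]
  ring

/-- The contribution of a sign pattern with one coefficient opposite to the other three. -/
noncomputable def densityOneThree (e a b c : ℝ) : ℝ :=
  24 * (e * a * b * c) ^ 4 * absOneThree e a b c / ((a + e) * (b + e) * (c + e)) ^ 5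

/-- The contribution of a sign pattern with two coefficients opposite to the other two. -/
noncomputable def densityTwoTwo (a b c d : ℝ) : ℝ :=
  24 * (a * b * c * d) ^ 4 * absTwoTwo a b c d *
    ((a + b + c + d) * ((a + b + c + d) ^ 4 - 4 * ((a + c) * (a + d) * (b + c) * (b + d))) /
      ((a + c) * (a + d) * (b + c) * (b + d)) ^ 5)

theorem ofReal_mul_cramerDensity_eq {p : Fin 3 → ℝ} {a b c g D F : ℝ} (ha : 0 < a) (hb : 0 < b)
    (hc : 0 < c) (hg0 : 0 ≤ g) (hg : gapMean p = ENNReal.ofReal (a * b * c * g))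
    (hD : (momentMatrix p).det = (a * b * c) ^ 5 * D) (hF : F = 6 * (a * b * c) ^ 4 * g * D) :
    ENNReal.ofReal (((a * b * c) ^ 2)⁻¹) * cramerDensity p = ENNReal.ofReal F := by
  rw [cramerDensity, hg, hD, ← ENNReal.ofReal_mul (by positivity),
    ← ENNReal.ofReal_mul (by positivity), hF]
  congr 1
  field_simp

theorem absOneThree_nonneg {e a b c : ℝ} (he : 0 < e) (ha : 0 < a) (hb : 0 < b) (hc : 0 < c) :
    0 ≤ absOneThree e a b c := by
  rw [absOneThree]; positivity

theorem absTwoTwo_nonneg {a b c d : ℝ} (ha : 0 < a) (hb : 0 < b) (hc : 0 < c) (hd : 0 < d) :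
    0 ≤ absTwoTwo a b c d := by
  rw [absTwoTwo]; positivity

theorem lintegral_cramerDensity_eq_densities :
    ∫⁻ p, cramerDensity p =
      (octantLIntegral fun a b c => ENNReal.ofReal (densityOneThree 1 a b c)) +
      3 * (octantLIntegral fun a b c => ENNReal.ofReal (densityOneThree a b c 1)) +
      3 * octantLIntegral fun a b c => ENNReal.ofReal (densityTwoTwo a b c 1) := by
  rw [lintegral_cramerDensity_eq_octant]
  refine congrArg₂ _ (congrArg₂ _ ?_ (congrArg _ ?_)) (congrArg _ ?_)
  all_goals
    rw [octantLIntegral_inv]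
    refine octantLIntegral_congr fun a b c ha hb hc => ?_
  · refine ofReal_mul_cramerDensity_eq ha hb hc (absOneThree_nonneg one_pos ha hb hc)
      (gapMean_pos_pos_pos ha hb hc) (det_momentMatrix_pos_pos_pos ha hb hc) ?_
    rw [densityOneThree]
    generalize (a + 1) * (b + 1) * (c + 1) = r
    ring
  · refine ofReal_mul_cramerDensity_eq ha hb hc (absOneThree_nonneg ha hb hc one_pos)
      (gapMean_pos_neg_neg ha hb hc) (det_momentMatrix_pos_neg_neg ha hb hc) ?_
    rw [densityOneThree, add_comm b a, add_comm c a, add_comm 1 a]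
    generalize (a + b) * (a + c) * (a + 1) = r
    ring
  · refine ofReal_mul_cramerDensity_eq ha hb hc (absTwoTwo_nonneg ha hb hc one_pos)
      (gapMean_pos_pos_neg ha hb hc) (det_momentMatrix_pos_pos_neg ha hb hc) ?_
    rw [densityTwoTwo]
    generalize a + b + c + 1 = s
    generalize (a + c) * (a + 1) * (b + c) * (b + 1) = r
    ring

theorem measurable_densityOneThree : Measurable fun q : ℝ × ℝ × ℝ × ℝ =>
    densityOneThree q.1 q.2.1 q.2.2.1 q.2.2.2 := by
  unfold densityOneThree absOneThree
  fun_prop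

theorem measurable_densityTwoTwo : Measurable fun q : ℝ × ℝ × ℝ × ℝ =>
    densityTwoTwo q.1 q.2.1 q.2.2.1 q.2.2.2 := by
  unfold densityTwoTwo absTwoTwo
  fun_prop

theorem octantLIntegral_projective {F : ℝ → ℝ → ℝ → ℝ → ENNReal}
    (hF : ∀ t a b c d, 0 < t → 0 < a → 0 < b → 0 < c → 0 < d →
      ENNReal.ofReal (t ^ 4) * F (t * a) (t * b) (t * c) (t * d) = F a b c d) :
    (octantLIntegral fun x y z => F x y z 1) = octantLIntegral fun x y z => F 1 y z x := by
  rw [octantLIntegral, octantLIntegral, lintegral_Ioi_zero_comp_inv]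
  refine setLIntegral_congr_fun measurableSet_Ioi fun x hx => ?_
  have hx : 0 < x := hx
  rw [lintegral_Ioi_zero_comp_mul_left _ (inv_pos.2 hx), ← mul_assoc,
    ← lintegral_const_mul' _ _ (by finiteness)]
  refine setLIntegral_congr_fun measurableSet_Ioi fun y hy => ?_
  rw [lintegral_Ioi_zero_comp_mul_left _ (inv_pos.2 hx), ← mul_assoc,
    ← lintegral_const_mul' _ _ (by finiteness)]
  refine setLIntegral_congr_fun measurableSet_Ioi fun z hz => ?_
  rw [← hF x⁻¹ 1 y z x (inv_pos.2 hx) one_pos hy hz hx, mul_one, inv_mul_cancel₀ hx.ne',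
    ← ENNReal.ofReal_mul (by positivity), ← ENNReal.ofReal_mul (by positivity)]
  congr 2
  field_simp

theorem densityOneThree_mul {t e a b c : ℝ} (ht : 0 < t) (he : 0 < e) (ha : 0 < a) (hb : 0 < b)
    (hc : 0 < c) : t ^ 4 * densityOneThree (t * e) (t * a) (t * b) (t * c) =
      densityOneThree e a b c := by
  simp only [densityOneThree, absOneThree, ← mul_add]
  field_simp

theorem octantLIntegral_rotate {f : ℝ × ℝ × ℝ → ENNReal} (hf : Measurable f) :
    octantLIntegral (fun x y z => f (y, z, x)) = octantLIntegral fun x y z => f (x, y, z) := by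
  rw [← octantLIntegral_swap_right hf]
  exact octantLIntegral_swap_left (f := fun q => f (q.1, q.2.2, q.2.1)) (hf.comp (by fun_prop))

theorem octantLIntegral_densityOneThree_swap :
    (octantLIntegral fun a b c => ENNReal.ofReal (densityOneThree a b c 1)) =
      octantLIntegral fun a b c => ENNReal.ofReal (densityOneThree 1 a b c) := by
  have hm : Measurable fun q : ℝ × ℝ × ℝ =>
      ENNReal.ofReal (densityOneThree 1 q.1 q.2.1 q.2.2) :=
    (measurable_densityOneThree.comp
      (by fun_prop : Measurable fun q : ℝ × ℝ × ℝ => ((1 : ℝ), q))).ennreal_ofReal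
  rw [octantLIntegral_projective (F := fun a b c d => ENNReal.ofReal (densityOneThree a b c d))]
  · exact octantLIntegral_rotate hm
  · intro t a b c d ht ha hb hc hd
    rw [← ENNReal.ofReal_mul (by positivity), densityOneThree_mul ht ha hb hc hd]

/-- The integral of `x ^ j / (1 + x) ^ (j + n + 2)` over the positive half-line. -/
theorem lintegral_pow_div_one_add_pow (j n : ℕ) :
    ∫⁻ x in Set.Ioi 0, ENNReal.ofReal (x ^ j / (1 + x) ^ (j + n + 2)) =
      ENNReal.ofReal (∫ x in (0 : ℝ)..1, x ^ n * (1 - x) ^ j) := by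
  rw [lintegral_Ioi_zero_comp_inv_sub_one, intervalIntegral.integral_of_le zero_le_one,
    integral_Ioc_eq_integral_Ioo, ofReal_integral_eq_lintegral_ofReal]
  · refine setLIntegral_congr_fun measurableSet_Ioo fun x hx => ?_
    have hx0 : 0 < x := hx.1
    rw [← ENNReal.ofReal_mul (by positivity)]
    congr 1
    have h1 : x⁻¹ - 1 = (1 - x) / x := by field_simp
    have h2 : 1 + (x⁻¹ - 1) = x⁻¹ := by ring
    rw [h2, h1, div_pow, inv_pow]
    field_simp
    ring
  · exact (Continuous.integrableOn_Icc (by fun_prop)).mono_set Set.Ioo_subset_Icc_self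
  · filter_upwards [ae_restrict_mem measurableSet_Ioo] with x hx
    have := hx.1
    have : 0 < 1 - x := by linarith [hx.2]
    positivity

theorem intervalIntegral_sum_mul_pow {n : ℕ} (c : Fin n → ℝ) :
    ∫ x in (0 : ℝ)..1, ∑ i, c i * x ^ (i : ℕ) = ∑ i, c i / ((i : ℕ) + 1) := by
  rw [intervalIntegral.integral_finsetSum
    fun i _ => (by fun_prop : Continuous fun x : ℝ => c i * x ^ (i : ℕ)).intervalIntegrable _ _]
  refine Finset.sum_congr rfl fun i _ => ?_
  rw [intervalIntegral.integral_const_mul, integral_pow]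
  simp [div_eq_mul_inv]

theorem octantLIntegral_ofReal_mul {f g h : ℝ → ℝ} (hf : ∀ x, 0 < x → 0 ≤ f x)
    (hg : ∀ x, 0 < x → 0 ≤ g x) {u v w : ℝ}
    (hu : ∫⁻ x in Set.Ioi 0, ENNReal.ofReal (f x) = ENNReal.ofReal u)
    (hv : ∫⁻ x in Set.Ioi 0, ENNReal.ofReal (g x) = ENNReal.ofReal v)
    (hw : ∫⁻ x in Set.Ioi 0, ENNReal.ofReal (h x) = ENNReal.ofReal w) (hu0 : 0 ≤ u) (hv0 : 0 ≤ v) :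
    (octantLIntegral fun x y z => ENNReal.ofReal (f x * g y * h z)) =
      ENNReal.ofReal (u * v * w) := by
  rw [octantLIntegral_congr (g := fun x y z => ENNReal.ofReal (h z) * ENNReal.ofReal (g y) *
    ENNReal.ofReal (f x))]
  · have e1 : ∀ x y, ∫⁻ z in Set.Ioi 0, ENNReal.ofReal (h z) * ENNReal.ofReal (g y) *
        ENNReal.ofReal (f x) = ENNReal.ofReal (g y) * ENNReal.ofReal w * ENNReal.ofReal (f x) := by
      intro x y
      rw [lintegral_mul_const' _ _ (by finiteness), lintegral_mul_const' _ _ (by finiteness), hw,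
        mul_comm (ENNReal.ofReal w)]
    have e2 : ∀ x, ∫⁻ y in Set.Ioi 0, ENNReal.ofReal (g y) * ENNReal.ofReal w *
        ENNReal.ofReal (f x) = ENNReal.ofReal (f x) * (ENNReal.ofReal v * ENNReal.ofReal w) := by
      intro x
      rw [lintegral_mul_const' _ _ (by finiteness), lintegral_mul_const' _ _ (by finiteness), hv,
        mul_comm]
    simp only [octantLIntegral, e1, e2]
    rw [lintegral_mul_const' _ _ (by finiteness), hu, ENNReal.ofReal_mul (by positivity),
      ENNReal.ofReal_mul hu0, mul_assoc]
  · intro x y z hx hy hz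
    have := hf x hx
    have := hg y hy
    rw [ENNReal.ofReal_mul (by positivity), ENNReal.ofReal_mul (by positivity)]
    ring

theorem octantLIntegral_add {f : ℝ → ℝ → ℝ → ENNReal}
    (hf : Measurable fun q : ℝ × ℝ × ℝ => f q.1 q.2.1 q.2.2) (g : ℝ → ℝ → ℝ → ENNReal) :
    (octantLIntegral fun x y z => f x y z + g x y z) = octantLIntegral f + octantLIntegral g := by
  have h1 : ∀ x y, Measurable fun z => f x y z := fun x y =>
    hf.comp (by fun_prop : Measurable fun z : ℝ => (x, y, z))
  have h2 : ∀ x, Measurable fun y => ∫⁻ z in Set.Ioi 0, f x y z := fun x =>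
    Measurable.lintegral_prod_right' (f := fun q : ℝ × ℝ => f x q.1 q.2)
      (hf.comp (by fun_prop : Measurable fun q : ℝ × ℝ => (x, q)))
  have h3 : Measurable fun x => ∫⁻ y in Set.Ioi 0, ∫⁻ z in Set.Ioi 0, f x y z :=
    Measurable.lintegral_prod_right' (f := fun q : ℝ × ℝ => ∫⁻ z in Set.Ioi 0, f q.1 q.2 z)
      (Measurable.lintegral_prod_right' (f := fun q : (ℝ × ℝ) × ℝ => f q.1.1 q.1.2 q.2)
        (hf.comp (by fun_prop : Measurable fun q : (ℝ × ℝ) × ℝ => (q.1.1, q.1.2, q.2))))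
  rw [octantLIntegral, octantLIntegral, octantLIntegral, ← lintegral_add_left h3]
  refine lintegral_congr fun x => ?_
  rw [← lintegral_add_left (h2 x)]
  exact lintegral_congr fun y => lintegral_add_left (h1 x y) _

theorem octantLIntegral_densityOneThree :
    (octantLIntegral fun a b c => ENNReal.ofReal (densityOneThree 1 a b c)) =
      ENNReal.ofReal (48 / 125) := by
  have key : ∀ (j n : ℕ) {m : ℕ} (c : Fin m → ℝ) (v : ℝ),
      (∀ x : ℝ, x ^ n * (1 - x) ^ j = ∑ i, c i * x ^ (i : ℕ)) → ∑ i, c i / ((i : ℕ) + 1) = v →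
      ∫⁻ x in Set.Ioi 0, ENNReal.ofReal (x ^ j / (1 + x) ^ (j + n + 2)) = ENNReal.ofReal v := by
    intro j n m c v h hv
    simp only [lintegral_pow_div_one_add_pow, h, intervalIntegral_sum_mul_pow, hv]
  have h46 := key 4 0 ![1, -4, 6, -4, 1] (1 / 5)
    (fun x => by simp [Fin.sum_univ_succ]; ring) (by simp [Fin.sum_univ_succ]; norm_num)
  have h26 := key 2 2 ![0, 0, 1, -2, 1] (1 / 30)
    (fun x => by simp [Fin.sum_univ_succ]; ring) (by simp [Fin.sum_univ_succ]; norm_num)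
  have h35 := key 3 0 ![1, -3, 3, -1] (1 / 4)
    (fun x => by simp [Fin.sum_univ_succ]; ring) (by simp [Fin.sum_univ_succ]; norm_num)
  have h36 := key 3 1 ![0, 1, -3, 3, -1] (1 / 20)
    (fun x => by simp [Fin.sum_univ_succ]; ring) (by simp [Fin.sum_univ_succ]; norm_num)
  have h25 := key 2 1 ![0, 1, -2, 1] (1 / 12)
    (fun x => by simp [Fin.sum_univ_succ]; ring) (by simp [Fin.sum_univ_succ]; norm_num)
  norm_num only at h46 h26 h35 h36 h25
  have hp : ∀ (j k : ℕ) (x : ℝ), 0 < x → 0 ≤ x ^ j / (1 + x) ^ k := fun j k x hx => by positivity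
  have hm : ∀ j₁ k₁ j₂ k₂ j₃ k₃ : ℕ, Measurable fun q : ℝ × ℝ × ℝ => ENNReal.ofReal
      (q.1 ^ j₁ / (1 + q.1) ^ k₁ * (q.2.1 ^ j₂ / (1 + q.2.1) ^ k₂) *
        (q.2.2 ^ j₃ / (1 + q.2.2) ^ k₃)) := by
    intros; fun_prop
  have hpt : ∀ a b c : ℝ, 0 < a → 0 < b → 0 < c →
      ENNReal.ofReal (densityOneThree 1 a b c) = ENNReal.ofReal 24 *
      (ENNReal.ofReal (a ^ 4 / (1 + a) ^ 6 * (b ^ 2 / (1 + b) ^ 6) * (c ^ 3 / (1 + c) ^ 5)) +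
      (ENNReal.ofReal (a ^ 4 / (1 + a) ^ 6 * (b ^ 3 / (1 + b) ^ 6) * (c ^ 2 / (1 + c) ^ 5)) +
      (ENNReal.ofReal (a ^ 4 / (1 + a) ^ 6 * (b ^ 4 / (1 + b) ^ 6) * (c ^ 2 / (1 + c) ^ 6)) +
      (ENNReal.ofReal (a ^ 4 / (1 + a) ^ 6 * (b ^ 4 / (1 + b) ^ 6) * (c ^ 4 / (1 + c) ^ 6)) +
      (ENNReal.ofReal (a ^ 2 / (1 + a) ^ 6 * (b ^ 3 / (1 + b) ^ 5) * (c ^ 3 / (1 + c) ^ 5)) +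
      (ENNReal.ofReal (a ^ 3 / (1 + a) ^ 6 * (b ^ 2 / (1 + b) ^ 5) * (c ^ 3 / (1 + c) ^ 5)) +
      ENNReal.ofReal (a ^ 3 / (1 + a) ^ 6 * (b ^ 3 / (1 + b) ^ 5) *
        (c ^ 2 / (1 + c) ^ 5)))))))) := by
    intro a b c ha hb hc
    repeat rw [← ENNReal.ofReal_add (by positivity) (by positivity)]
    rw [← ENNReal.ofReal_mul (by positivity), densityOneThree, absOneThree, add_comm b 1,
      add_comm c 1, add_comm a 1]
    congr 1
    field_simp
    ring
  rw [octantLIntegral_congr hpt, octantLIntegral_const_mul ENNReal.ofReal_ne_top,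
    octantLIntegral_add (hm 4 6 2 6 3 5), octantLIntegral_add (hm 4 6 3 6 2 5),
    octantLIntegral_add (hm 4 6 4 6 2 6), octantLIntegral_add (hm 4 6 4 6 4 6),
    octantLIntegral_add (hm 2 6 3 5 3 5), octantLIntegral_add (hm 3 6 2 5 3 5)]
  rw [octantLIntegral_ofReal_mul (hp 4 6) (hp 2 6) h46 h26 h35 (by norm_num) (by norm_num),
    octantLIntegral_ofReal_mul (hp 4 6) (hp 3 6) h46 h36 h25 (by norm_num) (by norm_num),
    octantLIntegral_ofReal_mul (hp 4 6) (hp 4 6) h46 h46 h26 (by norm_num) (by norm_num),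
    octantLIntegral_ofReal_mul (hp 4 6) (hp 4 6) h46 h46 h46 (by norm_num) (by norm_num),
    octantLIntegral_ofReal_mul (hp 2 6) (hp 3 5) h26 h35 h35 (by norm_num) (by norm_num),
    octantLIntegral_ofReal_mul (hp 3 6) (hp 2 5) h36 h25 h35 (by norm_num) (by norm_num),
    octantLIntegral_ofReal_mul (hp 3 6) (hp 3 5) h36 h35 h25 (by norm_num) (by norm_num)]
  repeat rw [← ENNReal.ofReal_add (by positivity) (by positivity)]
  rw [← ENNReal.ofReal_mul (by positivity)]
  norm_num

theorem absTwoTwo_eq {a b c d : ℝ} (ha : 0 < a) (hb : 0 < b) (hc : 0 < c) (hd : 0 < d) :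
    absTwoTwo a b c d =
      (c ^ 2 * d ^ 2 * ((a + b) * (a ^ 2 + b ^ 2) + (c + d) * (a ^ 2 + a * b + b ^ 2) +
        c * d * (a + b)) + a ^ 2 * b ^ 2 * ((c + d) * (c ^ 2 + d ^ 2) +
        (a + b) * (c ^ 2 + c * d + d ^ 2) + a * b * (c + d))) /
      ((a * b * c * d) ^ 2 * ((a + c) * (a + d) * (b + c) * (b + d))) := by
  rw [absTwoTwo, eq_div_iff (by positivity)]
  field_simp
  ring

theorem densityTwoTwo_swap_left {a b c d : ℝ} (ha : 0 < a) (hb : 0 < b) (hc : 0 < c) (hd : 0 < d) :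
    densityTwoTwo a b c d = densityTwoTwo b a c d := by
  have h : absTwoTwo a b c d = absTwoTwo b a c d := by
    rw [absTwoTwo_eq ha hb hc hd, absTwoTwo_eq hb ha hc hd]
    congr 1 <;> ring
  have h1 : b + a + c + d = a + b + c + d := by ring
  have h2 : (b + c) * (b + d) * (a + c) * (a + d) =
      (a + c) * (a + d) * (b + c) * (b + d) := by ring
  have h3 : b * a * c * d = a * b * c * d := by ring
  rw [densityTwoTwo, densityTwoTwo, h, h1, h2, h3]

theorem densityTwoTwo_swap_right {a b c d : ℝ} (ha : 0 < a) (hb : 0 < b) (hc : 0 < c)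
    (hd : 0 < d) : densityTwoTwo a b c d = densityTwoTwo a b d c := by
  have h : absTwoTwo a b c d = absTwoTwo a b d c := by
    rw [absTwoTwo_eq ha hb hc hd, absTwoTwo_eq ha hb hd hc]
    congr 1 <;> ring
  have h1 : a + b + d + c = a + b + c + d := by ring
  have h2 : (a + d) * (a + c) * (b + d) * (b + c) =
      (a + c) * (a + d) * (b + c) * (b + d) := by ring
  have h3 : a * b * d * c = a * b * c * d := by ring
  rw [densityTwoTwo, densityTwoTwo, h, h1, h2, h3]

theorem densityTwoTwo_mul {t a b c d : ℝ} (ht : 0 < t) (ha : 0 < a) (hb : 0 < b)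
    (hc : 0 < c) (hd : 0 < d) :
    t ^ 4 * densityTwoTwo (t * a) (t * b) (t * c) (t * d) = densityTwoTwo a b c d := by
  have h1 : absTwoTwo (t * a) (t * b) (t * c) (t * d) = (t ^ 5)⁻¹ * absTwoTwo a b c d := by
    simp only [absTwoTwo, ← mul_add]
    field_simp
  rw [densityTwoTwo, densityTwoTwo, h1]
  simp only [← mul_add]
  have h2 : (t * (a + b + c + d)) ^ 4 -
      4 * (t * (a + c) * (t * (a + d)) * (t * (b + c)) * (t * (b + d))) =
      t ^ 4 * ((a + b + c + d) ^ 4 - 4 * ((a + c) * (a + d) * (b + c) * (b + d))) := by ring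
  rw [h2]
  field_simp

theorem lintegral_quadrant_of_symm {f : ℝ → ℝ → ENNReal}
    (hf : Measurable (Function.uncurry f)) (hs : ∀ x y, 0 < x → 0 < y → f x y = f y x) :
    ∫⁻ x in Set.Ioi 0, ∫⁻ y in Set.Ioi 0, f x y =
      2 * ∫⁻ x in Set.Ioi 0, ∫⁻ m in Set.Ioi 0, f (x + m) x := by
  rw [lintegral_quadrant_split hf, two_mul]
  congr 1
  refine setLIntegral_congr_fun measurableSet_Ioi fun x hx =>
    setLIntegral_congr_fun measurableSet_Ioi fun m hm => ?_
  exact hs _ _ hx (add_pos hx hm)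

theorem octantLIntegral_densityTwoTwo_eq :
    (octantLIntegral fun a b c => ENNReal.ofReal (densityTwoTwo a b c 1)) =
      4 * ∫⁻ g in Set.Ioo 0 1, ∫⁻ x in Set.Ioi 0, ∫⁻ y in Set.Ioi 0,
        ENNReal.ofReal (densityTwoTwo (g + x) g (1 - g + y) (1 - g)) := by
  have hm : ∀ {h : ℝ × ℝ × ℝ → ℝ × ℝ × ℝ × ℝ}, Measurable h → Measurable fun q =>
      ENNReal.ofReal (densityTwoTwo (h q).1 (h q).2.1 (h q).2.2.1 (h q).2.2.2) := fun hh =>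
    (measurable_densityTwoTwo.comp hh).ennreal_ofReal
  have s1 : (octantLIntegral fun a b c => ENNReal.ofReal (densityTwoTwo a b c 1)) =
      2 * octantLIntegral fun b x c => ENNReal.ofReal (densityTwoTwo (b + x) b c 1) := by
    refine lintegral_quadrant_of_symm (f := fun a b => ∫⁻ c in Set.Ioi 0,
      ENNReal.ofReal (densityTwoTwo a b c 1)) ?_ ?_
    · exact Measurable.lintegral_prod_right' (f := fun q : (ℝ × ℝ) × ℝ =>
        ENNReal.ofReal (densityTwoTwo q.1.1 q.1.2 q.2 1)) (measurable_densityTwoTwo.comp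
          (by fun_prop : Measurable fun q : (ℝ × ℝ) × ℝ =>
            (q.1.1, q.1.2, q.2, (1 : ℝ)))).ennreal_ofReal
    · intro x y hx hy
      refine setLIntegral_congr_fun measurableSet_Ioi fun c hc => ?_
      simp only [densityTwoTwo_swap_left hx hy hc one_pos]
  have s2 : (octantLIntegral fun x c d => ENNReal.ofReal (densityTwoTwo (1 + x) 1 c d)) =
      2 * octantLIntegral fun x d y => ENNReal.ofReal (densityTwoTwo (1 + x) 1 (d + y) d) := by
    rw [octantLIntegral, octantLIntegral, ← lintegral_const_mul' _ _ (by finiteness)]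
    refine setLIntegral_congr_fun measurableSet_Ioi fun x hx => ?_
    refine lintegral_quadrant_of_symm (f := fun c d =>
      ENNReal.ofReal (densityTwoTwo (1 + x) 1 c d)) ?_ ?_
    · exact (measurable_densityTwoTwo.comp (by fun_prop : Measurable fun q : ℝ × ℝ =>
        (1 + x, (1 : ℝ), q.1, q.2))).ennreal_ofReal
    · intro c d hc hd
      simp only [densityTwoTwo_swap_right (add_pos one_pos hx) one_pos hc hd]
  rw [s1, octantLIntegral_projective (F := fun b x c d =>
      ENNReal.ofReal (densityTwoTwo (b + x) b c d)),
    octantLIntegral_rotate (f := fun q => ENNReal.ofReal (densityTwoTwo (1 + q.1) 1 q.2.1 q.2.2))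
      (hm (h := fun q => (1 + q.1, 1, q.2.1, q.2.2)) (by fun_prop)), s2,
    ← octantLIntegral_swap_left (f := fun q => ENNReal.ofReal
      (densityTwoTwo (1 + q.1) 1 (q.2.1 + q.2.2) q.2.1))
      (hm (h := fun q => (1 + q.1, 1, q.2.1 + q.2.2, q.2.1)) (by fun_prop)), ← mul_assoc]
  · congr 1
    · norm_num
    rw [octantLIntegral, lintegral_Ioi_zero_comp_inv_sub_one]
    refine setLIntegral_congr_fun measurableSet_Ioo fun g hg => ?_
    have hg0 : 0 < g := hg.1
    have hg1 : 0 < 1 - g := by linarith [hg.2]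
    rw [lintegral_Ioi_zero_comp_mul_left _ (inv_pos.2 hg0), ← mul_assoc,
      ← lintegral_const_mul' _ _ (by finiteness)]
    refine setLIntegral_congr_fun measurableSet_Ioi fun x hx => ?_
    have hx : 0 < x := hx
    rw [lintegral_Ioi_zero_comp_mul_left _ (inv_pos.2 hg0), ← mul_assoc,
      ← lintegral_const_mul' _ _ (by finiteness)]
    refine setLIntegral_congr_fun measurableSet_Ioi fun y hy => ?_
    have hy : 0 < y := hy
    rw [← densityTwoTwo_mul (inv_pos.2 hg0) (add_pos hg0 hx) hg0 (add_pos hg1 hy) hg1,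
      ← ENNReal.ofReal_mul (by positivity), ← ENNReal.ofReal_mul (by positivity),
      ← ENNReal.ofReal_mul (by positivity)]
    congr 2
    · field_simp
    · congr 1 <;> field_simp
  · intro t b x c d ht hb hx hc hd
    rw [← ENNReal.ofReal_mul (by positivity), ← mul_add,
      densityTwoTwo_mul ht (add_pos hb hx) hb hc hd]

theorem lintegral_Ioo_one_sub_pow (n : ℕ) :
    ∫⁻ x in Set.Ioo (0 : ℝ) 1, ENNReal.ofReal ((1 - x) ^ n) = ENNReal.ofReal (1 / (n + 1)) := by
  rw [← ofReal_integral_eq_lintegral_ofReal]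
  · rw [← integral_Ioc_eq_integral_Ioo, ← intervalIntegral.integral_of_le zero_le_one,
      intervalIntegral.integral_comp_sub_left (fun x : ℝ => x ^ n), integral_pow]
    simp
  · exact (Continuous.integrableOn_Icc (by fun_prop)).mono_set Set.Ioo_subset_Icc_self
  · filter_upwards [ae_restrict_mem measurableSet_Ioo] with x hx
    have : 0 < 1 - x := by linarith [hx.2]
    positivity

theorem lintegral_Ioo_inv_add_sub_mul :
    ∫⁻ x in Set.Ioo (0 : ℝ) 1, ∫⁻ y in Set.Ioo (0 : ℝ) 1, ENNReal.ofReal (x + y - x * y)⁻¹ =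
      ENNReal.ofReal (Real.pi ^ 2 / 6) := by
  have h : ∀ x ∈ Set.Ioo (0 : ℝ) 1, ∀ y ∈ Set.Ioo (0 : ℝ) 1, ENNReal.ofReal (x + y - x * y)⁻¹ =
      ∑' n : ℕ, ENNReal.ofReal ((1 - x) ^ n) * ENNReal.ofReal ((1 - y) ^ n) := by
    intro x hx y hy
    have hx1 : 0 < 1 - x := by linarith [hx.2]
    have hy1 : 0 < 1 - y := by linarith [hy.2]
    have hq : (1 - x) * (1 - y) < 1 := by nlinarith [hx.1, hy.1]
    have hs := hasSum_geometric_of_lt_one (by positivity) hq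
    rw [show x + y - x * y = 1 - (1 - x) * (1 - y) by ring, ← hs.tsum_eq,
      ENNReal.ofReal_tsum_of_nonneg (fun n => by positivity) hs.summable]
    simp only [mul_pow]
    exact tsum_congr fun n => ENNReal.ofReal_mul (by positivity)
  have hm : ∀ n : ℕ, Measurable fun x : ℝ => ENNReal.ofReal ((1 - x) ^ n) := fun n => by fun_prop
  have h1 : ∀ x ∈ Set.Ioo (0 : ℝ) 1,
      ∫⁻ y in Set.Ioo (0 : ℝ) 1, ENNReal.ofReal (x + y - x * y)⁻¹ =
      ∑' n : ℕ, ENNReal.ofReal ((1 - x) ^ n) * ENNReal.ofReal (1 / (n + 1)) := by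
    intro x hx
    rw [setLIntegral_congr_fun measurableSet_Ioo (h x hx), lintegral_tsum]
    · exact tsum_congr fun n => by
        rw [lintegral_const_mul _ (hm n), lintegral_Ioo_one_sub_pow]
    · exact fun n => ((hm n).const_mul _).aemeasurable
  rw [setLIntegral_congr_fun measurableSet_Ioo h1, lintegral_tsum]
  · have hz : HasSum (fun n : ℕ => 1 / ((n : ℝ) + 1) ^ 2) (Real.pi ^ 2 / 6) := by
      have := (hasSum_nat_add_iff' 1).2 hasSum_zeta_two
      simpa using this
    rw [← hz.tsum_eq, ENNReal.ofReal_tsum_of_nonneg (fun n => by positivity) hz.summable]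
    refine tsum_congr fun n => ?_
    rw [lintegral_mul_const _ (hm n), lintegral_Ioo_one_sub_pow,
      ← ENNReal.ofReal_mul (by positivity)]
    congr 1
    field_simp
  · exact fun n => ((hm n).mul_const _).aemeasurable

/-- Lebesgue measure on the open unit square. -/
noncomputable abbrev unitSquare : Measure (ℝ × ℝ) :=
  (volume.restrict (Set.Ioo 0 1)).prod (volume.restrict (Set.Ioo 0 1))

theorem ae_unitSquare : ∀ᵐ q ∂unitSquare, (0 < q.1 ∧ q.1 < 1) ∧ 0 < q.2 ∧ q.2 < 1 := by
  rw [unitSquare, Measure.prod_restrict]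
  filter_upwards [ae_restrict_mem (measurableSet_Ioo.prod measurableSet_Ioo)] with q hq
  exact hq

theorem add_sub_mul_pos {x y : ℝ} (hx : 0 ≤ x) (hx1 : x ≤ 1) (hy : 0 < y) :
    0 < x + y - x * y := by
  rcases hx1.eq_or_lt with rfl | h
  · simp
  · nlinarith [mul_pos (sub_pos.2 h) hy]

theorem lintegral_unitSquare_inv :
    ∫⁻ q, ENNReal.ofReal (q.1 + q.2 - q.1 * q.2)⁻¹ ∂unitSquare =
      ENNReal.ofReal (Real.pi ^ 2 / 6) := by
  rw [lintegral_prod _ (by fun_prop), lintegral_Ioo_inv_add_sub_mul]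

theorem inv_unitSquare_nonneg :
    0 ≤ᵐ[unitSquare] fun q => (q.1 + q.2 - q.1 * q.2)⁻¹ := by
  filter_upwards [ae_unitSquare] with q hq
  exact (inv_pos.2 (add_sub_mul_pos hq.1.1.le hq.1.2.le hq.2.1)).le

theorem integrable_unitSquare_inv :
    Integrable (fun q : ℝ × ℝ => (q.1 + q.2 - q.1 * q.2)⁻¹) unitSquare := by
  refine ⟨by fun_prop, ?_⟩
  rw [hasFiniteIntegral_iff_ofReal inv_unitSquare_nonneg, lintegral_unitSquare_inv]
  exact ENNReal.ofReal_lt_top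

theorem integral_unitSquare_inv :
    ∫ q, (q.1 + q.2 - q.1 * q.2)⁻¹ ∂unitSquare = Real.pi ^ 2 / 6 := by
  rw [integral_eq_lintegral_of_nonneg_ae inv_unitSquare_nonneg (by fun_prop),
    lintegral_unitSquare_inv, ENNReal.toReal_ofReal (by positivity)]

/-- The derivative in `x` of `-x * (1 - x) * x ^ i * y ^ j / (x + y - x * y) ^ 5`. -/
noncomputable def exactTerm (i j : ℕ) (q : ℝ × ℝ) : ℝ :=
  (5 * q.1 ^ (i + 1) * (1 - q.1) * (1 - q.2) -
    ((i + 1) * q.1 ^ i - (i + 2) * q.1 ^ (i + 1)) * (q.1 + q.2 - q.1 * q.2)) * q.2 ^ j /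
    (q.1 + q.2 - q.1 * q.2) ^ 6

theorem measurable_exactTerm (i j : ℕ) : Measurable (exactTerm i j) := by
  unfold exactTerm
  fun_prop

theorem integrable_exactTerm {i j : ℕ} (h : 4 ≤ i + j) :
    Integrable (exactTerm i j) unitSquare := by
  refine (integrable_unitSquare_inv.const_mul (2 * i + 8)).mono' 
    (measurable_exactTerm i j).aestronglyMeasurable ?_
  filter_upwards [ae_unitSquare] with q hq
  obtain ⟨x, y⟩ := q
  obtain ⟨⟨hx0, hx1⟩, hy0, hy1⟩ := hq
  dsimp only at hx0 hx1 hy0 hy1 ⊢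
  have hD := add_sub_mul_pos hx0.le hx1.le hy0
  have hxD : x ≤ x + y - x * y := by nlinarith
  have hyD : y ≤ x + y - x * y := by nlinarith
  have hD1 : x + y - x * y ≤ 1 := by nlinarith [mul_pos (sub_pos.2 hx1) (sub_pos.2 hy1)]
  rw [exactTerm]
  set D := x + y - x * y with hDdef
  have hpow : ∀ k l, 5 ≤ k + l → x ^ k * y ^ l ≤ D ^ 5 := fun k l hkl =>
    calc x ^ k * y ^ l ≤ D ^ k * D ^ l := by gcongr
      _ = D ^ (k + l) := (pow_add _ _ _).symm
      _ ≤ D ^ 5 := pow_le_pow_of_le_one hD.le hD1 hkl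
  have h1 := hpow (i + 1) j (by omega)
  have h2 : x ^ i * y ^ j * D ≤ D ^ 5 :=
    calc x ^ i * y ^ j * D ≤ D ^ i * D ^ j * D := by gcongr
      _ = D ^ (i + j + 1) := by rw [pow_succ, pow_add]
      _ ≤ D ^ 5 := pow_le_pow_of_le_one hD.le hD1 (by omega)
  have h3 : x ^ (i + 1) * y ^ j * D ≤ D ^ 5 :=
    (mul_le_of_le_one_right (by positivity) hD1).trans h1
  have h4 : x ^ (i + 1) * y ^ j * ((1 - x) * (1 - y)) ≤ D ^ 5 :=
    (mul_le_of_le_one_right (by positivity) (by nlinarith)).trans h1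
  have p2 : 0 ≤ x ^ i * y ^ j * D := by positivity
  have p3 : 0 ≤ x ^ (i + 1) * y ^ j * D := by positivity
  have p4 : 0 ≤ x ^ (i + 1) * y ^ j * ((1 - x) * (1 - y)) :=
    mul_nonneg (by positivity) (mul_nonneg (by linarith) (by linarith))
  have e : (2 * (i : ℝ) + 8) * D⁻¹ = (2 * i + 8) * D ^ 5 / D ^ 6 := by field_simp
  rw [e, Real.norm_eq_abs, abs_div, abs_of_pos (pow_pos hD 6)]
  gcongr
  have hi : (0 : ℝ) ≤ i := i.cast_nonneg
  have h2' := mul_le_mul_of_nonneg_left h2 (by positivity : (0 : ℝ) ≤ i + 1)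
  have h3' := mul_le_mul_of_nonneg_left h3 (by positivity : (0 : ℝ) ≤ i + 2)
  have p2' := mul_nonneg (by positivity : (0 : ℝ) ≤ i + 1) p2
  have p3' := mul_nonneg (by positivity : (0 : ℝ) ≤ i + 2) p3
  have hz : (5 * x ^ (i + 1) * (1 - x) * (1 - y) -
      ((i + 1) * x ^ i - (i + 2) * x ^ (i + 1)) * D) * y ^ j =
      5 * (x ^ (i + 1) * y ^ j * ((1 - x) * (1 - y))) - (i + 1) * (x ^ i * y ^ j * D) +
      (i + 2) * (x ^ (i + 1) * y ^ j * D) := by ring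
  rw [hz, abs_le]
  constructor <;> linarith

theorem integral_exactTerm {i j : ℕ} (h : 4 ≤ i + j) :
    ∫ q, exactTerm i j q ∂unitSquare = 0 := by
  rw [integral_prod_symm _ (integrable_exactTerm h)]
  refine (setIntegral_congr_fun measurableSet_Ioo fun y hy => ?_).trans (integral_zero _ _)
  rw [← integral_Ioc_eq_integral_Ioo, ← intervalIntegral.integral_of_le zero_le_one]
  have hD : ∀ x ∈ Set.uIcc (0 : ℝ) 1, 0 < x + y - x * y := fun x hx => by
    rw [Set.uIcc_of_le zero_le_one] at hx
    exact add_sub_mul_pos hx.1 hx.2 hy.1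
  rw [intervalIntegral.integral_eq_sub_of_hasDerivAt
    (f := fun x => -(x ^ (i + 1) * (1 - x) * y ^ j / (x + y - x * y) ^ 5))]
  · simp
  · intro x hx
    have hx := hD x hx
    have d1 : HasDerivAt (fun x : ℝ => x ^ (i + 1) * (1 - x) * y ^ j)
        ((((i + 1 : ℕ) : ℝ) * x ^ i * (1 - x) + x ^ (i + 1) * (-1)) * y ^ j) x :=
      ((hasDerivAt_pow (i + 1) x).mul ((hasDerivAt_id x).const_sub 1)).mul_const _
    have d2 : HasDerivAt (fun x : ℝ => (x + y - x * y) ^ 5)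
        (((5 : ℕ) : ℝ) * (x + y - x * y) ^ 4 * (1 - 1 * y)) x :=
      (((hasDerivAt_id x).add_const y).sub ((hasDerivAt_id x).mul_const y)).pow 5
    refine (d1.div d2 (pow_pos hx 5).ne').neg.congr_deriv ?_
    rw [exactTerm, ← neg_div, div_eq_div_iff (by positivity) (by positivity)]
    push_cast
    ring
  · refine ContinuousOn.intervalIntegrable ?_
    unfold exactTerm
    refine ContinuousOn.div (by fun_prop) (by fun_prop) fun x hx => (pow_pos (hD x hx) 6).ne'

/-- The numerator of `exactTerm`, symmetrized. -/
noncomputable def exactNumerator (i j : ℕ) (x y : ℝ) : ℝ :=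
  (5 * x ^ (i + 1) * (1 - x) * (1 - y) -
    ((i + 1) * x ^ i - (i + 2) * x ^ (i + 1)) * (x + y - x * y)) * y ^ j +
  (5 * y ^ (i + 1) * (1 - y) * (1 - x) -
    ((i + 1) * y ^ i - (i + 2) * y ^ (i + 1)) * (x + y - x * y)) * x ^ j

theorem exactTerm_add_exactTerm_swap (i j : ℕ) (q : ℝ × ℝ) :
    exactTerm i j q + exactTerm i j q.swap =
      exactNumerator i j q.1 q.2 / (q.1 + q.2 - q.1 * q.2) ^ 6 := by
  have h : q.2 + q.1 - q.2 * q.1 = q.1 + q.2 - q.1 * q.2 := by ring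
  rw [exactTerm, exactTerm, exactNumerator, Prod.fst_swap, Prod.snd_swap, h, add_div]

theorem integral_sum_exactNumerator (L : List (ℝ × ℕ × ℕ)) (hL : ∀ t ∈ L, 4 ≤ t.2.1 + t.2.2) :
    Integrable (fun q : ℝ × ℝ => (L.map fun t => t.1 * exactNumerator t.2.1 t.2.2 q.1 q.2).sum /
      (q.1 + q.2 - q.1 * q.2) ^ 6) unitSquare ∧
    ∫ q, (L.map fun t => t.1 * exactNumerator t.2.1 t.2.2 q.1 q.2).sum /
      (q.1 + q.2 - q.1 * q.2) ^ 6 ∂unitSquare = 0 := by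
  induction L with
  | nil => simp
  | cons t L ih =>
    obtain ⟨hi, h0⟩ := ih fun s hs => hL s (List.mem_cons_of_mem _ hs)
    have ht := hL t List.mem_cons_self
    have i1 := integrable_exactTerm ht
    have i2 := i1.swap
    have z2 : ∫ q, exactTerm t.2.1 t.2.2 (Prod.swap q) ∂unitSquare = 0 := by
      rw [unitSquare, integral_prod_swap (exactTerm t.2.1 t.2.2), integral_exactTerm ht]
    have i3 := (i1.add i2).const_mul t.1
    have e : (fun q : ℝ × ℝ => ((t :: L).map fun t =>
        t.1 * exactNumerator t.2.1 t.2.2 q.1 q.2).sum / (q.1 + q.2 - q.1 * q.2) ^ 6) = fun q =>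
        t.1 * (exactTerm t.2.1 t.2.2 + exactTerm t.2.1 t.2.2 ∘ Prod.swap) q +
        (L.map fun t => t.1 * exactNumerator t.2.1 t.2.2 q.1 q.2).sum /
          (q.1 + q.2 - q.1 * q.2) ^ 6 := by
      funext q
      rw [Pi.add_apply, Function.comp_apply, exactTerm_add_exactTerm_swap, List.map_cons,
        List.sum_cons, add_div, mul_div_assoc]
    rw [e]
    refine ⟨i3.add hi, ?_⟩
    rw [integral_add i3 hi, h0, integral_const_mul, integral_add' i1 i2, integral_exactTerm ht]
    simp [z2]

/-- `x ^ 5 * y ^ 5` times the value of `gapPolynomial` at `x⁻¹ - 1` and `y⁻¹ - 1`. -/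
noncomputable def squarePolynomial (x y : ℝ) : ℝ :=
  ((858 * x - 1287 * x ^ 2 + 858 * x ^ 3 - 286 * x ^ 4 + 39 * x ^ 5) +
    (858 - 3432 * x + 3718 * x ^ 2 - 2002 * x ^ 3 + 559 * x ^ 4 - 65 * x ^ 5) * y +
    (-1287 + 3718 * x - 3432 * x ^ 2 + 1638 * x ^ 3 - 416 * x ^ 4 + 45 * x ^ 5) * y ^ 2 +
    (858 - 2002 * x + 1638 * x ^ 2 - 702 * x ^ 3 + 159 * x ^ 4 - 15 * x ^ 5) * y ^ 3 +
    (-286 + 559 * x - 416 * x ^ 2 + 159 * x ^ 3 - 30 * x ^ 4 + 2 * x ^ 5) * y ^ 4 +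
    (39 - 65 * x + 45 * x ^ 2 - 15 * x ^ 3 + 2 * x ^ 4) * y ^ 5) / 90090

/-- Coefficients and exponents that write an integrand as exact terms. -/
noncomputable def squareCertificate : List (ℝ × ℕ × ℕ) :=
  [(-8/45045, 0, 4), (-93287/40540500, 0, 5), (-6887/263250, 0, 6), (-6731/450450, 0, 7),
    (643/225225, 0, 8), (-7/21450, 0, 9), (4/125125, 0, 10), (1360583/5791500, 1, 3),
    (-88247/8108100, 1, 4), (-1683421/20270250, 1, 5), (-118819/3378375, 1, 6),
    (37883/900900, 1, 7), (-223/30030, 1, 8), (131/180180, 1, 9), (-6/125125, 1, 10),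
    (-2103883/2702700, 2, 2), (5359121/8108100, 2, 3), (-10583/1621620, 2, 4),
    (-1194458/10135125, 2, 5), (4210027/40540500, 2, 6), (-149/3150, 2, 7), (6511/900900, 2, 8),
    (-43/75075, 2, 9), (4/125125, 2, 10), (357491/965250, 3, 1), (-628214/3378375, 3, 2),
    (-547123/2702700, 3, 4), (10827361/81081000, 3, 5), (-3741883/40540500, 3, 6),
    (4409/180180, 3, 7), (-107/36036, 3, 8), (1/6300, 3, 9), (-1/125125, 3, 10),
    (-204917/10135125, 4, 0), (272869/2316600, 4, 4), (-8088583/81081000, 4, 5),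
    (9827/270270, 4, 6), (-191/45045, 4, 7), (2/5005, 4, 8), (-223816/10135125, 5, 0),
    (1258/45045, 5, 4), (-502/135135, 5, 6), (11/12285, 5, 7), (-2/45045, 5, 8),
    (-359/193050, 6, 0), (47/30030, 6, 4), (-4/135135, 6, 7), (-4/75075, 7, 0), (-1/30030, 7, 4),
    (2/75075, 8, 0), (2/375375, 9, 0)]

theorem squarePolynomial_eq (x y : ℝ) :
    squarePolynomial x y * ((x + y) * ((x + y) ^ 4 - 4 * (x ^ 2 * y ^ 2 * (x + y - x * y)))) =
      -8 / 45045 * (x + y - x * y) ^ 5 + 217 / 40500 * (x + y - x * y) ^ 6 +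
      (List.map (fun t : ℝ × ℕ × ℕ => t.1 * exactNumerator t.2.1 t.2.2 x y) squareCertificate).sum := by
  simp only [squareCertificate, List.map_cons, List.map_nil, List.sum_cons, List.sum_nil, exactNumerator,
    squarePolynomial]
  push_cast
  ring

theorem four_le_of_mem_squareCertificate : ∀ t ∈ squareCertificate, 4 ≤ t.2.1 + t.2.2 := by
  simp [squareCertificate]

/-- The numerator of `absTwoTwo` splits into two terms of this shape. -/
noncomputable def gapNumerator (a b c d : ℝ) : ℝ :=
  a ^ 2 * b ^ 2 * (c ^ 4 * d ^ 4) * ((a + b) * (a ^ 2 + b ^ 2) +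
    (c + d) * (a ^ 2 + a * b + b ^ 2) + c * d * (a + b))

/-- The integral of `gapNumerator (g + x) g (1 - g + y) (1 - g)` over `0 < g < 1`. -/
noncomputable def gapPolynomial (x y : ℝ) : ℝ :=
  1 / 6435 + 8 / 6435 * y + 8 / 6435 * x + 37 / 9009 * y ^ 2 + 4 / 429 * x * y + 37 / 9009 * x
    ^ 2 + 1 / 143 * y ^ 3 + 37 / 1287 * x * y ^ 2 + 37 / 1287 * x ^ 2 * y + 1 / 143 * x ^ 3 + 1
    / 165 * y ^ 4 + 1 / 22 * x * y ^ 3 + 19 / 231 * x ^ 2 * y ^ 2 + 1 / 22 * x ^ 3 * y + 1 / 165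
    * x ^ 4 + 1 / 495 * y ^ 5 + 2 / 55 * x * y ^ 4 + 83 / 693 * x ^ 2 * y ^ 3 + 83 / 693 * x ^ 3
    * y ^ 2 + 2 / 55 * x ^ 4 * y + 1 / 495 * x ^ 5 + 1 / 90 * x * y ^ 5 + 11 / 126 * x ^ 2 * y ^
    4 + 10 / 63 * x ^ 3 * y ^ 3 + 11 / 126 * x ^ 4 * y ^ 2 + 1 / 90 * x ^ 5 * y + 1 / 42 * x ^ 2
    * y ^ 5 + 13 / 126 * x ^ 3 * y ^ 4 + 13 / 126 * x ^ 4 * y ^ 3 + 1 / 42 * x ^ 5 * y ^ 2 + 1 /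
    42 * x ^ 3 * y ^ 5 + 2 / 35 * x ^ 4 * y ^ 4 + 1 / 42 * x ^ 5 * y ^ 3 + 1 / 105 * x ^ 4 * y ^
    5 + 1 / 105 * x ^ 5 * y ^ 4

theorem intervalIntegral_pow_mul_one_sub_pow (i j : ℕ) :
    ∫ x in (0 : ℝ)..1, x ^ i * (1 - x) ^ j = i.factorial * j.factorial / (i + j + 1).factorial := by
  induction j generalizing i with
  | zero =>
    simp only [pow_zero, mul_one, integral_pow, Nat.factorial_zero, Nat.cast_one, add_zero,
      Nat.factorial_succ i, one_pow, zero_pow i.succ_ne_zero, sub_zero]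
    have : (i.factorial : ℝ) ≠ 0 := by positivity
    push_cast
    field_simp
  | succ j ih =>
    have hd : ∀ x ∈ Set.uIcc (0 : ℝ) 1, HasDerivAt (fun x : ℝ => x ^ (i + 1) * (1 - x) ^ (j + 1))
        ((i + 1) * (x ^ i * (1 - x) ^ (j + 1)) - (j + 1) * (x ^ (i + 1) * (1 - x) ^ j)) x := by
      intro x _
      refine (((hasDerivAt_id x).pow (i + 1)).mul
        (((hasDerivAt_id x).const_sub 1).pow (j + 1))).congr_deriv ?_
      simp
      ring
    have h := intervalIntegral.integral_eq_sub_of_hasDerivAt hd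
      (Continuous.intervalIntegrable (by fun_prop) 0 1)
    rw [intervalIntegral.integral_sub (Continuous.intervalIntegrable (by fun_prop) 0 1)
      (Continuous.intervalIntegrable (by fun_prop) 0 1), intervalIntegral.integral_const_mul,
      intervalIntegral.integral_const_mul, ih] at h
    have e : i + 1 + j + 1 = i + (j + 1) + 1 := by ring
    rw [e] at h
    have hi : (i + 1 : ℝ) ≠ 0 := by positivity
    refine mul_left_cancel₀ hi ?_
    rw [Nat.factorial_succ j]
    rw [Nat.factorial_succ i] at h
    push_cast at h ⊢
    simp at h
    linear_combination h

theorem intervalIntegral_sum_pow_mul_one_sub_pow (L : List (ℝ × ℕ × ℕ)) :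
    ∫ x in (0 : ℝ)..1, (L.map fun t => t.1 * (x ^ t.2.1 * (1 - x) ^ t.2.2)).sum =
      (L.map fun t => t.1 * ((t.2.1.factorial : ℝ) * t.2.2.factorial /
        (t.2.1 + t.2.2 + 1).factorial)).sum := by
  have hc : ∀ L : List (ℝ × ℕ × ℕ), Continuous fun x : ℝ =>
      (L.map fun t => t.1 * (x ^ t.2.1 * (1 - x) ^ t.2.2)).sum := fun L => by
    induction L with
    | nil => simpa using continuous_const
    | cons t L ih =>
      simp only [List.map_cons, List.sum_cons]
      fun_prop
  induction L with
  | nil => simp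
  | cons t L ih =>
    simp only [List.map_cons, List.sum_cons]
    rw [intervalIntegral.integral_add ((by fun_prop : Continuous fun x : ℝ =>
      t.1 * (x ^ t.2.1 * (1 - x) ^ t.2.2)).intervalIntegrable 0 1)
      ((hc L).intervalIntegrable 0 1), ih, intervalIntegral.integral_const_mul,
      intervalIntegral_pow_mul_one_sub_pow]

/-- Coefficients and exponents of `gapNumerator (g + x) g (h + y) h` as a polynomial in `g`, `h`. -/
noncomputable def gapCoefficients (x y : ℝ) : List (ℝ × ℕ × ℕ) :=
  [(2, 5, 10), (6, 6, 9), (4, 7, 8), (10 * y, 5, 9), (27 * y, 6, 8), (16 * y, 7, 7), (5 * x,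
    4, 10), (18 * x, 5, 9), (14 * x, 6, 8), (20 * y ^ 2, 5, 8), (48 * y ^ 2, 6, 7), (24 * y ^ 2,
    7, 6), (25 * x * y, 4, 9), (81 * x * y, 5, 8), (56 * x * y, 6, 7), (4 * x ^ 2, 3, 10), (20 *
    x ^ 2, 4, 9), (20 * x ^ 2, 5, 8), (20 * y ^ 3, 5, 7), (42 * y ^ 3, 6, 6), (16 * y ^ 3, 7,
    5), (50 * x * y ^ 2, 4, 8), (144 * x * y ^ 2, 5, 7), (84 * x * y ^ 2, 6, 6), (20 * x ^ 2 *
    y, 3, 9), (90 * x ^ 2 * y, 4, 8), (80 * x ^ 2 * y, 5, 7), (x ^ 3, 2, 10), (10 * x ^ 3, 3,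
    9), (15 * x ^ 3, 4, 8), (10 * y ^ 4, 5, 6), (18 * y ^ 4, 6, 5), (4 * y ^ 4, 7, 4), (50 * x *
    y ^ 3, 4, 7), (126 * x * y ^ 3, 5, 6), (56 * x * y ^ 3, 6, 5), (40 * x ^ 2 * y ^ 2, 3, 8),
    (160 * x ^ 2 * y ^ 2, 4, 7), (120 * x ^ 2 * y ^ 2, 5, 6), (5 * x ^ 3 * y, 2, 9), (45 * x ^ 3
    * y, 3, 8), (60 * x ^ 3 * y, 4, 7), (2 * x ^ 4, 2, 9), (6 * x ^ 4, 3, 8), (2 * y ^ 5, 5, 5),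
    (3 * y ^ 5, 6, 4), (25 * x * y ^ 4, 4, 6), (54 * x * y ^ 4, 5, 5), (14 * x * y ^ 4, 6, 4),
    (40 * x ^ 2 * y ^ 3, 3, 7), (140 * x ^ 2 * y ^ 3, 4, 6), (80 * x ^ 2 * y ^ 3, 5, 5), (10 * x
    ^ 3 * y ^ 2, 2, 8), (80 * x ^ 3 * y ^ 2, 3, 7), (90 * x ^ 3 * y ^ 2, 4, 6), (9 * x ^ 4 * y,
    2, 8), (24 * x ^ 4 * y, 3, 7), (x ^ 5, 2, 8), (5 * x * y ^ 5, 4, 5), (9 * x * y ^ 5, 5, 4),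
    (20 * x ^ 2 * y ^ 4, 3, 6), (60 * x ^ 2 * y ^ 4, 4, 5), (20 * x ^ 2 * y ^ 4, 5, 4), (10 * x
    ^ 3 * y ^ 3, 2, 7), (70 * x ^ 3 * y ^ 3, 3, 6), (60 * x ^ 3 * y ^ 3, 4, 5), (16 * x ^ 4 * y
    ^ 2, 2, 7), (36 * x ^ 4 * y ^ 2, 3, 6), (4 * x ^ 5 * y, 2, 7), (4 * x ^ 2 * y ^ 5, 3, 5),
    (10 * x ^ 2 * y ^ 5, 4, 4), (5 * x ^ 3 * y ^ 4, 2, 6), (30 * x ^ 3 * y ^ 4, 3, 5), (15 * x ^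
    3 * y ^ 4, 4, 4), (14 * x ^ 4 * y ^ 3, 2, 6), (24 * x ^ 4 * y ^ 3, 3, 5), (6 * x ^ 5 * y ^
    2, 2, 6), (x ^ 3 * y ^ 5, 2, 5), (5 * x ^ 3 * y ^ 5, 3, 4), (6 * x ^ 4 * y ^ 4, 2, 5), (6 *
    x ^ 4 * y ^ 4, 3, 4), (4 * x ^ 5 * y ^ 3, 2, 5), (x ^ 4 * y ^ 5, 2, 4), (x ^ 5 * y ^ 4, 2,
    4)]

theorem gapNumerator_eq_sum (x y g : ℝ) :
    gapNumerator (g + x) g (1 - g + y) (1 - g) =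
      ((gapCoefficients x y).map fun t => t.1 * (g ^ t.2.1 * (1 - g) ^ t.2.2)).sum := by
  generalize 1 - g = h
  simp only [gapNumerator, gapCoefficients, List.map_cons, List.map_nil, List.sum_cons,
    List.sum_nil]
  ring

theorem intervalIntegral_gapNumerator (x y : ℝ) :
    ∫ g in (0 : ℝ)..1, gapNumerator (g + x) g (1 - g + y) (1 - g) = gapPolynomial x y := by
  simp only [gapNumerator_eq_sum, intervalIntegral_sum_pow_mul_one_sub_pow]
  simp only [gapPolynomial, gapCoefficients, List.map_cons, List.map_nil, List.sum_cons,
    List.sum_nil]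
  norm_num only
  ring

theorem gapNumerator_nonneg {a b c d : ℝ} (ha : 0 ≤ a) (hb : 0 ≤ b) (hc : 0 ≤ c) (hd : 0 ≤ d) :
    0 ≤ gapNumerator a b c d := by
  rw [gapNumerator]; positivity

theorem gapPolynomial_comm (x y : ℝ) : gapPolynomial x y = gapPolynomial y x := by
  rw [gapPolynomial, gapPolynomial]; ring

theorem gapPolynomial_nonneg {x y : ℝ} (hx : 0 ≤ x) (hy : 0 ≤ y) : 0 ≤ gapPolynomial x y := by
  rw [gapPolynomial]; positivity

theorem four_mul_prod_le_sum_pow_four {p q r s : ℝ} (hp : 0 ≤ p) (hq : 0 ≤ q) (hr : 0 ≤ r)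
    (hs : 0 ≤ s) (h : p + q = r + s) : 4 * ((p * q) * (r * s)) ≤ (p + q) ^ 4 := by
  have h1 : p * q ≤ (p + q) ^ 2 := by nlinarith [mul_nonneg hp hq]
  have h2 : 4 * (r * s) ≤ (p + q) ^ 2 := by rw [h]; nlinarith [sq_nonneg (r - s)]
  calc 4 * ((p * q) * (r * s)) = (p * q) * (4 * (r * s)) := by ring
    _ ≤ (p + q) ^ 2 * (p + q) ^ 2 := by gcongr
    _ = (p + q) ^ 4 := by ring

theorem densityTwoTwo_eq_gapNumerator {a b c d : ℝ} (ha : 0 < a) (hb : 0 < b) (hc : 0 < c)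
    (hd : 0 < d) :
    densityTwoTwo a b c d = 24 * (gapNumerator a b c d + gapNumerator c d a b) *
      ((a + b + c + d) * ((a + b + c + d) ^ 4 - 4 * ((a + c) * (a + d) * (b + c) * (b + d))) /
        ((a + c) * (a + d) * (b + c) * (b + d)) ^ 6) := by
  have hP : 0 < (a + c) * (a + d) * (b + c) * (b + d) := by positivity
  rw [densityTwoTwo, absTwoTwo_eq ha hb hc hd, gapNumerator, gapNumerator]
  generalize (a + c) * (a + d) * (b + c) * (b + d) = P at hP ⊢
  generalize (a + b + c + d) * ((a + b + c + d) ^ 4 - 4 * P) = S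
  field_simp

/-- The part of `densityTwoTwo (g + x) g (1 - g + y) (1 - g)` that does not depend on `g`. -/
noncomputable def gapKernel (x y : ℝ) : ℝ :=
  (2 + x + y) * ((2 + x + y) ^ 4 - 4 * ((1 + x + y) * (1 + x) * (1 + y))) /
    ((1 + x + y) * (1 + x) * (1 + y)) ^ 6

theorem gapKernel_nonneg {x y : ℝ} (hx : 0 ≤ x) (hy : 0 ≤ y) : 0 ≤ gapKernel x y := by
  have h := four_mul_prod_le_sum_pow_four (p := 1 + x + y) (q := 1) (r := 1 + x) (s := 1 + y)
    (by positivity) (by positivity) (by positivity) (by positivity) (by ring)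
  have h' : 0 ≤ (2 + x + y) ^ 4 - 4 * ((1 + x + y) * (1 + x) * (1 + y)) := by
    rw [show 2 + x + y = 1 + x + y + 1 by ring]
    linarith
  rw [gapKernel]
  positivity

theorem lintegral_densityTwoTwo_gap {x y : ℝ} (hx : 0 < x) (hy : 0 < y) :
    ∫⁻ g in Set.Ioo 0 1, ENNReal.ofReal (densityTwoTwo (g + x) g (1 - g + y) (1 - g)) =
      ENNReal.ofReal (48 * gapPolynomial x y * gapKernel x y) := by
  have hc : ∀ u v : ℝ, Continuous fun g => gapNumerator (g + u) g (1 - g + v) (1 - g) :=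
    fun u v => by unfold gapNumerator; fun_prop
  have hc' : ∀ u v : ℝ, Continuous fun g => gapNumerator (1 - g + v) (1 - g) (g + u) g :=
    fun u v => by unfold gapNumerator; fun_prop
  have hs : ∫ g in (0 : ℝ)..1, gapNumerator (1 - g + y) (1 - g) (g + x) g = gapPolynomial y x := by
    have h := intervalIntegral.integral_comp_sub_left (a := 0) (b := 1)
      (fun g => gapNumerator (g + y) g (1 - g + x) (1 - g)) 1
    simpa only [sub_sub_cancel, sub_self, sub_zero, intervalIntegral_gapNumerator] using h
  have hcn : Continuous fun g => 24 * (gapNumerator (g + x) g (1 - g + y) (1 - g) +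
      gapNumerator (1 - g + y) (1 - g) (g + x) g) * gapKernel x y :=
    (((hc x y).add (hc' x y)).const_mul 24).mul_const _
  have e : ∀ g ∈ Set.Ioo (0 : ℝ) 1,
      ENNReal.ofReal (densityTwoTwo (g + x) g (1 - g + y) (1 - g)) =
      ENNReal.ofReal (24 * (gapNumerator (g + x) g (1 - g + y) (1 - g) +
        gapNumerator (1 - g + y) (1 - g) (g + x) g) * gapKernel x y) := by
    intro g hg
    have h1 : 0 < 1 - g := by linarith [hg.2]
    have h2 := hg.1
    rw [densityTwoTwo_eq_gapNumerator (by linarith) h2 (by linarith) h1, gapKernel,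
      show g + x + g + (1 - g + y) + (1 - g) = 2 + x + y by ring,
      show (g + x + (1 - g + y)) * (g + x + (1 - g)) * (g + (1 - g + y)) * (g + (1 - g)) =
        (1 + x + y) * (1 + x) * (1 + y) by ring]
  rw [setLIntegral_congr_fun measurableSet_Ioo e, ← ofReal_integral_eq_lintegral_ofReal]
  · rw [← integral_Ioc_eq_integral_Ioo, ← intervalIntegral.integral_of_le zero_le_one,
      intervalIntegral.integral_mul_const, intervalIntegral.integral_const_mul,
      intervalIntegral.integral_add ((hc x y).intervalIntegrable 0 1)
        ((hc' x y).intervalIntegrable 0 1), intervalIntegral_gapNumerator, hs,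
      gapPolynomial_comm y x]
    ring_nf
  · exact hcn.integrableOn_Icc.mono_set Set.Ioo_subset_Icc_self
  · filter_upwards [ae_restrict_mem measurableSet_Ioo] with g hg
    have h1 : 0 < 1 - g := by linarith [hg.2]
    have h2 := hg.1
    have := gapNumerator_nonneg (a := g + x) (b := g) (c := 1 - g + y) (d := 1 - g)
      (by linarith) h2.le (by linarith) h1.le
    have := gapNumerator_nonneg (a := 1 - g + y) (b := 1 - g) (c := g + x) (d := g)
      (by linarith) h1.le (by linarith) h2.le
    have := gapKernel_nonneg hx.le hy.le
    simp only [Pi.zero_apply]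
    positivity

/-- The integrand on the unit square. -/
noncomputable def squareDensity (x y : ℝ) : ℝ :=
  squarePolynomial x y * ((x + y) * ((x + y) ^ 4 - 4 * (x ^ 2 * y ^ 2 * (x + y - x * y)))) /
    (x + y - x * y) ^ 6

theorem squarePolynomial_eq_gapPolynomial {x y : ℝ} (hx : x ≠ 0) (hy : y ≠ 0) :
    squarePolynomial x y = x ^ 5 * y ^ 5 * gapPolynomial (x⁻¹ - 1) (y⁻¹ - 1) := by
  obtain ⟨u, rfl⟩ : ∃ u, x = u⁻¹ := ⟨x⁻¹, by simp⟩
  obtain ⟨v, rfl⟩ : ∃ v, y = v⁻¹ := ⟨y⁻¹, by simp⟩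
  have hu : u ≠ 0 := by simpa using hx
  have hv : v ≠ 0 := by simpa using hy
  rw [inv_inv, inv_inv, squarePolynomial, gapPolynomial]
  field_simp
  ring

theorem gapKernel_inv_sub_one {x y : ℝ} (hx : 0 < x) (hy : 0 < y) (h : 0 < x + y - x * y) :
    gapKernel (x⁻¹ - 1) (y⁻¹ - 1) = x ^ 7 * y ^ 7 *
      ((x + y) * ((x + y) ^ 4 - 4 * (x ^ 2 * y ^ 2 * (x + y - x * y)))) /
      (x + y - x * y) ^ 6 := by
  have e1 : 2 + (x⁻¹ - 1) + (y⁻¹ - 1) = (x + y) / (x * y) := by field_simp; ring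
  have e2 : (1 + (x⁻¹ - 1) + (y⁻¹ - 1)) * (1 + (x⁻¹ - 1)) * (1 + (y⁻¹ - 1)) =
      (x + y - x * y) / (x * y) ^ 2 := by field_simp; ring
  rw [gapKernel, e1, e2]
  generalize x + y - x * y = D at h ⊢
  generalize x + y = S
  field_simp

theorem squareDensity_eq {x y : ℝ} (hx : 0 < x) (hy : 0 < y) (h : 0 < x + y - x * y) :
    squareDensity x y =
      (x ^ 2)⁻¹ * ((y ^ 2)⁻¹ * (gapPolynomial (x⁻¹ - 1) (y⁻¹ - 1) * gapKernel (x⁻¹ - 1) (y⁻¹ - 1)))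
      := by
  rw [squareDensity, gapKernel_inv_sub_one hx hy h, squarePolynomial_eq_gapPolynomial hx.ne' hy.ne']
  generalize gapPolynomial (x⁻¹ - 1) (y⁻¹ - 1) = R
  generalize (x + y) * ((x + y) ^ 4 - 4 * (x ^ 2 * y ^ 2 * (x + y - x * y))) = S
  field_simp

theorem squareDensity_nonneg {x y : ℝ} (hx : 0 < x) (hx1 : x < 1) (hy : 0 < y) (hy1 : y < 1) :
    0 ≤ squareDensity x y := by
  have h1 : 0 ≤ x⁻¹ - 1 := sub_nonneg.2 ((one_le_inv₀ hx).2 hx1.le)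
  have h2 : 0 ≤ y⁻¹ - 1 := sub_nonneg.2 ((one_le_inv₀ hy).2 hy1.le)
  have := gapPolynomial_nonneg h1 h2
  have := gapKernel_nonneg h1 h2
  rw [squareDensity_eq hx hy (add_sub_mul_pos hx.le hx1.le hy)]
  positivity

theorem lintegral_squareDensity :
    ∫⁻ q, ENNReal.ofReal (squareDensity q.1 q.2) ∂unitSquare =
      ENNReal.ofReal (217 / 40500 - 4 / 135135 * Real.pi ^ 2) := by
  obtain ⟨i0, h0⟩ := integral_sum_exactNumerator _ four_le_of_mem_squareCertificate
  have i1 := integrable_unitSquare_inv.const_mul (-8 / 45045)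
  have i2 : Integrable (fun _ : ℝ × ℝ => (217 / 40500 : ℝ)) unitSquare := integrable_const _
  have hu : unitSquare.real Set.univ = 1 := by
    simp [Measure.real, ← Set.univ_prod_univ, Measure.prod_prod]
  have e : (fun q : ℝ × ℝ => squareDensity q.1 q.2) =ᵐ[unitSquare] fun q =>
      -8 / 45045 * (q.1 + q.2 - q.1 * q.2)⁻¹ + 217 / 40500 +
      (squareCertificate.map fun t => t.1 * exactNumerator t.2.1 t.2.2 q.1 q.2).sum /
        (q.1 + q.2 - q.1 * q.2) ^ 6 := by
    filter_upwards [ae_unitSquare] with q hq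
    have h := add_sub_mul_pos hq.1.1.le hq.1.2.le hq.2.1
    rw [squareDensity, squarePolynomial_eq]
    field_simp
  rw [← ofReal_integral_eq_lintegral_ofReal (((i1.add i2).add i0).congr e.symm), integral_congr_ae e,
    integral_add (by exact i1.add i2) i0, integral_add i1 i2, integral_const_mul, integral_unitSquare_inv, h0]
  · rw [integral_const, hu, smul_eq_mul]
    ring_nf
  · filter_upwards [ae_unitSquare] with q hq
    exact squareDensity_nonneg hq.1.1 hq.1.2 hq.2.1 hq.2.2

theorem lintegral_lintegral_lintegral_rotate {α β γ : Type*} [MeasurableSpace α]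
    [MeasurableSpace β] [MeasurableSpace γ] {μ : Measure α} {ν : Measure β} {ρ : Measure γ}
    [SFinite μ] [SFinite ν] [SFinite ρ] {f : α × β × γ → ENNReal} (hf : Measurable f) :
    ∫⁻ x, ∫⁻ y, ∫⁻ z, f (x, y, z) ∂ρ ∂ν ∂μ = ∫⁻ y, ∫⁻ z, ∫⁻ x, f (x, y, z) ∂μ ∂ρ ∂ν := by
  have h : Measurable fun q : (α × β) × γ => f (q.1.1, q.1.2, q.2) :=
    hf.comp (by fun_prop)
  rw [lintegral_lintegral_swap h.lintegral_prod_right'.aemeasurable]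
  refine lintegral_congr fun y => lintegral_lintegral_swap ?_
  exact (hf.comp (by fun_prop : Measurable fun q : α × γ => (q.1, y, q.2))).aemeasurable

theorem octantLIntegral_densityTwoTwo :
    (octantLIntegral fun a b c => ENNReal.ofReal (densityTwoTwo a b c 1)) =
      ENNReal.ofReal (192 * (217 / 40500 - 4 / 135135 * Real.pi ^ 2)) := by
  have hm : ∀ {h : ℝ × ℝ × ℝ → ℝ × ℝ × ℝ × ℝ}, Measurable h → Measurable fun q =>
      ENNReal.ofReal (densityTwoTwo (h q).1 (h q).2.1 (h q).2.2.1 (h q).2.2.2) := fun hh =>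
    (measurable_densityTwoTwo.comp hh).ennreal_ofReal
  have hf : Measurable fun q : ℝ × ℝ × ℝ => ENNReal.ofReal
      (densityTwoTwo (q.1 + q.2.1) q.1 (1 - q.1 + q.2.2) (1 - q.1)) :=
    hm (h := fun q => (q.1 + q.2.1, q.1, 1 - q.1 + q.2.2, 1 - q.1)) (by fun_prop)
  have hsq : Measurable fun q : ℝ × ℝ => ENNReal.ofReal (squareDensity q.1 q.2) := by
    unfold squareDensity squarePolynomial
    fun_prop
  have s1 : ∫⁻ g in Set.Ioo 0 1, ∫⁻ x in Set.Ioi 0, ∫⁻ y in Set.Ioi 0,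
      ENNReal.ofReal (densityTwoTwo (g + x) g (1 - g + y) (1 - g)) =
      ∫⁻ x in Set.Ioi 0, ∫⁻ y in Set.Ioi 0,
        ENNReal.ofReal (48 * gapPolynomial x y * gapKernel x y) := by
    rw [lintegral_lintegral_lintegral_rotate hf]
    exact setLIntegral_congr_fun measurableSet_Ioi fun x hx =>
      setLIntegral_congr_fun measurableSet_Ioi fun y hy => lintegral_densityTwoTwo_gap hx hy
  rw [octantLIntegral_densityTwoTwo_eq, s1, lintegral_Ioi_zero_comp_inv_sub_one]
  have s2 : ∀ x ∈ Set.Ioo (0 : ℝ) 1, ENNReal.ofReal ((x ^ 2)⁻¹) * ∫⁻ y in Set.Ioi 0,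
      ENNReal.ofReal (48 * gapPolynomial (x⁻¹ - 1) y * gapKernel (x⁻¹ - 1) y) =
      48 * ∫⁻ y in Set.Ioo 0 1, ENNReal.ofReal (squareDensity x y) := by
    intro x hx
    rw [lintegral_Ioi_zero_comp_inv_sub_one, ← lintegral_const_mul' _ _ ENNReal.ofReal_ne_top,
      ← lintegral_const_mul' _ _ (by simp)]
    refine setLIntegral_congr_fun measurableSet_Ioo fun y hy => ?_
    have hx0 := hx.1
    have hy0 := hy.1
    rw [← ENNReal.ofReal_mul (by positivity), ← ENNReal.ofReal_mul (by positivity),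
      show (48 : ENNReal) = ENNReal.ofReal 48 by simp, ← ENNReal.ofReal_mul (by positivity),
      squareDensity_eq hx0 hy0 (add_sub_mul_pos hx0.le hx.2.le hy0)]
    ring_nf
  rw [setLIntegral_congr_fun measurableSet_Ioo s2, lintegral_const_mul' _ _ (by simp),
    ← lintegral_prod _ hsq.aemeasurable, lintegral_squareDensity,
    show (4 : ENNReal) = ENNReal.ofReal 4 by simp, show (48 : ENNReal) = ENNReal.ofReal 48 by simp,
    ← ENNReal.ofReal_mul (by positivity), ← ENNReal.ofReal_mul (by positivity)]
  ring_nf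

theorem lintegral_cramerDensity :
    ∫⁻ p, cramerDensity p = ENNReal.ofReal (256 * (13 / 720 - Real.pi ^ 2 / 15015)) := by
  have hpi : (0 : ℝ) ≤ 217 / 40500 - 4 / 135135 * Real.pi ^ 2 := by
    nlinarith [Real.pi_lt_four, Real.pi_pos]
  rw [lintegral_cramerDensity_eq_densities, octantLIntegral_densityOneThree_swap,
    octantLIntegral_densityOneThree, octantLIntegral_densityTwoTwo,
    show (3 : ENNReal) = ENNReal.ofReal 3 by simp, ← ENNReal.ofReal_mul (by positivity),
    ← ENNReal.ofReal_mul (by positivity), ← ENNReal.ofReal_add (by positivity) (by positivity),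
    ← ENNReal.ofReal_add (by positivity) (by positivity)]
  ring_nf

theorem lintegral_pow_mul_exp_neg (k : ℕ) :
    ∫⁻ x in Set.Ioi 0, ENNReal.ofReal (x ^ k * Real.exp (-x)) = k.factorial := by
  have h := Real.GammaIntegral_convergent (s := (k : ℝ) + 1) (by positivity)
  have e : ∀ x : ℝ, x ^ k * Real.exp (-x) = Real.exp (-x) * x ^ ((k : ℝ) + 1 - 1) := fun x => by
    simp [mul_comm]
  simp only [e]
  rw [← ofReal_integral_eq_lintegral_ofReal h, ← Real.Gamma_eq_integral (by positivity),
    Real.Gamma_nat_eq_factorial]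
  · simp
  · filter_upwards [ae_restrict_mem measurableSet_Ioi] with x hx
    have : (0 : ℝ) < x := hx
    simp only [Pi.zero_apply]
    positivity

/-- The corner simplex in three-dimensional space. -/
def cornerSimplex : Set (Fin 3 → ℝ) := {y | (∀ i, 0 ≤ y i) ∧ ∑ i, y i ≤ 1}

theorem measurableSet_cornerSimplex : MeasurableSet cornerSimplex := by
  unfold cornerSimplex
  measurability

/-- The density of four independent exponential variables. -/
noncomputable def pairWeight (q : (Fin 3 → ℝ) × ℝ) : ℝ :=
  (∏ j, expWeight (q.1 j)) * expWeight q.2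

@[fun_prop]
theorem measurable_pairWeight : Measurable pairWeight := by
  unfold pairWeight
  fun_prop

theorem pairWeight_nonneg (q : (Fin 3 → ℝ) × ℝ) : 0 ≤ pairWeight q :=
  mul_nonneg (Finset.prod_nonneg fun _ _ => expWeight_nonneg _) (expWeight_nonneg _)

theorem lintegral_comp_smul_fin_three {s : ℝ} (hs : 0 < s) {f : (Fin 3 → ℝ) → ENNReal}
    (hf : Measurable f) : ∫⁻ n, f n = ENNReal.ofReal (s ^ 3) * ∫⁻ y, f (s • y) := by
  have h : ∫⁻ y, f (s • y) = ∫⁻ n, f n ∂(Measure.map (s • ·) volume) :=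
    (lintegral_map hf (by fun_prop)).symm
  rw [h, Measure.map_addHaar_smul _ hs.ne', lintegral_smul_measure, smul_eq_mul, ← mul_assoc,
    ← ENNReal.ofReal_mul (by positivity)]
  simp only [Module.finrank_fin_fun]
  rw [abs_of_pos (by positivity), mul_inv_cancel₀ (by positivity)]
  simp

theorem lintegral_mul_pairWeight {F : (Fin 3 → ℝ) × ℝ → ENNReal} (hF : Measurable F) (k : ℕ)
    (hk : ∀ s : ℝ, 0 < s → ∀ q, F (s • q) = ENNReal.ofReal (s ^ k) * F q) :
    ∫⁻ q, F q * ENNReal.ofReal (pairWeight q) =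
      (k + 3).factorial * ∫⁻ y in cornerSimplex, F (y, 1 - ∑ i, y i) := by
  let U : Set ((Fin 3 → ℝ) × ℝ) := {p | (∀ i, 0 ≤ p.1 i) ∧ ∑ i, p.1 i ≤ p.2}
  have hU : MeasurableSet U := by
    simp only [U]
    measurability
  let H : (Fin 3 → ℝ) × ℝ → ENNReal :=
    U.indicator fun p => F (p.1, p.2 - ∑ i, p.1 i) * ENNReal.ofReal (Real.exp (-p.2))
  have hH : Measurable H := by
    refine Measurable.indicator (Measurable.mul (hF.comp (by fun_prop :
      Measurable fun p : (Fin 3 → ℝ) × ℝ => (p.1, p.2 - ∑ i, p.1 i))) (by fun_prop)) hU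
  have hHi : ∀ n s, (n, s) ∈ U →
      H (n, s) = F (n, s - ∑ i, n i) * ENNReal.ofReal (Real.exp (-s)) :=
    fun n s h => Set.indicator_of_mem h _
  have hHo : ∀ n s, (n, s) ∉ U → H (n, s) = 0 := fun n s h => Set.indicator_of_notMem h _
  have s1 : ∀ᵐ n : Fin 3 → ℝ, ∫⁻ z, F (n, z) * ENNReal.ofReal (pairWeight (n, z)) =
      ∫⁻ s, H (n, s) := by
    have h0 : ∀ᵐ n : Fin 3 → ℝ, ∀ i, n i ≠ 0 :=
      ae_all_iff.2 fun i => Measure.ae_eval_ne (μ := fun _ : Fin 3 => (volume : Measure ℝ)) i 0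
    filter_upwards [h0] with n hn
    rw [← lintegral_sub_right_eq_self _ (∑ i, n i)]
    refine lintegral_congr_ae ?_
    filter_upwards [compl_mem_ae_iff.2 (measure_singleton (∑ i, n i))] with s hs
    have hs' : s ≠ ∑ i, n i := hs
    by_cases hp : ∀ i, 0 < n i
    · have e : ∀ i, expWeight (n i) = Real.exp (-n i) := fun i => if_pos (hp i)
      rcases lt_or_gt_of_ne hs' with hlt | hgt
      · rw [hHo n s fun h => absurd h.2 (not_le.2 hlt), pairWeight, expWeight,
          if_neg (by simpa using hlt.le)]
        simp
      · have hm : (n, s) ∈ U := ⟨fun i => (hp i).le, hgt.le⟩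
        rw [hHi n s hm, pairWeight]
        simp only [e]
        rw [expWeight, if_pos (sub_pos.2 hgt), ← Real.exp_sum, ← Real.exp_add, Finset.sum_neg_distrib]
        ring_nf
    · push Not at hp
      obtain ⟨i, hi⟩ := hp
      have hlt : n i < 0 := lt_of_le_of_ne hi (hn i)
      rw [pairWeight, Finset.prod_eq_zero (Finset.mem_univ i) (if_neg (not_lt.2 hi)),
        hHo n s fun h => absurd (h.1 i) (not_le.2 hlt)]
      simp
  have s2 : ∀ s : ℝ, 0 < s → ∫⁻ n, H (n, s) =
      ENNReal.ofReal (s ^ (k + 3) * Real.exp (-s)) *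
        ∫⁻ y in cornerSimplex, F (y, 1 - ∑ i, y i) := by
    intro s hs
    rw [lintegral_comp_smul_fin_three hs (f := fun n => H (n, s)) (by fun_prop),
      ← lintegral_indicator measurableSet_cornerSimplex,
      ← lintegral_const_mul' _ _ ENNReal.ofReal_ne_top,
      ← lintegral_const_mul' _ _ ENNReal.ofReal_ne_top]
    refine lintegral_congr fun y => ?_
    have hsum : ∑ i, (s • y) i = s * ∑ i, y i := by simp [Finset.mul_sum]
    have hmem : (s • y, s) ∈ U ↔ y ∈ cornerSimplex := by
      refine and_congr (forall_congr' fun i => ?_) ?_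
      · simp [hs]
      · dsimp only
        rw [hsum]
        exact mul_le_iff_le_one_right hs
    by_cases hy : y ∈ cornerSimplex
    · rw [Set.indicator_of_mem hy, hHi _ _ (hmem.2 hy)]
      rw [hsum, show (s • y, s - s * ∑ i, y i) = s • (y, 1 - ∑ i, y i) by
        simp [Prod.smul_mk, mul_sub], hk s hs, pow_add, ENNReal.ofReal_mul (by positivity),
        ENNReal.ofReal_mul (by positivity)]
      ring
    · rw [Set.indicator_of_notMem hy, hHo _ _ (mt hmem.1 hy)]
      simp
  have s3 : ∀ᵐ s : ℝ, ∫⁻ n, H (n, s) = (Set.Ioi 0).indicator (fun s =>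
      ENNReal.ofReal (s ^ (k + 3) * Real.exp (-s)) *
        ∫⁻ y in cornerSimplex, F (y, 1 - ∑ i, y i)) s := by
    filter_upwards [compl_mem_ae_iff.2 (measure_singleton (0 : ℝ))] with s hs
    rcases lt_or_gt_of_ne (show s ≠ 0 from hs) with h | h
    · rw [Set.indicator_of_notMem (by simpa using h.le)]
      refine (lintegral_congr fun n => ?_).trans lintegral_zero
      exact hHo n s fun hm => absurd (Finset.sum_nonneg fun i _ => hm.1 i)
        (not_le.2 (hm.2.trans_lt h))
    · rw [Set.indicator_of_mem (by exact h), s2 s h]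
  rw [Measure.volume_eq_prod, lintegral_prod _ (by fun_prop), lintegral_congr_ae s1,
    lintegral_lintegral_swap (by exact hH.aemeasurable), lintegral_congr_ae s3,
    lintegral_indicator measurableSet_Ioi, lintegral_mul_const _ (by fun_prop),
    lintegral_pow_mul_exp_neg]

theorem lintegral_expWeight : ∫⁻ x, ENNReal.ofReal (expWeight x) = 1 := by
  have h := lintegral_expWeight_mul 1
  have h' := lintegral_pow_mul_exp_neg 0
  simp only [pow_zero, one_mul] at h'
  simpa [h'] using h

theorem lintegral_pairWeight : ∫⁻ q, ENNReal.ofReal (pairWeight q) = 1 := by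
  have e : ∀ q, ENNReal.ofReal (pairWeight q) = (∏ j, ENNReal.ofReal (expWeight (q.1 j))) *
      ENNReal.ofReal (expWeight q.2) := fun q => by
    rw [pairWeight, ENNReal.ofReal_mul (Finset.prod_nonneg fun _ _ => expWeight_nonneg _),
      ENNReal.ofReal_prod_of_nonneg fun _ _ => expWeight_nonneg _]
  simp only [e]
  rw [Measure.volume_eq_prod, lintegral_prod_mul (f := fun n : Fin 3 → ℝ => ∏ j, ENNReal.ofReal (expWeight (n j)))
      (g := fun z => ENNReal.ofReal (expWeight z)) (Measurable.aemeasurable (by fun_prop))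
      (Measurable.aemeasurable (by fun_prop)),
    lintegral_expWeight, mul_one,
    lintegral_fin_three (by fun_prop)]
  simp only [Fin.prod_univ_three]
  simp [lintegral_const_mul', lintegral_expWeight, mul_assoc]

theorem volume_cornerSimplex : volume cornerSimplex = ENNReal.ofReal (1 / 6) := by
  have h := lintegral_mul_pairWeight (F := 1) measurable_one 0 (by simp)
  simp only [Pi.one_apply, one_mul, lintegral_pairWeight, setLIntegral_one] at h
  rw [one_div, ENNReal.ofReal_inv_of_pos (by positivity)]
  refine ENNReal.eq_inv_of_mul_eq_one_left ?_
  rw [mul_comm, h]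
  simp [Nat.factorial]

/-- The affine map that takes the corner simplex to the simplex with vertices `a`, `b`, `c`, `d`. -/
def simplexMap {E : Type*} [AddCommGroup E] [Module ℝ E] (a b c d : E) (y : Fin 3 → ℝ) : E :=
  d + (y 0 • (a - d) + y 1 • (b - d) + y 2 • (c - d))

theorem simplexMap_add_smul {E : Type*} [AddCommGroup E] [Module ℝ E] (a b c d : E)
    (y z : Fin 3 → ℝ) {s t : ℝ} (h : s + t = 1) :
    simplexMap a b c d (s • y + t • z) = s • simplexMap a b c d y + t • simplexMap a b c d z := by
  obtain rfl : t = 1 - s := by linarith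
  simp only [simplexMap, Pi.add_apply, Pi.smul_apply, smul_eq_mul]
  module

theorem convexHull_four_eq_image {E : Type*} [AddCommGroup E] [Module ℝ E] (a b c d : E) :
    convexHull ℝ {a, b, c, d} = simplexMap a b c d '' cornerSimplex := by
  refine Set.Subset.antisymm (convexHull_min ?_ ?_) ?_
  · rintro x (rfl | rfl | rfl | rfl)
    · exact ⟨![1, 0, 0], ⟨by simp [Fin.forall_fin_succ], by simp [Fin.sum_univ_three]⟩,
        by simp [simplexMap]⟩
    · exact ⟨![0, 1, 0], ⟨by simp [Fin.forall_fin_succ], by simp [Fin.sum_univ_three]⟩,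
        by simp [simplexMap]⟩
    · exact ⟨![0, 0, 1], ⟨by simp [Fin.forall_fin_succ], by simp [Fin.sum_univ_three]⟩,
        by simp [simplexMap]⟩
    · exact ⟨0, ⟨by simp, by simp⟩, by simp [simplexMap]⟩
  · rintro _ ⟨y, hy, rfl⟩ _ ⟨z, hz, rfl⟩ s t hs ht h
    refine ⟨s • y + t • z, ⟨fun i => ?_, ?_⟩, simplexMap_add_smul a b c d y z h⟩
    · have := hy.1 i
      have := hz.1 i
      simp only [Pi.add_apply, Pi.smul_apply, smul_eq_mul]
      positivity
    · have h1 := mul_le_mul_of_nonneg_left hy.2 hs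
      have h2 := mul_le_mul_of_nonneg_left hz.2 ht
      simp only [Pi.add_apply, Pi.smul_apply, smul_eq_mul, Finset.sum_add_distrib,
        ← Finset.mul_sum]
      linarith
  · rintro _ ⟨y, hy, rfl⟩
    have h := (convex_convexHull ℝ ({a, b, c, d} : Set E)).sum_mem (t := Finset.univ)
      (w := ![y 0, y 1, y 2, 1 - ∑ i, y i]) (z := ![a, b, c, d])
      (by simp [Fin.forall_fin_succ, hy.1, hy.2]) (by simp [Fin.sum_univ_succ]; ring)
      (fun i _ => subset_convexHull ℝ _ (by fin_cases i <;> simp))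
    convert h using 1
    simp [Fin.sum_univ_succ, simplexMap]
    module

/-- The matrix whose rows are the edges of a simplex from its last vertex. -/
def edgeMatrix (a b c d : Fin 3 → ℝ) : Matrix (Fin 3) (Fin 3) ℝ := Matrix.of ![a - d, b - d, c - d]

theorem simplexMap_eq_toLin (a b c d y : Fin 3 → ℝ) :
    simplexMap a b c d y = d + (edgeMatrix a b c d).transpose.toLin' y := by
  ext i
  simp [simplexMap, edgeMatrix, Matrix.toLin'_apply, Matrix.mulVec, dotProduct,
    Fin.sum_univ_three]
  ring

theorem volume_simplexMap_image (a b c d : Fin 3 → ℝ) :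
    volume (simplexMap a b c d '' cornerSimplex) =
      ENNReal.ofReal (|(edgeMatrix a b c d).det| / 6) := by
  have h : simplexMap a b c d '' cornerSimplex =
      (fun x => d + x) '' ((edgeMatrix a b c d).transpose.toLin' '' cornerSimplex) := by
    rw [Set.image_image]
    exact Set.image_congr fun y _ => simplexMap_eq_toLin a b c d y
  rw [h, Set.image_add_left, measure_preimage_add, Measure.addHaar_image_linearMap,
    LinearMap.det_toLin', Matrix.det_transpose, volume_cornerSimplex,
    ← ENNReal.ofReal_mul (abs_nonneg _), mul_one_div]

theorem ofLp_simplexMap (a b c d : EuclideanSpace ℝ (Fin 3)) (y : Fin 3 → ℝ) :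
    (simplexMap a b c d y).ofLp = simplexMap a.ofLp b.ofLp c.ofLp d.ofLp y := by
  simp [simplexMap]

theorem ofLp_preimage_image_simplexMap (a b c d : EuclideanSpace ℝ (Fin 3)) :
    WithLp.ofLp ⁻¹' (simplexMap a.ofLp b.ofLp c.ofLp d.ofLp '' cornerSimplex) =
      simplexMap a b c d '' cornerSimplex := by
  ext x
  exact ⟨fun ⟨y, hy, h⟩ => ⟨y, hy, WithLp.ofLp_injective 2 (by rw [ofLp_simplexMap]; exact h)⟩,
    fun ⟨y, hy, h⟩ => ⟨y, hy, by rw [← ofLp_simplexMap, h]⟩⟩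

theorem measurableEmbedding_ofLp :
    MeasurableEmbedding (WithLp.ofLp : EuclideanSpace ℝ (Fin 3) → Fin 3 → ℝ) :=
  (MeasurableEquiv.toLp 2 (Fin 3 → ℝ)).symm.measurableEmbedding

theorem volume_convexHull_four (a b c d : EuclideanSpace ℝ (Fin 3)) :
    volume (convexHull ℝ {a, b, c, d}) =
      ENNReal.ofReal (|(edgeMatrix a.ofLp b.ofLp c.ofLp d.ofLp).det| / 6) := by
  rw [convexHull_four_eq_image, ← volume_simplexMap_image, ← ofLp_preimage_image_simplexMap,
    (PiLp.volume_preserving_ofLp (Fin 3)).measure_preimage_emb measurableEmbedding_ofLp]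

theorem setLIntegral_convexHull_four {A B C D : EuclideanSpace ℝ (Fin 3)}
    (h : (edgeMatrix A.ofLp B.ofLp C.ofLp D.ofLp).det ≠ 0) (f : EuclideanSpace ℝ (Fin 3) → ENNReal) :
    ∫⁻ x in convexHull ℝ {A, B, C, D}, f x =
      ENNReal.ofReal |(edgeMatrix A.ofLp B.ofLp C.ofLp D.ofLp).det| *
        ∫⁻ y in cornerSimplex, f (simplexMap A B C D y) := by
  let L := LinearMap.toContinuousLinearMap
    (edgeMatrix A.ofLp B.ofLp C.ofLp D.ofLp).transpose.toLin'
  have hL : ∀ y, simplexMap A.ofLp B.ofLp C.ofLp D.ofLp y = D.ofLp + L y :=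
    simplexMap_eq_toLin A.ofLp B.ofLp C.ofLp D.ofLp
  have hd : L.det = (edgeMatrix A.ofLp B.ofLp C.ofLp D.ofLp).det := by
    rw [LinearMap.det_toContinuousLinearMap, LinearMap.det_toLin', Matrix.det_transpose]
  have hinj : Function.Injective L := by
    rw [LinearMap.coe_toContinuousLinearMap']
    exact Matrix.mulVec_injective_of_isUnit ((Matrix.isUnit_iff_isUnit_det _).2
      (by rw [Matrix.det_transpose]; exact h.isUnit))
  have e := (PiLp.volume_preserving_ofLp (Fin 3)).setLIntegral_comp_preimage_emb
    measurableEmbedding_ofLp (fun x => f (WithLp.toLp 2 x))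
    (simplexMap A.ofLp B.ofLp C.ofLp D.ofLp '' cornerSimplex)
  rw [ofLp_preimage_image_simplexMap, ← convexHull_four_eq_image] at e
  simp only [WithLp.toLp_ofLp] at e
  rw [e, lintegral_image_eq_lintegral_abs_det_fderiv_mul volume measurableSet_cornerSimplex
    (f' := fun _ => L), hd, lintegral_const_mul' _ _ ENNReal.ofReal_ne_top]
  · simp only [← ofLp_simplexMap, WithLp.toLp_ofLp]
  · intro y _
    rw [funext hL]
    exact (L.hasFDerivAt.const_add _).hasFDerivWithinAt
  · intro y _ z _ hyz
    simp only [hL] at hyz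
    exact hinj (add_left_cancel hyz)

theorem edgeMatrix_simplexMap (A B C D a b c d : Fin 3 → ℝ) :
    edgeMatrix (simplexMap A B C D a) (simplexMap A B C D b) (simplexMap A B C D c)
      (simplexMap A B C D d) = edgeMatrix a b c d * edgeMatrix A B C D := by
  ext i j
  fin_cases i <;> simp [edgeMatrix, simplexMap, Matrix.mul_apply, Fin.sum_univ_three] <;> ring

/-- The barycentric coordinates of a point of the corner simplex, the last one separated. -/
def barycentric (y : Fin 3 → ℝ) : (Fin 3 → ℝ) × ℝ := (y, 1 - ∑ i, y i)

@[fun_prop]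
theorem measurable_barycentric : Measurable barycentric := by
  unfold barycentric
  fun_prop

theorem measurable_setLIntegral_comp {α β γ : Type*} [MeasurableSpace α] [MeasurableSpace β]
    [MeasurableSpace γ] {μ : Measure β} [SFinite μ] {f : γ → ENNReal} (hf : Measurable f)
    {g : α → β → γ} (hg : Measurable fun p : α × β => g p.1 p.2) :
    Measurable fun a => ∫⁻ b, f (g a b) ∂μ :=
  Measurable.lintegral_prod_right' (f := fun p : α × β => f (g p.1 p.2)) (hf.comp hg)

theorem lintegral_four_mul_pairWeight
    {F : (Fin 3 → ℝ) × ℝ → (Fin 3 → ℝ) × ℝ → (Fin 3 → ℝ) × ℝ → (Fin 3 → ℝ) × ℝ → ENNReal}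
    (hF : Measurable fun q : ((Fin 3 → ℝ) × ℝ) × ((Fin 3 → ℝ) × ℝ) × ((Fin 3 → ℝ) × ℝ) ×
      ((Fin 3 → ℝ) × ℝ) => F q.1 q.2.1 q.2.2.1 q.2.2.2)
    (h₀ : ∀ s, 0 < s → ∀ a b c d, F (s • a) b c d = ENNReal.ofReal s * F a b c d)
    (h₁ : ∀ s, 0 < s → ∀ a b c d, F a (s • b) c d = ENNReal.ofReal s * F a b c d)
    (h₂ : ∀ s, 0 < s → ∀ a b c d, F a b (s • c) d = ENNReal.ofReal s * F a b c d)
    (h₃ : ∀ s, 0 < s → ∀ a b c d, F a b c (s • d) = ENNReal.ofReal s * F a b c d) :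
    ∫⁻ a, (∫⁻ b, (∫⁻ c, (∫⁻ d, F a b c d * ENNReal.ofReal (pairWeight d)) *
      ENNReal.ofReal (pairWeight c)) * ENNReal.ofReal (pairWeight b)) *
        ENNReal.ofReal (pairWeight a) =
      24 ^ 4 * ∫⁻ x in cornerSimplex, ∫⁻ y in cornerSimplex, ∫⁻ z in cornerSimplex,
        ∫⁻ w in cornerSimplex, F (barycentric x) (barycentric y) (barycentric z)
          (barycentric w) := by
  have hn : (((1 + 3).factorial : ℕ) : ENNReal) = 24 := by norm_num [Nat.factorial]
  have hc : (24 : ENNReal) ≠ ⊤ := by simp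
  have m₃ : Measurable fun q : ((Fin 3 → ℝ) × ℝ) × ((Fin 3 → ℝ) × ℝ) × ((Fin 3 → ℝ) × ℝ) =>
      ∫⁻ w in cornerSimplex, F q.1 q.2.1 q.2.2 (barycentric w) :=
    measurable_setLIntegral_comp hF
      (g := fun (q : ((Fin 3 → ℝ) × ℝ) × ((Fin 3 → ℝ) × ℝ) × ((Fin 3 → ℝ) × ℝ)) w =>
        (q.1, q.2.1, q.2.2, barycentric w)) (by fun_prop)
  have m₂ : Measurable fun q : ((Fin 3 → ℝ) × ℝ) × ((Fin 3 → ℝ) × ℝ) =>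
      ∫⁻ z in cornerSimplex, ∫⁻ w in cornerSimplex, F q.1 q.2 (barycentric z) (barycentric w) :=
    measurable_setLIntegral_comp m₃ (g := fun (q : ((Fin 3 → ℝ) × ℝ) × ((Fin 3 → ℝ) × ℝ)) z =>
      (q.1, q.2, barycentric z)) (by fun_prop)
  have m₁ : Measurable fun q : (Fin 3 → ℝ) × ℝ =>
      ∫⁻ y in cornerSimplex, ∫⁻ z in cornerSimplex, ∫⁻ w in cornerSimplex,
        F q (barycentric y) (barycentric z) (barycentric w) :=
    measurable_setLIntegral_comp m₂ (g := fun (q : ((Fin 3 → ℝ) × ℝ)) y => (q, barycentric y)) (by fun_prop)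
  have e₃ : ∀ a b c, ∫⁻ d, F a b c d * ENNReal.ofReal (pairWeight d) =
      24 * ∫⁻ w in cornerSimplex, F a b c (barycentric w) := fun a b c => by
    rw [← hn]
    exact lintegral_mul_pairWeight (F := fun d => F a b c d)
      (hF.comp (f := fun d => (a, b, c, d)) (by fun_prop)) 1
      (fun s hs q => by simp only [pow_one, h₃ s hs])
  have e₂ : ∀ a b, ∫⁻ c, (∫⁻ w in cornerSimplex, F a b c (barycentric w)) *
      ENNReal.ofReal (pairWeight c) =
      24 * ∫⁻ z in cornerSimplex, ∫⁻ w in cornerSimplex,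
        F a b (barycentric z) (barycentric w) := fun a b => by
    rw [← hn]
    exact lintegral_mul_pairWeight
      (F := fun c => ∫⁻ w in cornerSimplex, F a b c (barycentric w))
      (m₃.comp (f := fun c => (a, b, c)) (by fun_prop)) 1
      (fun s hs q => by
        simp only [pow_one, h₂ s hs, lintegral_const_mul' _ _ ENNReal.ofReal_ne_top])
  have e₁ : ∀ a, ∫⁻ b, (∫⁻ z in cornerSimplex, ∫⁻ w in cornerSimplex,
      F a b (barycentric z) (barycentric w)) * ENNReal.ofReal (pairWeight b) =
      24 * ∫⁻ y in cornerSimplex, ∫⁻ z in cornerSimplex, ∫⁻ w in cornerSimplex,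
        F a (barycentric y) (barycentric z) (barycentric w) := fun a => by
    rw [← hn]
    exact lintegral_mul_pairWeight
      (F := fun b => ∫⁻ z in cornerSimplex, ∫⁻ w in cornerSimplex,
        F a b (barycentric z) (barycentric w))
      (m₂.comp (f := fun b => (a, b)) (by fun_prop)) 1
      (fun s hs q => by
        simp only [pow_one, h₁ s hs, lintegral_const_mul' _ _ ENNReal.ofReal_ne_top])
  have e₀ : ∫⁻ a, (∫⁻ y in cornerSimplex, ∫⁻ z in cornerSimplex, ∫⁻ w in cornerSimplex,
      F a (barycentric y) (barycentric z) (barycentric w)) * ENNReal.ofReal (pairWeight a) =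
      24 * ∫⁻ x in cornerSimplex, ∫⁻ y in cornerSimplex, ∫⁻ z in cornerSimplex,
        ∫⁻ w in cornerSimplex, F (barycentric x) (barycentric y) (barycentric z)
          (barycentric w) := by
    rw [← hn]
    exact lintegral_mul_pairWeight m₁ 1
      (fun s hs q => by
        simp only [pow_one, h₀ s hs, lintegral_const_mul' _ _ ENNReal.ofReal_ne_top])
  simp only [e₃, mul_assoc, lintegral_const_mul' _ _ hc, e₂, e₁, e₀]
  ring

theorem lintegral_lintegral_arrow {H : (Fin 3 → Fin 3 → ℝ) → (Fin 3 → ℝ) → ENNReal}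
    (hH : Measurable H.uncurry) :
    ∫⁻ N, ∫⁻ z, H N z = ∫⁻ a : (Fin 3 → ℝ) × ℝ, ∫⁻ b : (Fin 3 → ℝ) × ℝ,
      ∫⁻ c : (Fin 3 → ℝ) × ℝ, H ![a.1, b.1, c.1] ![a.2, b.2, c.2] := by
  have e := (volume_measurePreserving_arrowProdEquivProdArrow (Fin 3 → ℝ) ℝ
    (Fin 3)).lintegral_comp hH
  rw [Measure.volume_eq_prod, lintegral_prod _ hH.aemeasurable] at e
  simp only [Function.uncurry] at e
  rw [← e, lintegral_fin_three]
  · refine lintegral_congr fun a => lintegral_congr fun b => lintegral_congr fun c => ?_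
    congr 1 <;> ext i <;> fin_cases i <;> rfl
  · exact hH.comp (MeasurableEquiv.measurable _)

/-- The determinant of the matrix with the given rows, the last column separated. -/
noncomputable def rowDet (a b c d : (Fin 3 → ℝ) × ℝ) : ℝ :=
  (!![a.1 0, a.1 1, a.1 2, a.2; b.1 0, b.1 1, b.1 2, b.2; c.1 0, c.1 1, c.1 2, c.2;
    d.1 0, d.1 1, d.1 2, d.2] : Matrix (Fin 4) (Fin 4) ℝ).det

theorem rowDet_eq (a b c d : (Fin 3 → ℝ) × ℝ) :
    rowDet a b c d =
      a.1 0 * (b.1 1 * (c.1 2 * d.2 - c.2 * d.1 2) - b.1 2 * (c.1 1 * d.2 - c.2 * d.1 1) +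
        b.2 * (c.1 1 * d.1 2 - c.1 2 * d.1 1)) -
      a.1 1 * (b.1 0 * (c.1 2 * d.2 - c.2 * d.1 2) - b.1 2 * (c.1 0 * d.2 - c.2 * d.1 0) +
        b.2 * (c.1 0 * d.1 2 - c.1 2 * d.1 0)) +
      a.1 2 * (b.1 0 * (c.1 1 * d.2 - c.2 * d.1 1) - b.1 1 * (c.1 0 * d.2 - c.2 * d.1 0) +
        b.2 * (c.1 0 * d.1 1 - c.1 1 * d.1 0)) -
      a.2 * (b.1 0 * (c.1 1 * d.1 2 - c.1 2 * d.1 1) - b.1 1 * (c.1 0 * d.1 2 - c.1 2 * d.1 0) +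
        b.1 2 * (c.1 0 * d.1 1 - c.1 1 * d.1 0)) := by
  rw [rowDet, Matrix.det_succ_row_zero]
  simp [Fin.sum_univ_succ, Matrix.det_fin_three, Fin.succAbove]
  ring

theorem rowDet_barycentric (x y z w : Fin 3 → ℝ) :
    rowDet (barycentric x) (barycentric y) (barycentric z) (barycentric w) =
      (edgeMatrix x y z w).det := by
  rw [rowDet_eq, Matrix.det_fin_three]
  simp [barycentric, edgeMatrix, Fin.sum_univ_three]
  ring

theorem lintegral_abs_rowDet_mul_pairWeight :
    ∫⁻ a, (∫⁻ b, (∫⁻ c, (∫⁻ d, ENNReal.ofReal |rowDet a b c d| *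
      ENNReal.ofReal (pairWeight d)) * ENNReal.ofReal (pairWeight c)) *
        ENNReal.ofReal (pairWeight b)) * ENNReal.ofReal (pairWeight a) =
      ENNReal.ofReal (256 * (13 / 720 - Real.pi ^ 2 / 15015)) := by
  have h : Measurable fun q : (((Fin 3 → Fin 3 → ℝ) × (Fin 3 → ℝ)) × (Fin 3 → ℝ)) × ℝ =>
      ENNReal.ofReal (|(!![q.1.1.1 0 0, q.1.1.1 0 1, q.1.1.1 0 2, q.1.1.2 0;
          q.1.1.1 1 0, q.1.1.1 1 1, q.1.1.1 1 2, q.1.1.2 1;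
          q.1.1.1 2 0, q.1.1.1 2 1, q.1.1.1 2 2, q.1.1.2 2;
          q.1.2 0, q.1.2 1, q.1.2 2, q.2] : Matrix (Fin 4) (Fin 4) ℝ).det| *
        ((∏ i, (∏ j, expWeight (q.1.1.1 i j)) * expWeight (q.1.1.2 i)) *
          ((∏ j, expWeight (q.1.2 j)) * expWeight q.2))) :=
    ENNReal.measurable_ofReal.comp
      ((measurable_abs.comp measurable_det_fin_four).mul (by fun_prop))
  have e := lintegral_abs_det_mul_expWeight
  rw [lintegral_lintegral_arrow] at e
  swap
  · exact h.lintegral_prod_right'.lintegral_prod_right'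
  refine Eq.trans ?_ (e.trans lintegral_cramerDensity)
  refine lintegral_congr fun a => ?_
  rw [← lintegral_mul_const' _ _ ENNReal.ofReal_ne_top]
  refine lintegral_congr fun b => ?_
  rw [← lintegral_mul_const' _ _ ENNReal.ofReal_ne_top,
    ← lintegral_mul_const' _ _ ENNReal.ofReal_ne_top]
  refine lintegral_congr fun c => ?_
  rw [← lintegral_mul_const' _ _ ENNReal.ofReal_ne_top,
    ← lintegral_mul_const' _ _ ENNReal.ofReal_ne_top,
    ← lintegral_mul_const' _ _ ENNReal.ofReal_ne_top]
  have hm := h.comp (f := fun d : (Fin 3 → ℝ) × ℝ =>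
    (((![a.1, b.1, c.1], ![a.2, b.2, c.2]), d.1), d.2)) (by fun_prop)
  refine Eq.trans ?_ (lintegral_prod _ hm.aemeasurable)
  rw [← Measure.volume_eq_prod]
  refine lintegral_congr fun d => ?_
  rw [← ENNReal.ofReal_mul (abs_nonneg _),
    ← ENNReal.ofReal_mul (mul_nonneg (abs_nonneg _) (pairWeight_nonneg _)),
    ← ENNReal.ofReal_mul (mul_nonneg (mul_nonneg (abs_nonneg _) (pairWeight_nonneg _))
      (pairWeight_nonneg _)),
    ← ENNReal.ofReal_mul (mul_nonneg (mul_nonneg (mul_nonneg (abs_nonneg _)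
      (pairWeight_nonneg _)) (pairWeight_nonneg _)) (pairWeight_nonneg _))]
  simp only [Function.comp_apply, rowDet, pairWeight, Fin.prod_univ_three, Matrix.cons_val]
  ring_nf

theorem setLIntegral_abs_det_edgeMatrix :
    24 ^ 4 * ∫⁻ x in cornerSimplex, ∫⁻ y in cornerSimplex, ∫⁻ z in cornerSimplex,
      ∫⁻ w in cornerSimplex, ENNReal.ofReal |(edgeMatrix x y z w).det| =
      ENNReal.ofReal (256 * (13 / 720 - Real.pi ^ 2 / 15015)) := by
  simp only [← rowDet_barycentric]
  rw [← lintegral_four_mul_pairWeight (F := fun a b c d => ENNReal.ofReal |rowDet a b c d|),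
    lintegral_abs_rowDet_mul_pairWeight]
  · simp only [rowDet_eq]
    fun_prop
  all_goals
    intro s hs a b c d
    rw [← ENNReal.ofReal_mul hs.le, ← abs_of_pos hs, ← abs_mul, abs_of_pos hs]
    simp only [rowDet_eq, Prod.smul_fst, Prod.smul_snd, Pi.smul_apply, smul_eq_mul]
    ring_nf

theorem measurable_det_edgeMatrix :
    Measurable fun q : (Fin 3 → ℝ) × (Fin 3 → ℝ) × (Fin 3 → ℝ) × (Fin 3 → ℝ) =>
      (edgeMatrix q.1 q.2.1 q.2.2.1 q.2.2.2).det := by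
  simp only [← rowDet_barycentric, rowDet_eq]
  fun_prop

theorem volume_convexHull_simplexMap {A B C D : EuclideanSpace ℝ (Fin 3)}
    (h : |(edgeMatrix A.ofLp B.ofLp C.ofLp D.ofLp).det| = 6) (x y z w : Fin 3 → ℝ) :
    volume (convexHull ℝ {simplexMap A B C D x, simplexMap A B C D y, simplexMap A B C D z,
      simplexMap A B C D w}) = ENNReal.ofReal |(edgeMatrix x y z w).det| := by
  rw [volume_convexHull_four]
  simp only [ofLp_simplexMap]
  rw [edgeMatrix_simplexMap, Matrix.det_mul, abs_mul, h, mul_div_assoc, div_self (by norm_num),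
    mul_one]

theorem setLIntegral_volume_convexHull {A B C D : EuclideanSpace ℝ (Fin 3)}
    (h : |(edgeMatrix A.ofLp B.ofLp C.ofLp D.ofLp).det| = 6) :
    ∫⁻ x in convexHull ℝ {A, B, C, D}, ∫⁻ y in convexHull ℝ {A, B, C, D},
      ∫⁻ z in convexHull ℝ {A, B, C, D}, ∫⁻ w in convexHull ℝ {A, B, C, D},
        volume (convexHull ℝ {x, y, z, w}) =
      ENNReal.ofReal (13 / 720 - Real.pi ^ 2 / 15015) := by
  have h0 : (edgeMatrix A.ofLp B.ofLp C.ofLp D.ofLp).det ≠ 0 := fun h' => by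
    rw [h', abs_zero] at h
    norm_num at h
  have hc : ENNReal.ofReal 6 ≠ ⊤ := ENNReal.ofReal_ne_top
  have e := setLIntegral_abs_det_edgeMatrix
  rw [ENNReal.ofReal_mul (by norm_num), show (24 : ENNReal) ^ 4 = ENNReal.ofReal 256 *
    ENNReal.ofReal 6 ^ 4 by
      rw [ENNReal.ofReal_ofNat, ENNReal.ofReal_ofNat]; norm_num, mul_assoc,
    ENNReal.mul_right_inj (by simp) ENNReal.ofReal_ne_top] at e
  simp only [setLIntegral_convexHull_four h0, h, volume_convexHull_simplexMap h,
    lintegral_const_mul' _ _ hc]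
  rw [← e]
  ring

theorem setIntegral_toReal_of_le_one {α : Type*} [MeasurableSpace α] {μ : Measure α} {s : Set α}
    (hs : MeasurableSet s) {f : α → ENNReal} {g : α → ℝ} (hf : Measurable f)
    (h : ∀ x ∈ s, f x ≤ 1) (hg : ∀ x ∈ s, g x = (f x).toReal) :
    ∫ x in s, g x ∂μ = (∫⁻ x in s, f x ∂μ).toReal := by
  rw [setIntegral_congr_fun hs hg]
  refine integral_toReal hf.aemeasurable ?_
  filter_upwards [ae_restrict_mem hs] with x hx
  exact (h x hx).trans_lt ENNReal.one_lt_top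

theorem setLIntegral_le_one {α : Type*} [MeasurableSpace α] {μ : Measure α} {s : Set α}
    (hs : MeasurableSet s) (hμ : μ s = 1) {f : α → ENNReal} (h : ∀ x ∈ s, f x ≤ 1) :
    ∫⁻ x in s, f x ∂μ ≤ 1 :=
  (setLIntegral_mono' hs h).trans (by rw [setLIntegral_const, hμ, one_mul])

theorem measurable_volume_convexHull_four :
    Measurable fun q : EuclideanSpace ℝ (Fin 3) × EuclideanSpace ℝ (Fin 3) ×
      EuclideanSpace ℝ (Fin 3) × EuclideanSpace ℝ (Fin 3) =>
        volume (convexHull ℝ {q.1, q.2.1, q.2.2.1, q.2.2.2}) := by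
  have hm : Measurable (WithLp.ofLp : EuclideanSpace ℝ (Fin 3) → Fin 3 → ℝ) :=
    measurableEmbedding_ofLp.measurable
  have h := measurable_det_edgeMatrix.comp (f := fun q : EuclideanSpace ℝ (Fin 3) ×
    EuclideanSpace ℝ (Fin 3) × EuclideanSpace ℝ (Fin 3) × EuclideanSpace ℝ (Fin 3) =>
      (q.1.ofLp, q.2.1.ofLp, q.2.2.1.ofLp, q.2.2.2.ofLp)) (by fun_prop)
  simp only [volume_convexHull_four]
  exact ENNReal.measurable_ofReal.comp ((measurable_abs.comp h).div_const 6)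

theorem setIntegral_volume_convexHull {T : Set (EuclideanSpace ℝ (Fin 3))} (hT : MeasurableSet T)
    (hc : Convex ℝ T) (hv : volume T = 1) :
    ∫ x in T, ∫ y in T, ∫ z in T, ∫ w in T, (volume (convexHull ℝ {x, y, z, w})).toReal =
      (∫⁻ x in T, ∫⁻ y in T, ∫⁻ z in T, ∫⁻ w in T,
        volume (convexHull ℝ {x, y, z, w})).toReal := by
  have m₄ := measurable_volume_convexHull_four
  have m₃ := measurable_setLIntegral_comp (μ := volume.restrict T) m₄
    (g := fun (q : EuclideanSpace ℝ (Fin 3) × EuclideanSpace ℝ (Fin 3) ×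
      EuclideanSpace ℝ (Fin 3)) w => (q.1, q.2.1, q.2.2, w)) (by fun_prop)
  have m₂ := measurable_setLIntegral_comp (μ := volume.restrict T) m₃
    (g := fun (q : EuclideanSpace ℝ (Fin 3) × EuclideanSpace ℝ (Fin 3)) z => (q.1, q.2, z))
    (by fun_prop)
  have m₁ := measurable_setLIntegral_comp (μ := volume.restrict T) m₂
    (g := fun (q : EuclideanSpace ℝ (Fin 3)) y => (q, y)) (by fun_prop)
  have b₃ : ∀ x ∈ T, ∀ y ∈ T, ∀ z ∈ T, ∀ w ∈ T, volume (convexHull ℝ {x, y, z, w}) ≤ 1 := by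
    intro x hx y hy z hz w hw
    rw [← hv]
    refine measure_mono (convexHull_min ?_ hc)
    rintro _ (rfl | rfl | rfl | rfl) <;> assumption
  have b₂ := fun x hx y hy z hz => setLIntegral_le_one hT hv (b₃ x hx y hy z hz)
  have b₁ := fun x hx y hy => setLIntegral_le_one hT hv (b₂ x hx y hy)
  have b₀ := fun x hx => setLIntegral_le_one hT hv (b₁ x hx)
  refine setIntegral_toReal_of_le_one hT m₁ b₀ fun x hx => ?_
  refine setIntegral_toReal_of_le_one hT (m₂.comp (f := fun y => (x, y)) (by fun_prop))
    (b₁ x hx) fun y hy => ?_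
  refine setIntegral_toReal_of_le_one hT (m₃.comp (f := fun z => (x, y, z)) (by fun_prop))
    (b₂ x hx y hy) fun z hz => ?_
  exact setIntegral_toReal_of_le_one hT (m₄.comp (f := fun w => (x, y, z, w)) (by fun_prop))
    (b₃ x hx y hy z hz) fun w hw => rfl

/-- The expected volume of the tetrahedron spanned by four i.i.d. uniform random points
in a tetrahedron of volume 1 equals `13/720 − π²/15015`. -/
theorem stmt_7 (A B C D : EuclideanSpace ℝ (Fin 3))
    (hT : volume (convexHull ℝ {A, B, C, D}) = 1) :
    (∫ x₀ in convexHull ℝ {A, B, C, D}, ∫ x₁ in convexHull ℝ {A, B, C, D},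
        ∫ x₂ in convexHull ℝ {A, B, C, D}, ∫ x₃ in convexHull ℝ {A, B, C, D},
          (volume (convexHull ℝ {x₀, x₁, x₂, x₃})).toReal)
      = 13 / 720 - Real.pi ^ 2 / 15015 := by
  have hm : MeasurableSet (convexHull ℝ {A, B, C, D}) :=
    ((Set.toFinite {A, B, C, D}).isCompact_convexHull ℝ).isClosed.measurableSet
  have hd : |(edgeMatrix A.ofLp B.ofLp C.ofLp D.ofLp).det| = 6 := by
    have h := hT
    rw [volume_convexHull_four, ENNReal.ofReal_eq_one] at h
    linarith
  rw [setIntegral_volume_convexHull hm (convex_convexHull ℝ _) hT,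
    setLIntegral_volume_convexHull hd, ENNReal.toReal_ofReal]
  nlinarith [Real.pi_pos, Real.pi_lt_four]
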